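/- Let p be prime and A, B ⊆ 𝔽_p be sets such that C₄(A,B)² · log|A| ≤ p·|A|⁵|B|⁴ and |A|⁵|B|⁶ ≤ p⁹. Then C₅(A,B) − |B||A|⁵ − |A||B|⁵ ≪ |B||A|⁴ + |A||B|⁴ + (E⁺(A)·E⁺(B))^{1/12} · C₄(A,B)^{1/2} · |A|^{5/3}|B|^{4/3} log^{1/3}|A| + (Ē^×(A)·Ē^×(B))^{1/4} · |A|^{5/2}|B|² log^{3/2}|A|, where ≪ denotes an inequality up to an absolute multiplicative constant. -/

import Mathlib

open scoped Classical Pointwise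

noncomputable section

/-- Number of collinear `k`-tuples of points of `A × B`. -/
def Ctuples (F : Type*) [Field F] (k : ℕ) (A B : Finset F) : ℕ :=
  ((Fintype.piFinset fun _ : Fin k => A ×ˢ B).filter fun f => Collinear F (Set.range f)).card

/-- Additive energy of two finite sets. -/
def addE (F : Type*) [Field F] (A B : Finset F) : ℕ :=
  (((A ×ˢ A) ×ˢ B ×ˢ B).filter fun q => q.1.1 - q.2.1 = q.1.2 - q.2.2).card

/-- Multiplicative energy of two finite sets. -/
def mulE (F : Type*) [Field F] (A B : Finset F) : ℕ :=
  (((A ×ˢ A) ×ˢ B ×ˢ B).filter fun q => q.1.1 * q.2.2 = q.1.2 * q.2.1).card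

/-- `max_s E^×(A - s)`. -/
def mulEbar (F : Type*) [Field F] (A : Finset F) : ℕ :=
  ⨆ s : F, mulE F (A.image fun a => a - s) (A.image fun a => a - s)

def repSub (F : Type*) [Field F] (A B : Finset F) (x : F) : ℕ :=
  ((A ×ˢ B).filter fun q => q.1 - q.2 = x).card

def addEk (F : Type*) [Field F] (k : ℕ) (A : Finset F) : ℕ :=
  ∑ x ∈ A - A, repSub F A A x ^ k

def repDiv (F : Type*) [Field F] (A B : Finset F) (x : F) : ℕ :=
  ((A ×ˢ B).filter fun q => q.2 ≠ 0 ∧ q.1 / q.2 = x).card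

def mulEk (F : Type*) [Field F] (k : ℕ) (A : Finset F) : ℕ :=
  ∑ x ∈ A / A, repDiv F A A x ^ k

def mulEkbar (F : Type*) [Field F] (k : ℕ) (A : Finset F) : ℕ :=
  ⨆ s : F, mulEk F k (A.image fun a => a - s)

/-- Number of points of `A × B` on the graph of `x ↦ l.1 * x + l.2`. -/
def nPts {F : Type*} [Field F] (A B : Finset F) (l : F × F) : ℕ :=
  ((A ×ˢ B).filter fun q => q.2 = l.1 * q.1 + l.2).card

/-- τ-rich lines of `𝓛`. -/
def Lrich {F : Type*} [Field F] (A B : Finset F) (L : Finset (F × F)) (τ : ℝ) : Finset (F × F) :=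
  L.filter fun l => τ ≤ (nPts A B l : ℝ)

def affMap {F : Type*} [Field F] (l : F × F) : F → F := fun x => l.1 * x + l.2

def affInv {F : Type*} [Field F] (l : F × F) : F → F := fun x => (x - l.2) / l.1

/-- alternating product `l₁ ∘ l₂⁻¹ ∘ l₃ ∘ l₄⁻¹ ∘ ⋯` in the affine group. -/
def altAff {F : Type*} [Field F] {k : ℕ} (a : Fin k → F × F) : F → F :=
  (List.ofFn fun i : Fin k => if (i : ℕ) % 2 = 0 then affMap (a i) else affInv (a i)).foldr
    (· ∘ ·) id

def TaffSet {F : Type*} [Field F] (k : ℕ) (L : Finset (F × F)) : ℕ :=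
  (((Fintype.piFinset fun _ : Fin k => L) ×ˢ Fintype.piFinset fun _ : Fin k => L).filter
    fun q => altAff q.1 = altAff q.2).card

def affEnergy {F : Type*} [Field F] (L : Finset (F × F)) : ℕ :=
  (((L ×ˢ L) ×ˢ L ×ˢ L).filter fun q =>
    affMap q.1.1 ∘ affInv q.1.2 = affMap q.2.1 ∘ affInv q.2.2).card

/-- incidences between `A × B` and the graphs of the maps in `L`. -/
def nInc {F : Type*} [Field F] (A B : Finset F) (L : Finset (F × F)) : ℕ :=
  (((A ×ˢ B) ×ˢ L).filter fun q => q.1.2 = q.2.1 * q.1.1 + q.2.2).card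

/-- balanced function of `A ⊆ 𝔽_p`. -/
def balanced {p : ℕ} [NeZero p] (A : Finset (ZMod p)) : ZMod p → ℝ :=
  fun x => (if x ∈ A then 1 else 0) - (A.card : ℝ) / p

def addEfun {p : ℕ} [NeZero p] (f : ZMod p → ℝ) : ℝ :=
  ∑ x, ∑ y, ∑ z, ∑ w, if x - y = z - w then f x * f y * f z * f w else 0

def mulEfun {p : ℕ} [NeZero p] (f : ZMod p → ℝ) : ℝ :=
  ∑ x, ∑ y, ∑ z, ∑ w, if x * w = z * y then f x * f y * f z * f w else 0

def mulEbarFun {p : ℕ} [NeZero p] (f : ZMod p → ℝ) : ℝ :=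
  ⨆ s : ZMod p, mulEfun fun x => f (x + s)

/-- a line in the plane: `inl (a,b)` is `y = a x + b`, `inr c` is `x = c`. -/
def onLine {F : Type*} [Field F] (l : (F × F) ⊕ F) (q : F × F) : Prop :=
  match l with
  | .inl ab => q.2 = ab.1 * q.1 + ab.2
  | .inr c => q.1 = c

def iLine {F : Type*} [Field F] (A B : Finset F) (l : (F × F) ⊕ F) : ℕ :=
  ((A ×ˢ B).filter fun q => onLine l q).card

def altSum {M : Type*} [AddCommGroup M] {k : ℕ} (x : Fin k → M) : M :=
  ∑ i : Fin k, if (i : ℕ) % 2 = 0 then x i else -x i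

def TaddSet {M : Type*} [AddCommGroup M] (k : ℕ) (A : Finset M) : ℕ :=
  (((Fintype.piFinset fun _ : Fin k => A) ×ˢ Fintype.piFinset fun _ : Fin k => A).filter
    fun q => altSum q.1 = altSum q.2).card

def TaddFun {p : ℕ} [NeZero p] (k : ℕ) (f : ZMod p → ℝ) : ℝ :=
  ∑ x : Fin k → ZMod p, ∑ y : Fin k → ZMod p,
    if altSum x = altSum y then (∏ i, f (x i)) * ∏ i, f (y i) else 0

def TaffFun {p : ℕ} [Fact p.Prime] (k : ℕ) (f : ZMod p × ZMod p → ℝ) : ℝ :=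
  ∑ a ∈ Fintype.piFinset fun _ : Fin k => (Finset.univ.filter fun l : ZMod p × ZMod p => l.1 ≠ 0),
    ∑ b ∈ Fintype.piFinset fun _ : Fin k => (Finset.univ.filter fun l : ZMod p × ZMod p => l.1 ≠ 0),
      if altAff a = altAff b then (∏ i, f (a i)) * ∏ i, f (b i) else 0

/-- `Ẽ^×_k (X, Y)`. -/
def tmulEk (F : Type*) [Field F] (k : ℕ) (X Y : Finset F) : ℕ :=
  (((Fintype.piFinset fun _ : Fin k => X.erase 0) ×ˢ
      Fintype.piFinset fun _ : Fin k => Y.erase 0).filter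
    fun q => ∀ i j : Fin k, q.1 i * q.2 j = q.1 j * q.2 i).card

def addEkG {G : Type*} [AddCommGroup G] (k : ℕ) (A : Finset G) : ℕ :=
  ∑ x ∈ A - A, (((A ×ˢ A).filter fun q => q.1 - q.2 = x).card) ^ k

end

section LightLines

open Polynomial

variable {F : Type*} [Field F]

/-- The point with parameter `t` on the light line attached to `v = (x, a, b)`. -/
def linePoint (v : F × F × F) (t : F) : Fin 3 → F :=
  ![v.2.2 - v.2.1 * v.1 + v.1 ^ 2 * t, v.2.1 - v.1 * t, t]

/-- Restriction of a polynomial in three variables to the light line attached to `v`. -/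
noncomputable def lineRestrict (v : F × F × F) : MvPolynomial (Fin 3) F →ₐ[F] F[X] :=
  MvPolynomial.aeval ![C (v.2.2 - v.2.1 * v.1) + C (v.1 ^ 2) * X, C v.2.1 - C v.1 * X, X]

/-- The derivative in the direction of the light lines with slope parameter `x`. -/
noncomputable def dirD (x : F) :
    Derivation F (MvPolynomial (Fin 3) F) (MvPolynomial (Fin 3) F) :=
  (x ^ 2) • MvPolynomial.pderiv 0 - x • MvPolynomial.pderiv 1 + MvPolynomial.pderiv 2

/-- A derivation transversal to `dirD x` inside the light cone geometry. -/
noncomputable def dirS (x : F) :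
    Derivation F (MvPolynomial (Fin 3) F) (MvPolynomial (Fin 3) F) :=
  MvPolynomial.pderiv 1 - (2 * x) • MvPolynomial.pderiv 0

/-- The derivation `∂/∂r`. -/
noncomputable abbrev dirR :
    Derivation F (MvPolynomial (Fin 3) F) (MvPolynomial (Fin 3) F) :=
  MvPolynomial.pderiv 0

theorem eval_lineRestrict (v : F × F × F) (f : MvPolynomial (Fin 3) F) (t : F) :
    (lineRestrict v f).eval t = MvPolynomial.eval (linePoint v t) f := by
  induction f using MvPolynomial.induction_on with
  | C a => simp [lineRestrict]
  | add f g hf hg => simp [hf, hg]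
  | mul_X f i hf =>
    rw [map_mul, eval_mul, hf, map_mul]
    congr 1
    fin_cases i <;> simp [lineRestrict, linePoint]

theorem natDegree_lineRestrict_le (v : F × F × F) (f : MvPolynomial (Fin 3) F) :
    (lineRestrict v f).natDegree ≤ f.totalDegree := by
  have := MvPolynomial.aeval_natDegree_le f (le_refl f.totalDegree)
    ![C (v.2.2 - v.2.1 * v.1) + C (v.1 ^ 2) * X, C v.2.1 - C v.1 * X, X] (n := 1) (by
      intro i
      fin_cases i
      · simp; compute_degree
      · simp; compute_degree
      · simp)
  simpa [lineRestrict] using this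

theorem derivative_lineRestrict (v : F × F × F) (f : MvPolynomial (Fin 3) F) :
    derivative (lineRestrict v f) = lineRestrict v (dirD v.1 f) := by
  induction f using MvPolynomial.induction_on with
  | C a => simp [lineRestrict, dirD, MvPolynomial.algHom_C]
  | add f g hf hg => simp [hf, hg]
  | mul_X f i hf =>
    rw [map_mul, derivative_mul, hf, Derivation.leibniz, map_add, smul_eq_mul, smul_eq_mul,
      map_mul, map_mul, add_comm, mul_comm (lineRestrict v (dirD v.1 f))]
    congr 2
    fin_cases i <;> simp [lineRestrict, dirD, MvPolynomial.pderiv_X,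
      Algebra.smul_def, derivative_pow]

theorem pderiv_pderiv_swap (i j : Fin 3) (f : MvPolynomial (Fin 3) F) :
    MvPolynomial.pderiv i (MvPolynomial.pderiv j f) =
      MvPolynomial.pderiv j (MvPolynomial.pderiv i f) := by
  have h : ⁅(MvPolynomial.pderiv i : Derivation F (MvPolynomial (Fin 3) F) (MvPolynomial (Fin 3) F)),
      (MvPolynomial.pderiv j : Derivation F (MvPolynomial (Fin 3) F) (MvPolynomial (Fin 3) F))⁆
      = 0 := by
    apply MvPolynomial.derivation_ext
    intro k
    fin_cases i <;> fin_cases j <;> fin_cases k <;>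
      simp [Derivation.commutator_apply, MvPolynomial.pderiv_X]
  have := congrArg (fun D => D f) h
  simpa [Derivation.commutator_apply, sub_eq_zero] using this

theorem dirD_dirS_swap (x : F) (f : MvPolynomial (Fin 3) F) :
    dirD x (dirS x f) = dirS x (dirD x f) := by
  simp only [dirD, dirS, Derivation.add_apply, Derivation.sub_apply, Derivation.smul_apply,
    map_add, map_sub, Derivation.map_smul]
  rw [pderiv_pderiv_swap 2 1, pderiv_pderiv_swap 2 0, pderiv_pderiv_swap 1 0]
  module

theorem dirD_dirR_swap (x : F) (f : MvPolynomial (Fin 3) F) :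
    dirD x (dirR f) = dirR (dirD x f) := by
  simp only [dirD, dirR, Derivation.add_apply, Derivation.sub_apply, Derivation.smul_apply,
    map_add, map_sub, Derivation.map_smul]
  rw [pderiv_pderiv_swap 2 0, pderiv_pderiv_swap 1 0]

/-- The ruling polynomial: it vanishes where two light lines on the surface `f = 0` cross. -/
noncomputable def ruling (x : F) (f : MvPolynomial (Fin 3) F) : MvPolynomial (Fin 3) F :=
  dirR f ^ 2 * (dirS x f * dirD x (dirD x f) - 2 * dirD x f * dirD x (dirS x f)) -
    dirD x f ^ 2 * (dirS x f * dirR (dirR f) - 2 * dirR f * dirS x (dirR f))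

theorem totalDegree_pderiv_add_one_le (i : Fin 3) (f : MvPolynomial (Fin 3) F)
    (h : MvPolynomial.pderiv i f ≠ 0) :
    (MvPolynomial.pderiv i f).totalDegree + 1 ≤ f.totalDegree := by
  obtain ⟨m, hm, hd⟩ := Finset.exists_mem_eq_sup _ (MvPolynomial.support_nonempty.2 h)
    (fun s : Fin 3 →₀ ℕ => s.sum fun _ e => e)
  have hc : MvPolynomial.coeff (m + Finsupp.single i 1) f ≠ 0 := by
    intro h0
    rw [MvPolynomial.mem_support_iff, MvPolynomial.coeff_pderiv, h0] at hm
    simp at hm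
  have := MvPolynomial.le_totalDegree (MvPolynomial.mem_support_iff.2 hc)
  rw [Finsupp.sum_add_index' (by simp) (by simp)] at this
  rw [MvPolynomial.totalDegree, hd]
  simpa using this

theorem totalDegree_pderiv_le (i : Fin 3) (f : MvPolynomial (Fin 3) F) :
    (MvPolynomial.pderiv i f).totalDegree ≤ f.totalDegree := by
  by_cases h : MvPolynomial.pderiv i f = 0
  · simp [h]
  · exact (Nat.le_succ _).trans (totalDegree_pderiv_add_one_le i f h)

theorem totalDegree_dirD_le (x : F) (f : MvPolynomial (Fin 3) F) :
    (dirD x f).totalDegree ≤ f.totalDegree := by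
  refine (MvPolynomial.totalDegree_add _ _).trans (max_le ?_ (totalDegree_pderiv_le _ _))
  refine (MvPolynomial.totalDegree_sub _ _).trans (max_le ?_ ?_) <;>
  exact (MvPolynomial.totalDegree_smul_le _ _).trans (totalDegree_pderiv_le _ _)

theorem totalDegree_dirS_le (x : F) (f : MvPolynomial (Fin 3) F) :
    (dirS x f).totalDegree ≤ f.totalDegree := by
  refine (MvPolynomial.totalDegree_sub _ _).trans (max_le (totalDegree_pderiv_le _ _) ?_)
  exact (MvPolynomial.totalDegree_smul_le _ _).trans (totalDegree_pderiv_le _ _)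

theorem totalDegree_ruling_le (x : F) (f : MvPolynomial (Fin 3) F) :
    (ruling x f).totalDegree ≤ 4 * f.totalDegree := by
  have hm : ∀ {p q : MvPolynomial (Fin 3) F} {m n : ℕ}, p.totalDegree ≤ m → q.totalDegree ≤ n →
      (p * q).totalDegree ≤ m + n := fun hp hq =>
    (MvPolynomial.totalDegree_mul _ _).trans (add_le_add hp hq)
  have hs : ∀ {p q : MvPolynomial (Fin 3) F} {m : ℕ}, p.totalDegree ≤ m → q.totalDegree ≤ m →
      (p - q).totalDegree ≤ m := fun hp hq =>
    (MvPolynomial.totalDegree_sub _ _).trans (max_le hp hq)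
  have h2 : (2 : MvPolynomial (Fin 3) F).totalDegree ≤ 0 := by
    have : (2 : MvPolynomial (Fin 3) F) = MvPolynomial.C 2 := (map_ofNat MvPolynomial.C 2).symm
    rw [this, MvPolynomial.totalDegree_C]
  set d := f.totalDegree
  have hR := totalDegree_pderiv_le 0 f
  have hD := totalDegree_dirD_le x f
  have hS := totalDegree_dirS_le x f
  have hDD := (totalDegree_dirD_le x (dirD x f)).trans hD
  have hDS := (totalDegree_dirD_le x (dirS x f)).trans hS
  have hRR := (totalDegree_pderiv_le 0 (dirR f)).trans hR
  have hSR := (totalDegree_dirS_le x (dirR f)).trans hR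
  have e : 4 * d = (d + d) + (d + d) := by ring
  have e2 : d + d = 0 + d + d := by ring
  rw [ruling, sq, sq, e]
  refine hs (hm (hm hR hR) (hs (hm hS hDD) ?_)) (hm (hm hD hD) (hs (hm hS hRR) ?_))
  · rw [e2]; exact hm (hm h2 hD) hDS
  · rw [e2]; exact hm (hm h2 hR) hSR

/-- Two light lines of distinct directions on `f = 0` cross only where `ruling x f` vanishes. -/
theorem eval_ruling_eq_zero {f : MvPolynomial (Fin 3) F} (P : Fin 3 → F) {x₁ x₂ : F}
    (hx : x₁ ≠ x₂) (h₁ : MvPolynomial.eval P (dirD x₁ f) = 0)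
    (h₂ : MvPolynomial.eval P (dirD x₂ f) = 0)
    (h₁' : MvPolynomial.eval P (dirD x₁ (dirD x₁ f)) = 0)
    (h₂' : MvPolynomial.eval P (dirD x₂ (dirD x₂ f)) = 0) (x : F) :
    MvPolynomial.eval P (ruling x f) = 0 := by
  simp only [ruling, dirD, dirS, dirR, Derivation.add_apply, Derivation.sub_apply,
    Derivation.smul_apply, map_add, map_sub, Derivation.map_smul, map_mul, map_pow,
    MvPolynomial.smul_eval, pderiv_pderiv_swap 1 0, pderiv_pderiv_swap 2 0,
    pderiv_pderiv_swap 2 1, map_ofNat] at *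
  generalize MvPolynomial.eval P (MvPolynomial.pderiv 0 f) = fr at *
  generalize MvPolynomial.eval P (MvPolynomial.pderiv 1 f) = fs at *
  generalize MvPolynomial.eval P (MvPolynomial.pderiv 2 f) = ft at *
  generalize MvPolynomial.eval P (MvPolynomial.pderiv 0 (MvPolynomial.pderiv 0 f)) = frr at *
  generalize MvPolynomial.eval P (MvPolynomial.pderiv 0 (MvPolynomial.pderiv 1 f)) = frs at *
  generalize MvPolynomial.eval P (MvPolynomial.pderiv 0 (MvPolynomial.pderiv 2 f)) = frt at *
  generalize MvPolynomial.eval P (MvPolynomial.pderiv 1 (MvPolynomial.pderiv 1 f)) = fss at *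
  generalize MvPolynomial.eval P (MvPolynomial.pderiv 1 (MvPolynomial.pderiv 2 f)) = fst at *
  generalize MvPolynomial.eval P (MvPolynomial.pderiv 2 (MvPolynomial.pderiv 2 f)) = ftt at *
  have hs : fs = (x₁ + x₂) * fr := by
    apply mul_left_cancel₀ (sub_ne_zero.2 hx)
    linear_combination h₂ - h₁
  have ht : ft = x₁ * x₂ * fr := by
    linear_combination h₁ + x₁ * hs
  subst hs ht
  apply mul_left_cancel₀ (sub_ne_zero.2 hx.symm)
  linear_combination (fr ^ 3 * (x₂ - x) ^ 2) * h₁' - (fr ^ 3 * (x₁ - x) ^ 2) * h₂'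

theorem lineRestrict_ruling_identity (v : F × F × F) (f : MvPolynomial (Fin 3) F)
    (hf : lineRestrict v f = 0) (hdvd : f ∣ ruling v.1 f) :
    let G := lineRestrict v (dirR f)
    let H := lineRestrict v (dirS v.1 f)
    G ^ 2 * (H * (H * derivative (derivative G) - derivative (derivative H) * G)
      - 2 * (H * derivative G - G * derivative H) * derivative H) = 0 := by
  intro G H
  obtain ⟨Q, hQ⟩ := hdvd
  set x := v.1 with hx
  have hD : lineRestrict v (dirD x f) = 0 := by rw [← derivative_lineRestrict, hf, map_zero]
  have hDD : lineRestrict v (dirD x (dirD x f)) = 0 := by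
    rw [← derivative_lineRestrict, hD, map_zero]
  let τ : Derivation F (MvPolynomial (Fin 3) F) (MvPolynomial (Fin 3) F) :=
    (dirS x f) • (dirR : Derivation F (MvPolynomial (Fin 3) F) (MvPolynomial (Fin 3) F))
      - (dirR f) • dirS x
  have hτ : ∀ p, τ p = dirS x f * dirR p - dirR f * dirS x p := fun p => rfl
  have hτf : τ f = 0 := by rw [hτ]; ring
  have key : lineRestrict v (τ (ruling x f)) = 0 := by
    rw [hQ, Derivation.leibniz, hτf]
    simp [hf]
  have hτD : lineRestrict v (τ (dirD x f)) = H * derivative G - G * derivative H := by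
    rw [hτ, ← dirD_dirR_swap, ← dirD_dirS_swap, derivative_lineRestrict, derivative_lineRestrict]
    simp [G, H, hx]
  have hτDD : lineRestrict v (τ (dirD x (dirD x f))) =
      H * derivative (derivative G) - G * derivative (derivative H) := by
    rw [hτ, ← dirD_dirR_swap, ← dirD_dirS_swap, ← dirD_dirR_swap, ← dirD_dirS_swap]
    simp [G, H, hx, derivative_lineRestrict]
  have hDS : lineRestrict v (dirD x (dirS x f)) = derivative H := by
    rw [derivative_lineRestrict]
  rw [ruling] at key
  have h2 : τ (2 : MvPolynomial (Fin 3) F) = 0 := by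
    have : (2 : MvPolynomial (Fin 3) F) = algebraMap F _ 2 := (map_ofNat (algebraMap F _) 2).symm
    rw [this, Derivation.map_algebraMap]
  simp only [Derivation.leibniz, map_sub, map_add, map_mul, smul_eq_mul, Derivation.leibniz_pow,
    hD, hDD, hτD, hτDD, hDS, map_pow, h2, map_ofNat, nsmul_eq_mul] at key
  have hG : lineRestrict v (dirR f) = G := rfl
  have hH : lineRestrict v (dirS x f) = H := rfl
  rw [hG, hH] at key
  linear_combination key

end LightLines

section Ruling

open Polynomial

variable {F : Type*} [Field F]

theorem natDegree_eq_zero_of_derivative_eq_zero_of_lt {p : ℕ} [CharP F p] {u : F[X]}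
    (hu : derivative u = 0) (hd : u.natDegree < p) : u.natDegree = 0 := by
  by_contra h
  obtain ⟨n, hn⟩ := Nat.exists_eq_succ_of_ne_zero h
  have h1 := congrArg (fun q => q.coeff n) hu
  simp only [coeff_derivative, coeff_zero, mul_eq_zero] at h1
  rcases h1 with h1 | h1
  · have : u.leadingCoeff = 0 := by rw [leadingCoeff, hn]; exact h1
    rw [leadingCoeff_eq_zero] at this
    simp [this] at h
  · have h2 : ((n + 1 : ℕ) : F) = 0 := by exact_mod_cast h1
    rw [CharP.cast_eq_zero_iff F p] at h2
    have := Nat.le_of_dvd (Nat.succ_pos _) h2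
    omega

theorem exists_eq_C_mul_of_wronskian_eq_zero {p : ℕ} [CharP F p] {u v : F[X]} (hv : v ≠ 0)
    (hud : u.natDegree < p) (hvd : v.natDegree < p)
    (h : derivative u * v = u * derivative v) : ∃ c : F, u = C c * v := by
  by_cases hu : u = 0
  · exact ⟨0, by simp [hu]⟩
  obtain ⟨u₁, v₁, hcop, hu₁, hv₁⟩ : ∃ u₁ v₁ : F[X], IsCoprime u₁ v₁ ∧
      u = gcd u v * u₁ ∧ v = gcd u v * v₁ := by
    obtain ⟨u₁, hu₁⟩ := gcd_dvd_left u v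
    obtain ⟨v₁, hv₁⟩ := gcd_dvd_right u v
    refine ⟨u₁, v₁, ?_, hu₁, hv₁⟩
    have hg : gcd u v ≠ 0 := fun h0 => hu ((gcd_eq_zero_iff _ _).1 h0).1
    obtain ⟨a, b, hab⟩ := exists_gcd_eq_mul_add_mul u v
    refine ⟨a, b, mul_left_cancel₀ hg ?_⟩
    linear_combination (-a) * hu₁ - b * hv₁ - hab
  set g := gcd u v with hgdef
  have hg : g ≠ 0 := fun h0 => hu (by rw [hu₁, h0, zero_mul])
  have hu0 : u₁ ≠ 0 := fun h0 => hu (by rw [hu₁, h0, mul_zero])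
  have hv0 : v₁ ≠ 0 := fun h0 => hv (by rw [hv₁, h0, mul_zero])
  have hW : derivative u₁ * v₁ = u₁ * derivative v₁ := by
    have h' := h
    rw [hu₁, hv₁, derivative_mul, derivative_mul] at h'
    apply mul_left_cancel₀ (mul_ne_zero hg hg)
    linear_combination h'
  have hlt : ∀ {q : F[X]}, q ≠ 0 → q ∣ derivative q → derivative q = 0 := by
    intro q hq hdv
    by_contra h0
    exact absurd (degree_le_of_dvd hdv h0) (not_le.2 (degree_derivative_lt hq))
  have hu' : derivative u₁ = 0 := hlt hu0 (hcop.dvd_of_dvd_mul_right ⟨_, hW⟩)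
  have hv' : derivative v₁ = 0 := hlt hv0 (hcop.symm.dvd_of_dvd_mul_left
    ⟨derivative u₁, by rw [← hW, mul_comm]⟩)
  have hdu : u₁.natDegree < p := by
    rw [hu₁, natDegree_mul hg hu0] at hud; omega
  have hdv : v₁.natDegree < p := by
    rw [hv₁, natDegree_mul hg hv0] at hvd; omega
  have e1 := eq_C_of_natDegree_eq_zero (natDegree_eq_zero_of_derivative_eq_zero_of_lt hu' hdu)
  have e2 := eq_C_of_natDegree_eq_zero (natDegree_eq_zero_of_derivative_eq_zero_of_lt hv' hdv)
  have hc : v₁.coeff 0 ≠ 0 := fun h0 => hv0 (by rw [e2, h0, C_0])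
  refine ⟨u₁.coeff 0 / v₁.coeff 0, ?_⟩
  rw [hu₁]
  rw [hv₁, e1, e2]
  simp only [coeff_C_zero]
  have : (C (u₁.coeff 0) : F[X]) = C (u₁.coeff 0 / v₁.coeff 0) * C (v₁.coeff 0) := by
    rw [← C_mul, div_mul_cancel₀ _ hc]
  rw [this]; ring

/-- On a line of a surface whose ruling polynomial vanishes identically, the two transversal
derivatives are proportional through a linear polynomial. -/
theorem exists_linear_mul_of_dvd_ruling {p : ℕ} [CharP F p] {v : F × F × F}
    {f : MvPolynomial (Fin 3) F} (hf : lineRestrict v f = 0) (hdvd : f ∣ ruling v.1 f)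
    (hdeg : 2 * f.totalDegree < p) (hG : lineRestrict v (dirR f) ≠ 0)
    (hH : lineRestrict v (dirS v.1 f) ≠ 0) :
    ∃ c e : F, lineRestrict v (dirR f) = (C c * X + C e) * lineRestrict v (dirS v.1 f) := by
  have key := lineRestrict_ruling_identity v f hf hdvd
  have hGd := (natDegree_lineRestrict_le v (dirR f)).trans (totalDegree_pderiv_le 0 f)
  have hHd := (natDegree_lineRestrict_le v (dirS v.1 f)).trans (totalDegree_dirS_le v.1 f)
  set G := lineRestrict v (dirR f)
  set H := lineRestrict v (dirS v.1 f)
  simp only [mul_eq_zero, pow_eq_zero_iff two_ne_zero, hG, false_or] at key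
  obtain ⟨c, hc⟩ : ∃ c : F, derivative G * H - G * derivative H = C c * H ^ 2 := by
    apply exists_eq_C_mul_of_wronskian_eq_zero (p := p) (pow_ne_zero 2 hH)
    · have hlt : f.totalDegree + f.totalDegree < p := by omega
      refine lt_of_le_of_lt ((natDegree_sub_le_of_le ?_ ?_).trans (max_self _).le) hlt
      · exact natDegree_mul_le_of_le ((natDegree_derivative_le G).trans ((Nat.sub_le _ _).trans hGd)) hHd
      · exact natDegree_mul_le_of_le hGd ((natDegree_derivative_le H).trans ((Nat.sub_le _ _).trans hHd))
    · exact lt_of_le_of_lt (natDegree_pow_le_of_le 2 hHd) hdeg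
    · simp only [derivative_sub, derivative_mul, derivative_pow]
      simp only [Nat.cast_ofNat, map_ofNat]
      linear_combination H * key
  by_cases h0 : f.totalDegree = 0
  · have hz : dirR f = 0 := by
      rw [MvPolynomial.totalDegree_eq_zero_iff_eq_C] at h0
      rw [h0, dirR, MvPolynomial.pderiv_C]
    exact absurd (by simp only [G, hz, map_zero]) hG
  obtain ⟨e, he⟩ : ∃ e : F, G - C c * X * H = C e * H := by
    apply exists_eq_C_mul_of_wronskian_eq_zero (p := p) hH
    · refine lt_of_le_of_lt (natDegree_sub_le_of_le (n := f.totalDegree + 1) (by omega)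
        ?_) (by omega)
      rw [add_comm]
      exact natDegree_mul_le_of_le (by compute_degree) hHd
    · omega
    · simp only [derivative_sub, derivative_mul, derivative_C, derivative_X]
      linear_combination hc
  exact ⟨c, e, by linear_combination he⟩

/-- Two light lines meet exactly when this form vanishes. -/
def lightForm (v w : F × F × F) : F :=
  v.2.2 - w.2.2 + v.2.1 * w.1 - w.2.1 * v.1

/-- The parameter of the crossing point of two meeting light lines. -/
def crossParam (v w : F × F × F) : F := (v.2.1 - w.2.1) / (v.1 - w.1)

theorem linePoint_crossParam {v w : F × F × F} (hx : w.1 ≠ v.1) (h : lightForm v w = 0) :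
    linePoint v (crossParam v w) = linePoint w (crossParam v w) := by
  have hx' : v.1 - w.1 ≠ 0 := sub_ne_zero.2 hx.symm
  have ht : crossParam v w * (v.1 - w.1) = v.2.1 - w.2.1 := div_mul_cancel₀ _ hx'
  rw [lightForm] at h
  simp only [linePoint]
  congr 1
  · linear_combination h + (v.1 + w.1) * ht
  · congr 1
    linear_combination -ht

theorem eval_dirD_of_lineRestrict_eq_zero {v : F × F × F} {f : MvPolynomial (Fin 3) F}
    (hf : lineRestrict v f = 0) (t : F) :
    MvPolynomial.eval (linePoint v t) (dirD v.1 f) = 0 ∧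
      MvPolynomial.eval (linePoint v t) (dirD v.1 (dirD v.1 f)) = 0 := by
  rw [← eval_lineRestrict, ← eval_lineRestrict, ← derivative_lineRestrict,
    ← derivative_lineRestrict, ← derivative_lineRestrict, hf]
  simp

theorem eval_ruling_crossParam {v w : F × F × F} {f : MvPolynomial (Fin 3) F}
    (hv : lineRestrict v f = 0) (hw : lineRestrict w f = 0) (hx : w.1 ≠ v.1)
    (h : lightForm v w = 0) (x : F) :
    (lineRestrict v (ruling x f)).eval (crossParam v w) = 0 := by
  obtain ⟨h1, h2⟩ := eval_dirD_of_lineRestrict_eq_zero hv (crossParam v w)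
  obtain ⟨h3, h4⟩ := eval_dirD_of_lineRestrict_eq_zero hw (crossParam v w)
  rw [← linePoint_crossParam hx h] at h3 h4
  rw [eval_lineRestrict]
  exact eval_ruling_eq_zero _ hx.symm h1 h3 h2 h4 x

theorem eval_dirS_crossParam {v w : F × F × F} {f : MvPolynomial (Fin 3) F}
    (hv : lineRestrict v f = 0) (hw : lineRestrict w f = 0) (hx : w.1 ≠ v.1)
    (h : lightForm v w = 0) :
    (lineRestrict v (dirS v.1 f)).eval (crossParam v w) =
      (w.1 - v.1) * (lineRestrict v (dirR f)).eval (crossParam v w) := by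
  obtain ⟨h1, -⟩ := eval_dirD_of_lineRestrict_eq_zero hv (crossParam v w)
  obtain ⟨h3, -⟩ := eval_dirD_of_lineRestrict_eq_zero hw (crossParam v w)
  rw [← linePoint_crossParam hx h] at h3
  rw [eval_lineRestrict, eval_lineRestrict]
  simp only [dirD, dirS, dirR, Derivation.add_apply, Derivation.sub_apply,
    Derivation.smul_apply, map_add, map_sub, MvPolynomial.smul_eval] at *
  apply mul_left_cancel₀ (sub_ne_zero.2 hx)
  linear_combination h1 - h3

theorem card_filter_eval_crossParam_le {v : F × F × F} {N : Finset (F × F × F)}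
    (hinj : Set.InjOn (crossParam v) N) {q : F[X]} (hq : q ≠ 0) :
    (N.filter fun w => q.eval (crossParam v w) = 0).card ≤ q.natDegree := by
  rw [← Finset.card_image_of_injOn (f := crossParam v)
    (hinj.mono (by intro w hw; exact (Finset.mem_filter.1 hw).1))]
  refine (Finset.card_le_card ?_).trans ((Multiset.toFinset_card_le _).trans (card_roots' q))
  intro t ht
  obtain ⟨w, hw, rfl⟩ := Finset.mem_image.1 ht
  rw [Multiset.mem_toFinset, mem_roots hq]
  exact (Finset.mem_filter.1 hw).2

theorem eq_zero_of_eval_crossParam {v : F × F × F} {N : Finset (F × F × F)}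
    (hinj : Set.InjOn (crossParam v) N) {q : F[X]} (hN : q.natDegree < N.card)
    (h : ∀ w ∈ N, q.eval (crossParam v w) = 0) : q = 0 := by
  by_contra hq
  have := card_filter_eval_crossParam_le hinj hq
  rw [Finset.filter_true_of_mem h] at this
  omega

/-- If the ruling polynomial vanishes on the surface, then a line with many well-spread neighbours
consists of singular points. -/
theorem lineRestrict_pderiv_eq_zero {p : ℕ} [CharP F p] {v : F × F × F}
    {f : MvPolynomial (Fin 3) F} (hf : lineRestrict v f = 0) (hdvd : f ∣ ruling v.1 f)
    (hdeg : 2 * f.totalDegree < p) {N : Finset (F × F × F)}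
    (hinj : Set.InjOn (crossParam v) N)
    (hN : ∀ w ∈ N, w.1 ≠ v.1 ∧ lightForm v w = 0 ∧ lineRestrict w f = 0) {k : ℕ}
    (hk : ∀ c e d : F, (c ≠ 0 ∨ e ≠ 0) →
      (N.filter fun w => c * w.2.1 + e * w.1 = d).card ≤ k)
    (hcard : f.totalDegree + k < N.card) (i : Fin 3) :
    lineRestrict v (MvPolynomial.pderiv i f) = 0 := by
  have hGd := (natDegree_lineRestrict_le v (dirR f)).trans (totalDegree_pderiv_le 0 f)
  have hHd := (natDegree_lineRestrict_le v (dirS v.1 f)).trans (totalDegree_dirS_le v.1 f)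
  have hrel : ∀ w ∈ N, (lineRestrict v (dirS v.1 f)).eval (crossParam v w) =
      (w.1 - v.1) * (lineRestrict v (dirR f)).eval (crossParam v w) := fun w hw =>
    eval_dirS_crossParam hf (hN w hw).2.2 (hN w hw).1 (hN w hw).2.1
  have hD : lineRestrict v (dirD v.1 f) = 0 := by rw [← derivative_lineRestrict, hf, map_zero]
  suffices hGH : lineRestrict v (dirR f) = 0 ∧ lineRestrict v (dirS v.1 f) = 0 by
    obtain ⟨hG, hH⟩ := hGH
    have h1 : lineRestrict v (MvPolynomial.pderiv 1 f) = 0 := by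
      simp only [dirS, Derivation.sub_apply, Derivation.smul_apply, map_sub, map_smul, hG] at hH
      simpa using hH
    have h2 : lineRestrict v (MvPolynomial.pderiv 2 f) = 0 := by
      simp only [dirD, Derivation.sub_apply, Derivation.add_apply, Derivation.smul_apply, map_sub,
        map_add, map_smul, hG, h1] at hD
      simpa using hD
    fin_cases i
    · exact hG
    · exact h1
    · exact h2
  by_cases hG : lineRestrict v (dirR f) = 0
  · refine ⟨hG, eq_zero_of_eval_crossParam hinj (by omega) fun w hw => ?_⟩
    rw [hrel w hw, hG]; simp
  by_cases hH : lineRestrict v (dirS v.1 f) = 0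
  · refine absurd (eq_zero_of_eval_crossParam hinj (by omega) fun w hw => ?_) hG
    have := hrel w hw
    rw [hH, eval_zero, eq_comm, mul_eq_zero] at this
    exact this.resolve_left (sub_ne_zero.2 (hN w hw).1)
  exfalso
  obtain ⟨c, e, hce⟩ := exists_linear_mul_of_dvd_ruling hf hdvd hdeg hG hH
  have hce0 : c ≠ 0 ∨ e ≠ 0 := by
    by_contra h
    push Not at h
    rw [h.1, h.2] at hce
    simp at hce
    exact hG hce
  have h1 := card_filter_eval_crossParam_le hinj hH
  have h2 := hk c e (1 + c * v.2.1 + e * v.1) hce0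
  have h3 : N ⊆ (N.filter fun w => (lineRestrict v (dirS v.1 f)).eval (crossParam v w) = 0) ∪
      N.filter fun w => c * w.2.1 + e * w.1 = 1 + c * v.2.1 + e * v.1 := by
    intro w hw
    rw [Finset.mem_union, Finset.mem_filter, Finset.mem_filter]
    by_cases h0 : (lineRestrict v (dirS v.1 f)).eval (crossParam v w) = 0
    · exact Or.inl ⟨hw, h0⟩
    refine Or.inr ⟨hw, ?_⟩
    have hr := hrel w hw
    rw [hce, eval_mul] at hr
    simp only [eval_add, eval_mul, eval_C, eval_X] at hr
    have ht : crossParam v w * (v.1 - w.1) = v.2.1 - w.2.1 :=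
      div_mul_cancel₀ _ (sub_ne_zero.2 (hN w hw).1.symm)
    have hr2 : (w.1 - v.1) * (c * crossParam v w + e) = 1 := by
      apply mul_right_cancel₀ h0
      linear_combination -hr
    linear_combination hr2 + c * ht
  have h4 := (Finset.card_le_card h3).trans (Finset.card_union_le _ _)
  omega

end Ruling

section BezoutLines

open Polynomial

variable {F : Type*} [Field F]

theorem sum_range_choose_two (N : ℕ) :
    ∑ i ∈ Finset.range (N + 1), (i + 2).choose i = (N + 3).choose 3 := by
  induction N with
  | zero => simp
  | succ N ih =>
    rw [Finset.sum_range_succ, ih, Nat.choose_symm_of_eq_add (show N + 1 + 2 = (N + 1) + 2 by ring),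
      show N + 1 + 3 = (N + 3) + 1 by ring, Nat.choose_succ_succ (N + 3) 2]
    ring

theorem finrank_restrictTotalDegree (N : ℕ) :
    Module.finrank F (MvPolynomial.restrictTotalDegree (Fin 3) F N) = (N + 3).choose 3 := by
  rw [MvPolynomial.restrictTotalDegree, Module.finrank_eq_nat_card_basis
    (MvPolynomial.basisRestrictSupport F _)]
  have hset : {m : Fin 3 →₀ ℕ | (m.sum fun _ e => e) ≤ N} =
      (((Finset.range (N + 1)).biUnion fun i => Finset.finsuppAntidiag Finset.univ i :
        Finset (Fin 3 →₀ ℕ)) : Set (Fin 3 →₀ ℕ)) := by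
    ext m
    have : (m.sum fun _ e => e) = ∑ i, m i := Finsupp.sum_fintype _ _ (by simp)
    simp [this]
  rw [hset, Nat.card_coe_set_eq, Set.ncard_coe_finset, Finset.card_biUnion, ← sum_range_choose_two]
  · refine Finset.sum_congr rfl fun i _ => ?_
    rw [Finset.card_finsuppAntidiag_nat_eq_choose]
    simp [add_comm]
  · intro i _ j _ hij
    refine Finset.disjoint_left.2 fun m hm hm' => hij ?_
    rw [Finset.mem_finsuppAntidiag] at hm hm'
    rw [← hm.1, hm'.1]

/-- Multiplication by a polynomial as a linear map. -/
noncomputable def mulPoly (f : MvPolynomial (Fin 3) F) :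
    MvPolynomial (Fin 3) F →ₗ[F] MvPolynomial (Fin 3) F := LinearMap.mulLeft F f

theorem mulPoly_apply (f g : MvPolynomial (Fin 3) F) : mulPoly f g = f * g := rfl

theorem mulPoly_injective {f : MvPolynomial (Fin 3) F} (hf : f ≠ 0) :
    Function.Injective (mulPoly f) := fun _ _ h => mul_left_cancel₀ hf h

theorem finrank_map_mulPoly {f : MvPolynomial (Fin 3) F} (hf : f ≠ 0) (N : ℕ) :
    Module.finrank F ((MvPolynomial.restrictTotalDegree (Fin 3) F N).map (mulPoly f)) =
      (N + 3).choose 3 := by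
  rw [← finrank_restrictTotalDegree (F := F) N]
  exact (Submodule.equivMapOfInjective _ (mulPoly_injective hf) _).finrank_eq.symm

theorem finrank_ideal_ge {f g : MvPolynomial (Fin 3) F} (hf : Irreducible f) (hfg : ¬ f ∣ g)
    (m : ℕ) :
    (m + g.totalDegree + 3).choose 3 + (m + f.totalDegree + 3).choose 3 ≤
      Module.finrank F
        (((MvPolynomial.restrictTotalDegree (Fin 3) F (m + g.totalDegree)).map (mulPoly f) ⊔
        (MvPolynomial.restrictTotalDegree (Fin 3) F (m + f.totalDegree)).map (mulPoly g) :
        Submodule F (MvPolynomial (Fin 3) F))) + (m + 3).choose 3 := by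
  have hg : g ≠ 0 := fun h => hfg (h ▸ dvd_zero f)
  have hf0 := hf.ne_zero
  rw [← finrank_map_mulPoly hf0, ← finrank_map_mulPoly hg, ← Submodule.finrank_sup_add_finrank_inf_eq,
    ← finrank_map_mulPoly (mul_ne_zero hf0 hg) m]
  gcongr
  apply Submodule.finrank_mono
  rintro h ⟨⟨u, hu, rfl⟩, ⟨w, hw, hw'⟩⟩
  rw [mulPoly_apply, mulPoly_apply] at hw'
  have hdvd : f ∣ w := (hf.prime.dvd_or_dvd ⟨u, hw'⟩).resolve_left hfg
  obtain ⟨w', rfl⟩ := hdvd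
  refine ⟨w', ?_, ?_⟩
  · rw [SetLike.mem_coe, MvPolynomial.mem_restrictTotalDegree] at *
    by_cases h0 : w' = 0
    · simp [h0]
    rw [MvPolynomial.totalDegree_mul_of_isDomain hf0 h0] at hw
    omega
  · rw [mulPoly_apply, mulPoly_apply, ← hw']; ring

/-- Two planes cutting out the light line of `v`. -/
noncomputable def planeOne (v : F × F × F) : MvPolynomial (Fin 3) F :=
  MvPolynomial.X 0 + MvPolynomial.C v.1 * MvPolynomial.X 1 - MvPolynomial.C v.2.2

/-- Two planes cutting out the light line of `v`. -/
noncomputable def planeTwo (v : F × F × F) : MvPolynomial (Fin 3) F :=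
  MvPolynomial.X 1 + MvPolynomial.C v.1 * MvPolynomial.X 2 - MvPolynomial.C v.2.1

theorem lineRestrict_C (v : F × F × F) (c : F) : lineRestrict v (MvPolynomial.C c) = C c := by
  rw [← MvPolynomial.algebraMap_eq, AlgHom.commutes]; rfl

theorem lineRestrict_X_two (v : F × F × F) : lineRestrict v (MvPolynomial.X 2) = X := by
  simp [lineRestrict]

theorem exists_separating_plane {v w : F × F × F} (h : v ≠ w) :
    ∃ q : MvPolynomial (Fin 3) F, q.totalDegree ≤ 1 ∧ lineRestrict w q = 0 ∧
      lineRestrict v q ≠ 0 := by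
  have hX : ∀ i : Fin 3, (MvPolynomial.X i : MvPolynomial (Fin 3) F).totalDegree ≤ 1 := fun i =>
    (MvPolynomial.totalDegree_X i).le
  have hC : ∀ (i : Fin 3) (c : F),
      (MvPolynomial.C c * MvPolynomial.X i : MvPolynomial (Fin 3) F).totalDegree ≤ 1 := fun i c =>
    (MvPolynomial.totalDegree_mul _ _).trans
      (by rw [MvPolynomial.totalDegree_C, MvPolynomial.totalDegree_X])
  have hd : ∀ (i j : Fin 3) (c d : F), (MvPolynomial.X i + MvPolynomial.C c * MvPolynomial.X j -
      MvPolynomial.C d : MvPolynomial (Fin 3) F).totalDegree ≤ 1 := fun i j c d =>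
    (MvPolynomial.totalDegree_sub _ _).trans (max_le ((MvPolynomial.totalDegree_add _ _).trans
      (max_le (hX i) (hC j c))) (by simp))
  have hw1 : lineRestrict w (planeOne w) = 0 := by
    simp only [planeOne, map_sub, map_add, map_mul, lineRestrict_C]
    simp [lineRestrict]; ring
  have hw2 : lineRestrict w (planeTwo w) = 0 := by
    simp only [planeTwo, map_sub, map_add, map_mul, lineRestrict_C]
    simp [lineRestrict]
  have hv2 : lineRestrict v (planeTwo w) = C (w.1 - v.1) * X + C (v.2.1 - w.2.1) := by
    simp only [planeTwo, map_sub, map_add, map_mul, lineRestrict_C]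
    simp [lineRestrict]; ring
  by_cases h2 : lineRestrict v (planeTwo w) = 0
  · refine ⟨planeOne w, hd _ _ _ _, hw1, fun h1 => h ?_⟩
    rw [hv2] at h2
    have e1 : w.1 - v.1 = 0 := by simpa using congrArg (fun q => q.coeff 1) h2
    have e2 : v.2.1 - w.2.1 = 0 := by simpa using congrArg (fun q => q.coeff 0) h2
    have e3 : (lineRestrict v (planeOne w)).eval 0 = v.2.2 - v.2.1 * v.1 + w.1 * v.2.1 - w.2.2 := by
      simp only [planeOne, map_sub, map_add, map_mul, lineRestrict_C]
      simp [lineRestrict]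
    rw [h1, eval_zero] at e3
    refine Prod.ext (sub_eq_zero.1 e1).symm (Prod.ext (sub_eq_zero.1 e2) ?_)
    linear_combination -e3 - v.2.1 * e1
  · exact ⟨planeTwo w, hd _ _ _ _, hw2, h2⟩

theorem exists_separating_poly (S : Finset (F × F × F)) {v : F × F × F} (hv : v ∈ S) :
    ∃ q : MvPolynomial (Fin 3) F, q.totalDegree + 1 ≤ S.card ∧ lineRestrict v q ≠ 0 ∧
      ∀ w ∈ S, w ≠ v → lineRestrict w q = 0 := by
  have h : ∀ w : F × F × F, ∃ q : MvPolynomial (Fin 3) F, q.totalDegree ≤ 1 ∧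
      (w ≠ v → lineRestrict w q = 0 ∧ lineRestrict v q ≠ 0) := by
    intro w
    by_cases hw : w = v
    · exact ⟨0, by simp, fun h => absurd hw h⟩
    · obtain ⟨q, h1, h2, h3⟩ := exists_separating_plane (Ne.symm hw)
      exact ⟨q, h1, fun _ => ⟨h2, h3⟩⟩
  choose q hq1 hq2 using h
  refine ⟨∏ w ∈ S.erase v, q w, ?_, ?_, ?_⟩
  · have : (∏ w ∈ S.erase v, q w).totalDegree ≤ _ := (MvPolynomial.totalDegree_finsetProd (S.erase v) q).trans
      (Finset.sum_le_card_nsmul _ _ 1 fun w _ => hq1 w)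
    rw [Finset.card_erase_of_mem hv, smul_eq_mul, mul_one] at this
    have := Finset.card_pos.2 ⟨v, hv⟩
    omega
  · rw [map_prod, Finset.prod_ne_zero_iff]
    exact fun w hw => (hq2 w (Finset.ne_of_mem_erase hw)).2
  · intro w hw hwv
    rw [map_prod]
    exact Finset.prod_eq_zero (Finset.mem_erase.2 ⟨hwv, hw⟩) (hq2 w hwv).1

theorem finrank_add_card_mul_le (S : Finset (F × F × F)) (n M : ℕ) (hM : M + S.card ≤ n + 2)
    (W : Submodule F (MvPolynomial (Fin 3) F))
    (hW : W ≤ MvPolynomial.restrictTotalDegree (Fin 3) F n)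
    (hWS : ∀ q ∈ W, ∀ v ∈ S, lineRestrict v q = 0) :
    Module.finrank F W + S.card * M ≤ (n + 3).choose 3 := by
  have h : ∀ v : S, ∃ q : MvPolynomial (Fin 3) F, q.totalDegree + 1 ≤ S.card ∧
      lineRestrict v.1 q ≠ 0 ∧ ∀ w ∈ S, w ≠ v → lineRestrict w q = 0 := fun v =>
    exists_separating_poly S v.2
  choose q hq1 hq2 hq3 using h
  let Φ : (S → degreeLT F M) →ₗ[F] MvPolynomial (Fin 3) F :=
    ∑ v : S, (mulPoly (q v)) ∘ₗ
      (aeval (MvPolynomial.X 2 : MvPolynomial (Fin 3) F)).toLinearMap ∘ₗ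
      (degreeLT F M).subtype ∘ₗ LinearMap.proj v
  have hΦ : ∀ u, Φ u = ∑ v : S, q v * aeval (MvPolynomial.X 2) (u v : F[X]) := by
    intro u
    simp [Φ, mulPoly_apply]
  have hrest : ∀ u (v : S), lineRestrict v.1 (Φ u) = lineRestrict v.1 (q v) * (u v : F[X]) := by
    intro u v
    rw [hΦ, map_sum, Finset.sum_eq_single v]
    · rw [map_mul, ← aeval_algHom_apply, lineRestrict_X_two, aeval_X_left_apply]
    · intro w _ hw
      rw [map_mul, hq3 w v v.2 (fun h => hw (Subtype.ext h.symm)), zero_mul]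
    · simp
  have hinj : Function.Injective Φ := by
    rw [← LinearMap.ker_eq_bot, LinearMap.ker_eq_bot']
    intro u hu
    ext1 v
    have := hrest u v
    rw [hu, map_zero, eq_comm, mul_eq_zero] at this
    exact Subtype.ext (this.resolve_left (hq2 v))
  have hdisj : Disjoint W (LinearMap.range Φ) := by
    rw [Submodule.disjoint_def]
    rintro _ hw ⟨u, rfl⟩
    have : u = 0 := by
      ext1 v
      have h := hrest u v
      rw [hWS _ hw v v.2, eq_comm, mul_eq_zero] at h
      exact Subtype.ext (h.resolve_left (hq2 v))
    rw [this, map_zero]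
  have hrange : LinearMap.range Φ ≤ MvPolynomial.restrictTotalDegree (Fin 3) F n := by
    rintro _ ⟨u, rfl⟩
    rw [hΦ]
    refine Submodule.sum_mem _ fun v _ => ?_
    rw [MvPolynomial.mem_restrictTotalDegree]
    by_cases h0 : (u v : F[X]) = 0
    · simp [h0]
    have hlt : (u v : F[X]).natDegree < M := by
      rw [natDegree_lt_iff_degree_lt h0]
      exact mem_degreeLT.1 (u v).2
    have hle : (aeval (MvPolynomial.X 2 : MvPolynomial (Fin 3) F) (u v : F[X])).totalDegree ≤
        (u v : F[X]).natDegree := by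
      rw [aeval_eq_sum_range]
      refine MvPolynomial.totalDegree_finsetSum_le fun i hi => ?_
      refine (MvPolynomial.totalDegree_smul_le _ _).trans ?_
      rw [MvPolynomial.totalDegree_X_pow]
      exact Nat.lt_succ_iff.1 (Finset.mem_range.1 hi)
    have := MvPolynomial.totalDegree_mul (q v) (aeval (MvPolynomial.X 2) (u v : F[X]))
    have := hq1 v
    omega
  have : FiniteDimensional F W := Submodule.finiteDimensional_of_le hW
  have h1 := Submodule.finrank_sup_add_finrank_inf_eq W (LinearMap.range Φ)
  have h2 := Submodule.finrank_mono (sup_le hW hrange)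
  rw [finrank_restrictTotalDegree] at h2
  have h3 : Module.finrank F (degreeLT F M) = M := by
    rw [(degreeLTEquiv F M).finrank_eq]; simp
  rw [hdisj.eq_bot, finrank_bot, LinearMap.finrank_range_of_inj hinj,
    Module.finrank_pi_fintype] at h1
  simp only [h3, Finset.sum_const, Finset.card_univ, Fintype.card_coe, smul_eq_mul] at h1
  omega

theorem bezout_arith {d e L m C₁ C₂ C₃ C₄ : ℤ} (hd0 : 0 ≤ d) (he0 : 0 ≤ e)
    (hL' : d * e + 1 ≤ L) (hm' : m = L * (d * e + 1))
    (c1 : 6 * C₁ = (m + e + 3) * (m + e + 2) * (m + e + 1))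
    (c2 : 6 * C₂ = (m + d + 3) * (m + d + 2) * (m + d + 1))
    (c3 : 6 * C₃ = (m + d + e + 3) * (m + d + e + 2) * (m + d + e + 1))
    (c4 : 6 * C₄ = (m + 3) * (m + 2) * (m + 1))
    (h3 : C₁ + C₂ + L * (m + d + e + 2 - L) ≤ C₃ + C₄) : False := by
  have h4 : 3 * (2 * L * (m + d + e + 2 - L)) ≤ 3 * (d * e * (2 * m + d + e + 4)) := by
    linear_combination 6 * h3 - c1 - c2 + c3 + c4
  have h4' := le_of_mul_le_mul_left h4 three_pos
  clear c1 c2 c3 c4 h3 h4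
  have hde : 0 ≤ d * e := mul_nonneg hd0 he0
  have h5 : (L - d * e) * (m + d + e + 2) ≤ L * L := by
    have : 0 ≤ d * e * (d + e) := mul_nonneg hde (add_nonneg hd0 he0)
    linarith
  have h6 : (L - d * e) * (m + 2) ≤ L * L := by
    have := mul_nonneg (by linarith : 0 ≤ L - d * e) (add_nonneg hd0 he0)
    linarith
  have h7 : L ≤ (L - d * e) * (d * e + 1) := by
    have := mul_nonneg (by linarith : 0 ≤ L - d * e - 1) hde
    linarith
  rw [hm'] at h6
  have h8 : L * L ≤ L * ((L - d * e) * (d * e + 1)) :=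
    mul_le_mul_of_nonneg_left h7 (by linarith)
  linarith

/-- A Bézout bound for light lines contained in two surfaces without common component. -/
theorem card_lines_le_of_not_dvd {f g : MvPolynomial (Fin 3) F} (hf : Irreducible f)
    (hfg : ¬ f ∣ g) (S : Finset (F × F × F))
    (hS : ∀ v ∈ S, lineRestrict v f = 0 ∧ lineRestrict v g = 0) :
    S.card ≤ f.totalDegree * g.totalDegree := by
  set d := f.totalDegree with hd
  set e := g.totalDegree with he
  set L := S.card with hL
  by_contra hlt
  push Not at hlt
  set m := L * (d * e + 1) with hm
  set n := m + d + e with hn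
  have hLm : L ≤ m := Nat.le_mul_of_pos_right _ (Nat.succ_pos _)
  have h1 := finrank_ideal_ge hf hfg m
  have h2 := finrank_add_card_mul_le S n (n + 2 - L) (by omega)
    ((MvPolynomial.restrictTotalDegree (Fin 3) F (m + e)).map (mulPoly f) ⊔
      (MvPolynomial.restrictTotalDegree (Fin 3) F (m + d)).map (mulPoly g)) (by
      refine sup_le ?_ ?_
      · rintro _ ⟨u, hu, rfl⟩
        rw [SetLike.mem_coe, MvPolynomial.mem_restrictTotalDegree] at hu
        rw [MvPolynomial.mem_restrictTotalDegree]
        have := MvPolynomial.totalDegree_mul f u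
        rw [mulPoly_apply]; omega
      · rintro _ ⟨u, hu, rfl⟩
        rw [SetLike.mem_coe, MvPolynomial.mem_restrictTotalDegree] at hu
        rw [MvPolynomial.mem_restrictTotalDegree]
        have := MvPolynomial.totalDegree_mul g u
        rw [mulPoly_apply]; omega) (by
      intro q hq v hv
      obtain ⟨_, ⟨u, -, rfl⟩, _, ⟨w, -, rfl⟩, rfl⟩ := Submodule.mem_sup.1 hq
      simp [mulPoly_apply, (hS v hv).1, (hS v hv).2])
  rw [← hd, ← he] at h1
  have hc : ∀ N : ℕ, (6 : ℤ) * ((N + 3).choose 3 : ℕ) = (N + 3) * (N + 2) * (N + 1) := by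
    intro N
    have := Nat.descFactorial_eq_factorial_mul_choose (N + 3) 3
    simp [Nat.descFactorial, Nat.factorial] at this
    push_cast [← Nat.cast_inj (R := ℤ)] at this
    linarith
  have h3 : ((m + e + 3).choose 3 : ℤ) + (m + d + 3).choose 3 + L * (n + 2 - L : ℕ) ≤
      (n + 3).choose 3 + (m + 3).choose 3 := by
    rw [← hL] at h2
    exact_mod_cast (by omega :
      (m + e + 3).choose 3 + (m + d + 3).choose 3 + L * (n + 2 - L) ≤
        (n + 3).choose 3 + (m + 3).choose 3)
  rw [Nat.cast_sub (by omega)] at h3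
  have c1 := hc (m + e); have c2 := hc (m + d); have c3 := hc n; have c4 := hc m
  push_cast at c1 c2 c3 c4 h3
  have hL' : (d * e + 1 : ℤ) ≤ L := by exact_mod_cast hlt
  have hm' : (m : ℤ) = L * (d * e + 1) := by exact_mod_cast hm
  have hn' : (n : ℤ) = m + d + e := by exact_mod_cast hn
  rw [hn'] at c3 h3
  exact bezout_arith (Int.natCast_nonneg d) (Int.natCast_nonneg e) hL' hm' c1 c2 c3 c4 h3

end BezoutLines

section Components

open Polynomial

variable {F : Type*} [Field F]

theorem totalDegree_pos_of_irreducible {f : MvPolynomial (Fin 3) F} (hf : Irreducible f) :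
    0 < f.totalDegree := by
  rw [Nat.pos_iff_ne_zero]
  intro h0
  rw [MvPolynomial.totalDegree_eq_zero_iff_eq_C] at h0
  have hc : MvPolynomial.coeff 0 f ≠ 0 := fun h => hf.ne_zero (by rw [h0, h, map_zero])
  apply hf.not_isUnit
  rw [h0]
  exact (isUnit_iff_ne_zero.2 hc).map MvPolynomial.C

theorem exists_pderiv_ne_zero {p : ℕ} [CharP F p] {f : MvPolynomial (Fin 3) F}
    (hf : Irreducible f) (hp : f.totalDegree < p) : ∃ i, MvPolynomial.pderiv i f ≠ 0 := by
  have hpos := totalDegree_pos_of_irreducible hf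
  obtain ⟨m, hm, hd⟩ := Finset.exists_mem_eq_sup _ (MvPolynomial.support_nonempty.2 hf.ne_zero)
    (fun s : Fin 3 →₀ ℕ => s.sum fun _ e => e)
  have hsum : (m.sum fun _ e => e) = f.totalDegree := hd.symm
  have hm0 : m ≠ 0 := by
    rintro rfl
    simp at hsum; omega
  obtain ⟨i, hi⟩ := Finsupp.ne_iff.1 hm0
  rw [Finsupp.coe_zero, Pi.zero_apply] at hi
  have hle : m i ≤ f.totalDegree := by
    rw [← hsum]
    exact Finset.single_le_sum (f := fun j => m j) (fun _ _ => Nat.zero_le _)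
      (Finsupp.mem_support_iff.2 hi)
  refine ⟨i, fun h => ?_⟩
  have h1 : MvPolynomial.coeff (m - Finsupp.single i 1) (MvPolynomial.pderiv i f) = 0 := by
    rw [h, MvPolynomial.coeff_zero]
  have h2 : m - Finsupp.single i 1 + Finsupp.single i 1 = m :=
    tsub_add_cancel_of_le (by rw [Finsupp.single_le_iff]; omega)
  have h3 : (m - Finsupp.single i 1 : Fin 3 →₀ ℕ) i + 1 = m i := by
    simp; omega
  rw [MvPolynomial.coeff_pderiv, h2] at h1
  have h4 : (((m - Finsupp.single i 1 : Fin 3 →₀ ℕ) i : ℕ) : F) + 1 = ((m i : ℕ) : F) := by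
    exact_mod_cast congrArg (Nat.cast (R := F)) h3
  rcases mul_eq_zero.1 h1 with h1 | h1
  · exact MvPolynomial.mem_support_iff.1 hm h1
  · rw [h4, CharP.cast_eq_zero_iff F p] at h1
    have := Nat.le_of_dvd (by omega) h1
    omega

/-- An irreducible surface contains few light lines that have many well-spread neighbours. -/
theorem card_lines_on_irreducible_le {p : ℕ} [CharP F p] {g : MvPolynomial (Fin 3) F}
    (hg : Irreducible g) (hdeg : 2 * g.totalDegree < p) {S : Finset (F × F × F)}
    (hS : ∀ v ∈ S, lineRestrict v g = 0) {k : ℕ}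
    (hN : ∀ v ∈ S, ∃ N : Finset (F × F × F), Set.InjOn (crossParam v) N ∧
      (∀ w ∈ N, w.1 ≠ v.1 ∧ lightForm v w = 0 ∧ lineRestrict w g = 0) ∧
      (∀ c e d : F, (c ≠ 0 ∨ e ≠ 0) →
        (N.filter fun w => c * w.2.1 + e * w.1 = d).card ≤ k) ∧
      4 * g.totalDegree < N.card ∧ g.totalDegree + k < N.card) :
    S.card ≤ g.totalDegree * (4 * g.totalDegree) := by
  by_cases hx : ∃ x, ¬ g ∣ ruling x g
  · obtain ⟨x, hx⟩ := hx
    refine (card_lines_le_of_not_dvd hg hx S fun v hv => ⟨hS v hv, ?_⟩).trans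
      (Nat.mul_le_mul_left _ (totalDegree_ruling_le x g))
    obtain ⟨N, hinj, hN1, -, hN2, -⟩ := hN v hv
    refine eq_zero_of_eval_crossParam hinj ?_ fun w hw =>
      eval_ruling_crossParam (hS v hv) (hN1 w hw).2.2 (hN1 w hw).1 (hN1 w hw).2.1 x
    exact ((natDegree_lineRestrict_le v _).trans (totalDegree_ruling_le x g)).trans_lt hN2
  · push Not at hx
    obtain ⟨i, hi⟩ := exists_pderiv_ne_zero (p := p) hg (by omega)
    have hlt := totalDegree_pderiv_add_one_le i g hi
    have hnd : ¬ g ∣ MvPolynomial.pderiv i g := by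
      rintro ⟨q, hq⟩
      have hq0 : q ≠ 0 := fun h => hi (by rw [hq, h, mul_zero])
      rw [hq, MvPolynomial.totalDegree_mul_of_isDomain hg.ne_zero hq0] at hlt
      omega
    refine (card_lines_le_of_not_dvd hg hnd S fun v hv => ⟨hS v hv, ?_⟩).trans
      (Nat.mul_le_mul_left _ (by omega))
    obtain ⟨N, hinj, hN1, hk, -, hN2⟩ := hN v hv
    exact lineRestrict_pderiv_eq_zero (hS v hv) (hx v.1) hdeg hinj hN1 hk hN2 i

/-- A family of light lines lying on a surface of degree at most `d`, each having many
well-spread neighbours, has at most `5 d ^ 2` members. -/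
theorem card_lines_on_surface_le {p : ℕ} [CharP F p] {d k : ℕ} (hdp : 2 * d < p)
    {Q : Finset (F × F × F)}
    (hQ : ∃ f : MvPolynomial (Fin 3) F, f ≠ 0 ∧ f.totalDegree ≤ d ∧ ∀ v ∈ Q, lineRestrict v f = 0)
    (hN : ∀ v ∈ Q, ∃ N ⊆ Q, Set.InjOn (crossParam v) N ∧
      (∀ w ∈ N, w.1 ≠ v.1 ∧ lightForm v w = 0) ∧
      (∀ c e d : F, (c ≠ 0 ∨ e ≠ 0) →
        (N.filter fun w => c * w.2.1 + e * w.1 = d).card ≤ k) ∧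
      5 * d < N.card ∧ 2 * d + k < N.card) :
    Q.card ≤ 5 * d * d := by
  have hex : ∃ n, ∃ f : MvPolynomial (Fin 3) F, f ≠ 0 ∧ f.totalDegree = n ∧
      ∀ v ∈ Q, lineRestrict v f = 0 := by
    obtain ⟨f, h1, -, h3⟩ := hQ
    exact ⟨_, f, h1, rfl, h3⟩
  obtain ⟨f, hf0, hfn, hfQ⟩ := Nat.find_spec hex
  have hmin : ∀ g : MvPolynomial (Fin 3) F, g ≠ 0 → (∀ v ∈ Q, lineRestrict v g = 0) →
      f.totalDegree ≤ g.totalDegree := by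
    intro g hg hgQ
    rw [hfn]
    exact Nat.find_min' hex ⟨g, hg, rfl, hgQ⟩
  have hfd : f.totalDegree ≤ d := by
    obtain ⟨f', h1, h2, h3⟩ := hQ
    exact (hmin f' h1 h3).trans h2
  clear hfn hex hQ
  set l := UniqueFactorizationMonoid.factors f with hl
  have hassoc : Associated l.prod f := UniqueFactorizationMonoid.factors_prod hf0
  have hirr : ∀ g ∈ l, Irreducible g := UniqueFactorizationMonoid.irreducible_of_factor
  have hvan : ∀ v ∈ Q, lineRestrict v l.prod = 0 := by
    intro v hv
    obtain ⟨u, hu⟩ := hassoc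
    have := hfQ v hv
    rw [← hu, map_mul] at this
    exact (mul_eq_zero.1 this).resolve_right ((u.isUnit.map (lineRestrict v)).ne_zero)
  have hdegprod : l.prod.totalDegree = f.totalDegree := by
    obtain ⟨u, hu⟩ := hassoc
    have h0 : (l.prod) ≠ 0 := fun h => hf0 (by rw [← hu, h, zero_mul])
    apply le_antisymm
    · rw [← hu, MvPolynomial.totalDegree_mul_of_isDomain h0 u.ne_zero]; omega
    · exact hmin _ h0 hvan
  have hdegsum : ∀ s : Multiset (MvPolynomial (Fin 3) F), (∀ g ∈ s, Irreducible g) →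
      s.prod ≠ 0 ∧ s.prod.totalDegree = (s.map MvPolynomial.totalDegree).sum := by
    intro s
    induction s using Multiset.induction_on with
    | empty => intro _; simp
    | cons a s ih =>
      intro h
      have h1 := ih fun g hg => h g (Multiset.mem_cons_of_mem hg)
      have h2 := (h a (Multiset.mem_cons_self a s)).ne_zero
      rw [Multiset.prod_cons, Multiset.map_cons, Multiset.sum_cons,
        MvPolynomial.totalDegree_mul_of_isDomain h2 h1.1, h1.2]
      exact ⟨mul_ne_zero h2 h1.1, rfl⟩
  have hcomp : ∀ g ∈ l, (Q.filter fun v => lineRestrict v g = 0).card ≤ 5 * d * g.totalDegree := by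
    intro g hg
    set h := (l.erase g).prod with hh
    have hgh : g * h = l.prod := Multiset.prod_erase hg
    have hgirr := hirr g hg
    have hgpos := totalDegree_pos_of_irreducible hgirr
    have hh0 : h ≠ 0 := (hdegsum _ fun q hq => hirr q (Multiset.mem_of_mem_erase hq)).1
    have hdegh : g.totalDegree + h.totalDegree = f.totalDegree := by
      rw [← hdegprod, ← hgh, MvPolynomial.totalDegree_mul_of_isDomain hgirr.ne_zero hh0]
    have hsplit : ∀ v ∈ Q, lineRestrict v g = 0 ∨ lineRestrict v h = 0 := by
      intro v hv
      have := hvan v hv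
      rwa [← hgh, map_mul, mul_eq_zero] at this
    have hndvd : ¬ g ∣ h := by
      rintro ⟨q, hq⟩
      have := hmin h hh0 fun v hv => (hsplit v hv).elim
        (fun h1 => by rw [hq, map_mul, h1, zero_mul]) id
      omega
    have hA := card_lines_le_of_not_dvd hgirr hndvd
      (Q.filter fun v => lineRestrict v g = 0 ∧ lineRestrict v h = 0)
      fun v hv => (Finset.mem_filter.1 hv).2
    have hB := card_lines_on_irreducible_le (p := p) hgirr (by omega)
      (S := Q.filter fun v => lineRestrict v g = 0 ∧ lineRestrict v h ≠ 0) (k := k)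
      (fun v hv => (Finset.mem_filter.1 hv).2.1) (by
        intro v hv
        obtain ⟨hvQ, hvg, hvh⟩ := Finset.mem_filter.1 hv
        obtain ⟨N, hNQ, hinj, hN1, hk, hc1, hc2⟩ := hN v hvQ
        have hbad : (N.filter fun w => ¬ lineRestrict w g = 0).card ≤ d := by
          refine (Finset.card_le_card ?_).trans ((card_filter_eval_crossParam_le hinj hvh).trans
            ((natDegree_lineRestrict_le v h).trans (by omega)))
          intro w hw
          rw [Finset.mem_filter] at hw ⊢
          refine ⟨hw.1, ?_⟩
          rw [eval_lineRestrict, linePoint_crossParam (hN1 w hw.1).1 (hN1 w hw.1).2,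
            ← eval_lineRestrict, (hsplit w (hNQ hw.1)).resolve_left hw.2, eval_zero]
        have hcount := Finset.card_filter_add_card_filter_not (s := N)
          (fun w => lineRestrict w g = 0)
        refine ⟨N.filter fun w => lineRestrict w g = 0, hinj.mono ?_, ?_, ?_, by omega, by omega⟩
        · intro w hw; exact (Finset.mem_filter.1 hw).1
        · intro w hw
          rw [Finset.mem_filter] at hw
          exact ⟨(hN1 w hw.1).1, (hN1 w hw.1).2, hw.2⟩
        · intro c e d hce
          exact (Finset.card_le_card (Finset.filter_subset_filter _ (Finset.filter_subset _ _))).trans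
            (hk c e d hce))
    have hAB : (Q.filter fun v => lineRestrict v g = 0).card ≤
        (Q.filter fun v => lineRestrict v g = 0 ∧ lineRestrict v h = 0).card +
        (Q.filter fun v => lineRestrict v g = 0 ∧ lineRestrict v h ≠ 0).card := by
      rw [← Finset.filter_filter, ← Finset.filter_filter]
      exact (Finset.card_filter_add_card_filter_not (fun v => lineRestrict v h = 0)).ge
    have e1 : g.totalDegree * h.totalDegree ≤ g.totalDegree * d :=
      Nat.mul_le_mul_left _ (by omega)
    have e2 : g.totalDegree * (4 * g.totalDegree) ≤ g.totalDegree * (4 * d) :=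
      Nat.mul_le_mul_left _ (by omega)
    calc _ ≤ _ := hAB
      _ ≤ g.totalDegree * d + g.totalDegree * (4 * d) := by omega
      _ = 5 * d * g.totalDegree := by ring
  have hcover : Q ⊆ l.toFinset.biUnion fun g => Q.filter fun v => lineRestrict v g = 0 := by
    intro v hv
    have h1 := hvan v hv
    rw [map_multiset_prod, Multiset.prod_eq_zero_iff, Multiset.mem_map] at h1
    obtain ⟨g, hg, hg0⟩ := h1
    simp only [Finset.mem_biUnion, Multiset.mem_toFinset, Finset.mem_filter]
    exact ⟨g, hg, hv, hg0⟩
  have hsumle : ∑ g ∈ l.toFinset, g.totalDegree ≤ (l.map MvPolynomial.totalDegree).sum := by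
    rw [Finset.sum_multiset_map_count]
    refine Finset.sum_le_sum fun g hg => ?_
    rw [smul_eq_mul]
    exact Nat.le_mul_of_pos_left _ (Multiset.count_pos.2 (Multiset.mem_toFinset.1 hg))
  calc Q.card ≤ _ := Finset.card_le_card hcover
    _ ≤ ∑ g ∈ l.toFinset, (Q.filter fun v => lineRestrict v g = 0).card := Finset.card_biUnion_le
    _ ≤ ∑ g ∈ l.toFinset, 5 * d * g.totalDegree :=
        Finset.sum_le_sum fun g hg => hcomp g (Multiset.mem_toFinset.1 hg)
    _ = 5 * d * ∑ g ∈ l.toFinset, g.totalDegree := by rw [Finset.mul_sum]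
    _ ≤ 5 * d * d := by
        refine Nat.mul_le_mul_left _ (hsumle.trans ?_)
        rw [← (hdegsum l hirr).2, hdegprod]
        exact hfd

/-- There is a surface of degree at most `d` through any sufficiently small family of lines. -/
theorem exists_surface_through_lines (S : Finset (F × F × F)) (d : ℕ)
    (h : S.card * (d + 1) < (d + 3).choose 3) :
    ∃ f : MvPolynomial (Fin 3) F, f ≠ 0 ∧ f.totalDegree ≤ d ∧ ∀ v ∈ S, lineRestrict v f = 0 := by
  have hmem : ∀ (v : S) (f : MvPolynomial.restrictTotalDegree (Fin 3) F d),
      lineRestrict v.1 f.1 ∈ degreeLT F (d + 1) := by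
    intro v f
    rw [mem_degreeLT]
    refine lt_of_le_of_lt degree_le_natDegree ?_
    have := (natDegree_lineRestrict_le v.1 f.1).trans
      ((MvPolynomial.mem_restrictTotalDegree _ _ _).1 f.2)
    exact_mod_cast Nat.lt_succ_of_le this
  let Φ : MvPolynomial.restrictTotalDegree (Fin 3) F d →ₗ[F] (S → degreeLT F (d + 1)) :=
    LinearMap.pi fun v => LinearMap.codRestrict _
      ((lineRestrict v.1).toLinearMap ∘ₗ Submodule.subtype _) (hmem v)
  have h3 : Module.finrank F (degreeLT F (d + 1)) = d + 1 := by
    rw [(degreeLTEquiv F (d + 1)).finrank_eq]; simp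
  have hker : LinearMap.ker Φ ≠ ⊥ := by
    apply LinearMap.ker_ne_bot_of_finrank_lt
    rw [finrank_restrictTotalDegree, Module.finrank_pi_fintype]
    simpa [h3] using h
  obtain ⟨f, hf, hf0⟩ := Submodule.exists_mem_ne_zero_of_ne_bot hker
  refine ⟨f.1, fun h0 => hf0 (Subtype.ext h0), (MvPolynomial.mem_restrictTotalDegree _ _ _).1 f.2,
    fun v hv => ?_⟩
  have := congrFun (LinearMap.mem_ker.1 hf) ⟨v, hv⟩
  exact congrArg Subtype.val this

end Components

section Sampling

variable {V : Type*} [DecidableEq V]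

/-- Truncated exponential weight used in the derandomized sampling argument. -/
noncomputable def sampleWeight (N : V → Finset V) (d : ℕ) (S : Finset V) (v : V) : ℝ :=
  if (N v ∩ S).card ≤ d then (1 / 2 : ℝ) ^ (N v ∩ S).card else 0

theorem sampleWeight_nonneg (N : V → Finset V) (d : ℕ) (S : Finset V) (v : V) :
    0 ≤ sampleWeight N d S v := by
  unfold sampleWeight; split_ifs <;> positivity

theorem sampleWeight_insert_le (N : V → Finset V) (d : ℕ) (S : Finset V) (v w : V) :
    sampleWeight N d (insert w S) v ≤
      sampleWeight N d S v * (1 - if w ∈ N v \ S then 1 / 2 else 0) := by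
  by_cases hw : w ∈ N v \ S
  · obtain ⟨h1, h2⟩ := Finset.mem_sdiff.1 hw
    have hc : (N v ∩ insert w S).card = (N v ∩ S).card + 1 := by
      rw [Finset.inter_insert_of_mem h1, Finset.card_insert_of_notMem]
      exact fun h => h2 (Finset.mem_inter.1 h).2
    rw [if_pos hw]
    unfold sampleWeight
    rw [hc]
    split_ifs with h3 h4 h4
    · rw [pow_succ]; norm_num
    · omega
    · positivity
    · simp
  · rw [if_neg hw, sub_zero, mul_one]
    have : N v ∩ insert w S = N v ∩ S := by
      by_cases h1 : w ∈ N v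
      · have h2 : w ∈ S := by
          by_contra h; exact hw (Finset.mem_sdiff.2 ⟨h1, h⟩)
        rw [Finset.insert_eq_of_mem h2]
      · rw [Finset.inter_insert_of_notMem h1]
    unfold sampleWeight
    rw [this]

theorem sum_sampleWeight_insert_le {Q : Finset V} {N : V → Finset V} {d D : ℕ} (hd : 2 * d ≤ D)
    {v : V} (hNQ : N v ⊆ Q) (hD : D ≤ (N v).card) (S : Finset V) :
    ∑ w ∈ Q, sampleWeight N d (insert w S) v ≤
      sampleWeight N d S v * (Q.card - D / 4) := by
  by_cases h : (N v ∩ S).card ≤ d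
  · refine (Finset.sum_le_sum fun w _ => sampleWeight_insert_le N d S v w).trans ?_
    rw [← Finset.mul_sum]
    refine mul_le_mul_of_nonneg_left ?_ (sampleWeight_nonneg _ _ _ _)
    rw [Finset.sum_sub_distrib, Finset.sum_const, nsmul_eq_mul, mul_one, ← Finset.sum_filter,
      Finset.sum_const, nsmul_eq_mul]
    have h1 : (Q.filter fun w => w ∈ N v \ S) = N v \ S := by
      ext w
      rw [Finset.mem_filter, and_iff_right_iff_imp]
      exact fun hw => hNQ (Finset.mem_sdiff.1 hw).1
    have h2 := Finset.card_inter_add_card_sdiff (N v) S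
    have h3 : D ≤ 2 * (N v \ S).card := by omega
    have h4 : (D : ℝ) ≤ 2 * ((N v \ S).card : ℝ) := by exact_mod_cast h3
    rw [h1]
    linarith
  · have h0 : sampleWeight N d S v = 0 := if_neg h
    rw [h0, zero_mul]
    refine (Finset.sum_nonpos fun w _ => ?_)
    have := sampleWeight_insert_le N d S v w
    rwa [h0, zero_mul] at this

theorem exists_sample {Q : Finset V} {N : V → Finset V} {d D : ℕ} (hd : 2 * d ≤ D)
    (hN : ∀ v ∈ Q, N v ⊆ Q ∧ D ≤ (N v).card) (hQ : Q.Nonempty) (s : ℕ) :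
    ∃ S : Finset V, S ⊆ Q ∧ S.card ≤ s ∧
      ∑ v ∈ Q, sampleWeight N d S v ≤ Q.card * (1 - D / (4 * Q.card) : ℝ) ^ s := by
  have hQ0 : (0 : ℝ) < Q.card := by exact_mod_cast hQ.card_pos
  have hDQ : (D : ℝ) ≤ Q.card := by
    obtain ⟨v, hv⟩ := hQ
    exact_mod_cast (hN v hv).2.trans (Finset.card_le_card (hN v hv).1)
  have hr : (0 : ℝ) ≤ 1 - D / (4 * Q.card) := by
    rw [sub_nonneg, div_le_one (by positivity)]
    linarith
  induction s with
  | zero =>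
    refine ⟨∅, by simp, by simp, ?_⟩
    simp [sampleWeight]
  | succ s ih =>
    obtain ⟨S, hSQ, hSc, hS⟩ := ih
    have hsum : ∑ w ∈ Q, ∑ v ∈ Q, sampleWeight N d (insert w S) v ≤
        ∑ w ∈ Q, (∑ v ∈ Q, sampleWeight N d S v) * (1 - D / (4 * Q.card)) := by
      rw [Finset.sum_comm, Finset.sum_const, nsmul_eq_mul]
      have : (Q.card : ℝ) * ((∑ v ∈ Q, sampleWeight N d S v) * (1 - D / (4 * Q.card))) =
          ∑ v ∈ Q, sampleWeight N d S v * (Q.card - D / 4) := by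
        rw [← Finset.sum_mul]; field_simp
      rw [this]
      exact Finset.sum_le_sum fun v hv => sum_sampleWeight_insert_le hd (hN v hv).1 (hN v hv).2 S
    obtain ⟨w, hw, hle⟩ := Finset.exists_le_of_sum_le hQ hsum
    refine ⟨insert w S, Finset.insert_subset hw hSQ,
      (Finset.card_insert_le _ _).trans (by omega), hle.trans ?_⟩
    rw [pow_succ, ← mul_assoc]
    exact mul_le_mul_of_nonneg_right hS hr

theorem exists_sample_many_neighbours {Q : Finset V} {N : V → Finset V} {d D : ℕ}
    (hd : 2 * d ≤ D) (hN : ∀ v ∈ Q, N v ⊆ Q ∧ D ≤ (N v).card) (hQ : Q.Nonempty) (s : ℕ)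
    (hs : (2 : ℝ) ^ d * (Q.card * (1 - D / (4 * Q.card) : ℝ) ^ s) < 1) :
    ∃ S : Finset V, S ⊆ Q ∧ S.card ≤ s ∧ ∀ v ∈ Q, d < (N v ∩ S).card := by
  obtain ⟨S, h1, h2, h3⟩ := exists_sample hd hN hQ s
  refine ⟨S, h1, h2, fun v hv => ?_⟩
  by_contra hlt
  push Not at hlt
  have h4 : sampleWeight N d S v ≤ ∑ v ∈ Q, sampleWeight N d S v :=
    Finset.single_le_sum (fun v _ => sampleWeight_nonneg N d S v) hv
  have h5 : (1 / 2 : ℝ) ^ d ≤ sampleWeight N d S v := by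
    rw [sampleWeight, if_pos hlt]
    exact pow_le_pow_of_le_one (by norm_num) (by norm_num) hlt
  have h6 : (1 / 2 : ℝ) ^ d * 2 ^ d = 1 := by rw [← mul_pow]; norm_num
  have h7 : (0 : ℝ) < 2 ^ d := by positivity
  nlinarith [h5.trans (h4.trans h3)]

end Sampling

section Core

variable {F : Type*} [Field F]

theorem lightForm_swap (v w : F × F × F) : lightForm w v = -lightForm v w := by
  unfold lightForm; ring

theorem lightForm_eq_zero_of_linePoint_eq {v w : F × F × F} {t : F}
    (h : linePoint v t = linePoint w t) : lightForm v w = 0 := by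
  have h0 := congrFun h 0
  have h1 := congrFun h 1
  simp [linePoint] at h0 h1
  unfold lightForm
  linear_combination h0 + (v.1 + w.1) * h1

/-- The members of `Q` other than `v` whose light line meets that of `v`. -/
noncomputable def lightNeighbours (Q : Finset (F × F × F)) (v : F × F × F) :
    Finset (F × F × F) :=
  Q.filter fun w => w ≠ v ∧ lightForm v w = 0

theorem sampling_numerics {m d D s : ℕ} (hd : 1 ≤ d) (hm : m ≤ 24 * d ^ 2) (hm0 : 0 < m)
    (hD : 4100 * d ≤ D) (hDm : D ≤ m) (hs : d ^ 2 ≤ 6 * s) :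
    (2 : ℝ) ^ d * (m * (1 - D / (4 * m) : ℝ) ^ s) < 1 := by
  have hd' : (1 : ℝ) ≤ d := by exact_mod_cast hd
  have hm' : (m : ℝ) ≤ 24 * d ^ 2 := by exact_mod_cast hm
  have hm0' : (0 : ℝ) < m := by exact_mod_cast hm0
  have hD' : 4100 * (d : ℝ) ≤ D := by exact_mod_cast hD
  have hDm' : (D : ℝ) ≤ m := by exact_mod_cast hDm
  have hs' : (d : ℝ) ^ 2 ≤ 6 * s := by exact_mod_cast hs
  have h0 : (0 : ℝ) ≤ 1 - D / (4 * m) := by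
    rw [sub_nonneg, div_le_one (by positivity)]; linarith
  have h00 := pow_nonneg h0 s
  have h1 : (1 - D / (4 * m) : ℝ) ^ s ≤ Real.exp (-(7.1 * d)) := by
    have h2 : (1 - D / (4 * m) : ℝ) ≤ Real.exp (-(D / (4 * m))) := by
      have := Real.add_one_le_exp (-(D / (4 * m) : ℝ)); linarith
    refine (pow_le_pow_left₀ h0 h2 s).trans ?_
    rw [← Real.exp_nat_mul, Real.exp_le_exp]
    have h3 : 7.1 * (d : ℝ) ≤ s * (D / (4 * m)) := by
      rw [mul_div_assoc', le_div_iff₀ (by positivity)]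
      have h4 : 7.1 * (d : ℝ) * (4 * m) ≤ 7.1 * d * (4 * (24 * d ^ 2)) := by gcongr
      have h5 : (d : ℝ) ^ 2 / 6 * (4100 * d) ≤ s * D := by gcongr; linarith
      have h6 : (0 : ℝ) ≤ d ^ 3 := by positivity
      nlinarith
    linarith
  have h2 : (2 : ℝ) ^ d ≤ Real.exp d := by
    have := Real.add_one_le_exp (1 : ℝ)
    calc (2 : ℝ) ^ d ≤ Real.exp 1 ^ d := pow_le_pow_left₀ (by norm_num) (by linarith) d
      _ = Real.exp d := by rw [← Real.exp_nat_mul, mul_one]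
  have h3 : (m : ℝ) ≤ Real.exp (6 * d) := by
    have e1 : (d : ℝ) ≤ Real.exp d := by have := Real.add_one_le_exp (d : ℝ); linarith
    have e2 : (24 : ℝ) ≤ Real.exp (4 * d) := by
      have e3 : (2.7 : ℝ) ≤ Real.exp d := by
        have := Real.exp_one_gt_d9
        have := Real.exp_le_exp.2 hd'
        linarith
      have e4 : Real.exp (4 * d) = Real.exp d ^ 4 := by rw [← Real.exp_nat_mul]; norm_num
      rw [e4]
      calc (24 : ℝ) ≤ 2.7 ^ 4 := by norm_num
        _ ≤ _ := by gcongr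
    calc (m : ℝ) ≤ 24 * d ^ 2 := hm'
      _ ≤ Real.exp (4 * d) * Real.exp d ^ 2 := by gcongr
      _ = Real.exp (6 * d) := by
        rw [← Real.exp_nat_mul, ← Real.exp_add]; congr 1; push_cast; ring
  calc (2 : ℝ) ^ d * (m * (1 - D / (4 * m) : ℝ) ^ s) ≤
      Real.exp d * (Real.exp (6 * d) * Real.exp (-(7.1 * d))) :=
        mul_le_mul h2 (mul_le_mul h3 h1 h00 (Real.exp_pos _).le) (mul_nonneg hm0'.le h00)
          (Real.exp_pos _).le
    _ = Real.exp (-(0.1 * d)) := by rw [← Real.exp_add, ← Real.exp_add]; congr 1; ring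
    _ < 1 := by rw [Real.exp_lt_one_iff]; linarith

theorem exists_lightNeighbours_card_le {p : ℕ} [CharP F p] {Q : Finset (F × F × F)} {k D : ℕ}
    (hne : Q.Nonempty)
    (hx : ∀ v ∈ Q, ∀ w ∈ Q, v ≠ w → lightForm v w = 0 → v.1 ≠ w.1)
    (htri : ∀ u ∈ Q, ∀ v ∈ Q, ∀ w ∈ Q, u ≠ v → u ≠ w → v ≠ w → lightForm u v = 0 →
      lightForm u w = 0 → lightForm v w ≠ 0)
    (hk : ∀ v ∈ Q, ∀ c e d : F, (c ≠ 0 ∨ e ≠ 0) →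
      ((lightNeighbours Q v).filter fun w => c * w.2.1 + e * w.1 = d).card ≤ k)
    (hD : 2000 ^ 2 * Q.card ≤ D ^ 2) (hkD : 2 * k ≤ D) (hp : Q.card ≤ p ^ 2) :
    ∃ v ∈ Q, (lightNeighbours Q v).card ≤ D := by
  by_contra hlt
  push Not at hlt
  set m := Q.card with hm
  have hm0 : 0 < m := hne.card_pos
  have hDm : D < m := by
    obtain ⟨v, hv⟩ := hne
    exact (hlt v hv).trans_le (Finset.card_le_card (Finset.filter_subset _ _))
  set d := Nat.sqrt (m / 6) with hd
  have hd1 : 6 * d ^ 2 ≤ m := by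
    have h : d ^ 2 ≤ m / 6 := Nat.sqrt_le' (m / 6)
    omega
  have hd2 : m < 6 * (d + 1) ^ 2 := by
    have h : m / 6 < (d + 1) ^ 2 := Nat.lt_succ_sqrt' (m / 6)
    omega
  have hm6 : 2000 ^ 2 < m := by
    by_contra h
    nlinarith
  have hd0 : 1 ≤ d := by
    by_contra h
    have : d = 0 := by omega
    rw [this] at hd2; omega
  have hm24 : m ≤ 24 * d ^ 2 := by nlinarith
  have hDd : 4100 * d ≤ D := by
    by_contra h
    push Not at h
    have h1 : D * D ≤ (4100 * d) * (4100 * d) := Nat.mul_le_mul h.le h.le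
    nlinarith
  obtain ⟨s, hs1, hs2⟩ : ∃ s, d ^ 2 ≤ 6 * s ∧ 6 * s < d ^ 2 + 5 * d + 6 :=
    ⟨(d ^ 2 + 5 * d + 5) / 6, by omega, by omega⟩
  obtain ⟨S, hSQ, hSs, hS⟩ := exists_sample_many_neighbours (Q := Q) (N := lightNeighbours Q)
    (d := d) (D := D) (by omega)
    (fun v hv => ⟨Finset.filter_subset _ _, (hlt v hv).le⟩) hne s
    (sampling_numerics hd0 hm24 hm0 hDd hDm.le hs1)
  have hinj : ∀ v ∈ Q, Set.InjOn (crossParam v) (lightNeighbours Q v) := by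
    intro v hv w hw w' hw' heq
    obtain ⟨h1, h2, h3⟩ := Finset.mem_filter.1 hw
    obtain ⟨h1', h2', h3'⟩ := Finset.mem_filter.1 hw'
    by_contra hww
    refine htri v hv w h1 w' h1' h2.symm h2'.symm hww h3 h3'
      (lightForm_eq_zero_of_linePoint_eq (t := crossParam v w) ?_)
    rw [← linePoint_crossParam (hx v hv w h1 h2.symm h3).symm h3, heq,
      ← linePoint_crossParam (hx v hv w' h1' h2'.symm h3').symm h3']
  have hNp : ∀ v ∈ Q, ∀ w ∈ lightNeighbours Q v, w.1 ≠ v.1 ∧ lightForm v w = 0 := by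
    intro v hv w hw
    obtain ⟨h1, h2, h3⟩ := Finset.mem_filter.1 hw
    exact ⟨(hx v hv w h1 h2.symm h3).symm, h3⟩
  have hsurf : ∃ f : MvPolynomial (Fin 3) F, f ≠ 0 ∧ f.totalDegree ≤ d ∧
      ∀ v ∈ Q, lineRestrict v f = 0 := by
    obtain ⟨f, hf0, hfd, hfS⟩ := exists_surface_through_lines S d (by
      have h1 : S.card * (d + 1) ≤ s * (d + 1) := Nat.mul_le_mul_right _ hSs
      have h2 := Nat.descFactorial_eq_factorial_mul_choose (d + 3) 3
      simp [Nat.descFactorial, Nat.factorial] at h2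
      have h3 : 6 * s * (d + 1) < (d ^ 2 + 5 * d + 6) * (d + 1) :=
        Nat.mul_lt_mul_of_pos_right hs2 (Nat.succ_pos _)
      nlinarith)
    refine ⟨f, hf0, hfd, fun v hv => ?_⟩
    refine eq_zero_of_eval_crossParam (N := lightNeighbours Q v ∩ S)
      ((hinj v hv).mono (by intro w hw; exact (Finset.mem_inter.1 hw).1))
      (((natDegree_lineRestrict_le v f).trans hfd).trans_lt (hS v hv)) fun w hw => ?_
    obtain ⟨hw1, hw2⟩ := Finset.mem_inter.1 hw
    obtain ⟨h1, h2⟩ := hNp v hv w hw1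
    rw [eval_lineRestrict, linePoint_crossParam h1 h2, ← eval_lineRestrict, hfS w hw2,
      Polynomial.eval_zero]
  have hdp : 2 * d < p := by
    by_contra h
    have : p ^ 2 ≤ (2 * d) ^ 2 := Nat.pow_le_pow_left (not_lt.1 h) 2
    nlinarith
  have hfin := card_lines_on_surface_le (p := p) (d := d) (k := k) hdp hsurf fun v hv =>
    ⟨lightNeighbours Q v, Finset.filter_subset _ _, hinj v hv, hNp v hv, hk v hv, by
      have := hlt v hv; omega, by have := hlt v hv; omega⟩
  nlinarith

/-- The number of crossings in a family of light lines without triangles. -/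
theorem sum_lightNeighbours_card_le {p : ℕ} [CharP F p] {k D : ℕ} (Q : Finset (F × F × F))
    (hx : ∀ v ∈ Q, ∀ w ∈ Q, v ≠ w → lightForm v w = 0 → v.1 ≠ w.1)
    (htri : ∀ u ∈ Q, ∀ v ∈ Q, ∀ w ∈ Q, u ≠ v → u ≠ w → v ≠ w → lightForm u v = 0 →
      lightForm u w = 0 → lightForm v w ≠ 0)
    (hk : ∀ v ∈ Q, ∀ c e d : F, (c ≠ 0 ∨ e ≠ 0) →
      ((lightNeighbours Q v).filter fun w => c * w.2.1 + e * w.1 = d).card ≤ k)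
    (hD : 2000 ^ 2 * Q.card ≤ D ^ 2) (hkD : 2 * k ≤ D) (hp : Q.card ≤ p ^ 2) :
    ∑ v ∈ Q, (lightNeighbours Q v).card ≤ 2 * D * Q.card := by
  induction Q using Finset.strongInduction with
  | H Q ih =>
  rcases Q.eq_empty_or_nonempty with rfl | hne
  · simp
  obtain ⟨v, hv, hdeg⟩ := exists_lightNeighbours_card_le (p := p) hne hx htri hk hD hkD hp
  have hsub := Finset.erase_subset v Q
  have hcard := Finset.card_erase_add_one hv
  have hmono : ∀ w, lightNeighbours (Q.erase v) w ⊆ lightNeighbours Q w := fun w =>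
    Finset.filter_subset_filter _ hsub
  have h1 := ih (Q.erase v) (Finset.erase_ssubset hv)
    (fun a ha b hb => hx a (hsub ha) b (hsub hb))
    (fun a ha b hb c hc => htri a (hsub ha) b (hsub hb) c (hsub hc))
    (fun a ha c e d hce =>
      (Finset.card_le_card (Finset.filter_subset_filter _ (hmono a))).trans
        (hk a (hsub ha) c e d hce))
    (by omega) (by omega)
  have h2 : ∀ w ∈ Q.erase v, (lightNeighbours Q w).card =
      (lightNeighbours (Q.erase v) w).card + if w ∈ lightNeighbours Q v then 1 else 0 := by
    intro w hw
    obtain ⟨hwv, hwQ⟩ := Finset.mem_erase.1 hw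
    have e : lightNeighbours (Q.erase v) w = (lightNeighbours Q w).erase v := by
      unfold lightNeighbours; rw [Finset.filter_erase]
    rw [e]
    have hiff : w ∈ lightNeighbours Q v ↔ v ∈ lightNeighbours Q w := by
      simp [lightNeighbours, hv, hwQ, hwv, Ne.symm hwv, lightForm_swap w v]
    by_cases hmem : v ∈ lightNeighbours Q w
    · rw [if_pos (hiff.2 hmem), Finset.card_erase_add_one hmem]
    · rw [if_neg (mt hiff.1 hmem), Finset.erase_eq_of_notMem hmem, add_zero]
  have h3 : ∑ w ∈ Q.erase v, (if w ∈ lightNeighbours Q v then 1 else 0) ≤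
      (lightNeighbours Q v).card := by
    rw [← Finset.sum_filter, ← Finset.card_eq_sum_ones]
    exact Finset.card_le_card fun w hw => (Finset.mem_filter.1 hw).2
  rw [← Finset.add_sum_erase _ _ hv, Finset.sum_congr rfl h2, Finset.sum_add_distrib, ← hcard]
  have : 2 * D * ((Q.erase v).card + 1) = 2 * D * (Q.erase v).card + 2 * D := by ring
  omega

end Core

section Genericity

variable {F : Type*} [Field F]

theorem ratFunc_cubic_eq_zero {c₀ c₁ c₂ c₃ : F}
    (h : RatFunc.C c₀ + RatFunc.C c₁ * RatFunc.X + RatFunc.C c₂ * RatFunc.X ^ 2 +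
      RatFunc.C c₃ * RatFunc.X ^ 3 = 0) : c₀ = 0 ∧ c₁ = 0 ∧ c₂ = 0 ∧ c₃ = 0 := by
  have h1 : algebraMap (Polynomial F) (RatFunc F) (Polynomial.C c₀ +
      Polynomial.C c₁ * Polynomial.X + Polynomial.C c₂ * Polynomial.X ^ 2 +
      Polynomial.C c₃ * Polynomial.X ^ 3) = 0 := by
    simpa using h
  have h2 := (map_eq_zero_iff _ (RatFunc.algebraMap_injective F)).1 h1
  have e0 := congrArg (fun f => Polynomial.coeff f 0) h2
  have e1 := congrArg (fun f => Polynomial.coeff f 1) h2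
  have e2 := congrArg (fun f => Polynomial.coeff f 2) h2
  have e3 := congrArg (fun f => Polynomial.coeff f 3) h2
  simp [Polynomial.coeff_X, Polynomial.coeff_X_pow, Polynomial.coeff_C] at e0 e1 e2 e3
  exact ⟨e0, e1, e2, e3⟩

/-- Generic deformation of the first family of points. -/
noncomputable def redMap (v : F × F × F) : RatFunc F × RatFunc F × RatFunc F :=
  (RatFunc.X ^ 3 * RatFunc.C v.1, RatFunc.C v.2.1,
    RatFunc.C v.2.2 + RatFunc.X ^ 2 * RatFunc.C v.1 + RatFunc.X * RatFunc.C v.2.1)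

/-- Generic deformation of the second family of points, dual to `redMap`. -/
noncomputable def blueMap (v : F × F × F) : RatFunc F × RatFunc F × RatFunc F :=
  (RatFunc.C v.1 - RatFunc.X, (RatFunc.C v.2.1 + RatFunc.X ^ 2) / RatFunc.X ^ 3,
    RatFunc.C v.2.2)

theorem lightForm_redMap_blueMap (v w : F × F × F) :
    lightForm (redMap v) (blueMap w) = RatFunc.C (lightForm v w) := by
  have hX : (RatFunc.X : RatFunc F) ≠ 0 := RatFunc.X_ne_zero
  simp only [lightForm, redMap, blueMap, map_add, map_sub, map_mul]
  field_simp
  ring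

theorem lightForm_redMap_blueMap_eq_zero {v w : F × F × F} :
    lightForm (redMap v) (blueMap w) = 0 ↔ lightForm v w = 0 := by
  rw [lightForm_redMap_blueMap, map_eq_zero]

theorem eq_of_lightForm_redMap {v w : F × F × F} (h : lightForm (redMap v) (redMap w) = 0) :
    v = w := by
  obtain ⟨h0, h1, h2, -⟩ := ratFunc_cubic_eq_zero (c₀ := v.2.2 - w.2.2) (c₁ := v.2.1 - w.2.1)
    (c₂ := v.1 - w.1) (c₃ := v.2.1 * w.1 - w.2.1 * v.1) (by
      rw [← h]; simp only [lightForm, redMap, map_sub, map_mul]; ring)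
  exact Prod.ext (sub_eq_zero.1 h2) (Prod.ext (sub_eq_zero.1 h1) (sub_eq_zero.1 h0))

theorem eq_of_lightForm_blueMap {v w : F × F × F} (h : lightForm (blueMap v) (blueMap w) = 0) :
    v = w := by
  have hX : (RatFunc.X : RatFunc F) ≠ 0 := RatFunc.X_ne_zero
  obtain ⟨-, h1, h2, h3⟩ := ratFunc_cubic_eq_zero (c₀ := v.2.1 * w.1 - w.2.1 * v.1)
    (c₁ := w.2.1 - v.2.1) (c₂ := w.1 - v.1) (c₃ := v.2.2 - w.2.2) (by
      have h' : RatFunc.X ^ 3 * lightForm (blueMap v) (blueMap w) = 0 := by rw [h, mul_zero]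
      rw [← h']
      simp only [lightForm, blueMap, map_sub, map_mul]
      field_simp
      ring)
  exact Prod.ext (sub_eq_zero.1 h2).symm
    (Prod.ext (sub_eq_zero.1 h1).symm (sub_eq_zero.1 h3))

theorem redMap_fst_ne_blueMap_fst (v w : F × F × F) : (redMap v).1 ≠ (blueMap w).1 := by
  intro h
  obtain ⟨-, h1, -⟩ := ratFunc_cubic_eq_zero (c₀ := -w.1) (c₁ := 1) (c₂ := 0) (c₃ := v.1) (by
    simp only [redMap, blueMap] at h
    simp only [map_neg, map_one, map_zero]
    linear_combination h)
  exact one_ne_zero h1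

theorem redMap_injective : Function.Injective (redMap : F × F × F → _) := by
  intro v w h
  exact eq_of_lightForm_redMap (by rw [h]; unfold lightForm; ring)

theorem blueMap_injective : Function.Injective (blueMap : F × F × F → _) := by
  intro v w h
  exact eq_of_lightForm_blueMap (by rw [h]; unfold lightForm; ring)

/-- A linear condition over an extension field cuts out no more points on a rational family than
some rational linear condition does. -/
theorem card_filter_linear_le {S : Finset (F × F × F)} {k : ℕ} (hk1 : 1 ≤ k)
    (hinj : ∀ v ∈ S, ∀ w ∈ S, v.1 = w.1 → v.2.1 = w.2.1 → v = w)
    (hk : ∀ c e d : F, (c ≠ 0 ∨ e ≠ 0) →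
      (S.filter fun w => c * w.2.1 + e * w.1 = d).card ≤ k)
    (c e d : RatFunc F) (hce : c ≠ 0 ∨ e ≠ 0) :
    (S.filter fun w => c * RatFunc.C w.2.1 + e * RatFunc.C w.1 = d).card ≤ k := by
  by_contra hlt
  push Not at hlt
  obtain ⟨v, hv, w, hw, hvw⟩ := Finset.one_lt_card.1 (lt_of_le_of_lt hk1 hlt)
  obtain ⟨hvS, hv⟩ := Finset.mem_filter.1 hv
  obtain ⟨hwS, hw⟩ := Finset.mem_filter.1 hw
  set δ := v.2.1 - w.2.1 with hδ
  set ε := v.1 - w.1 with hε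
  have hδε : δ ≠ 0 ∨ ε ≠ 0 := by
    by_contra h
    push Not at h
    exact hvw (hinj v hvS w hwS (sub_eq_zero.1 h.2) (sub_eq_zero.1 h.1))
  have h0 : c * RatFunc.C δ + e * RatFunc.C ε = 0 := by
    rw [hδ, hε, map_sub, map_sub]; linear_combination hv - hw
  refine absurd (hk ε (-δ) (ε * v.2.1 + (-δ) * v.1) (by
    rcases hδε with h | h
    · exact Or.inr (neg_ne_zero.2 h)
    · exact Or.inl h)) (not_le.2 (hlt.trans_le (Finset.card_le_card ?_)))
  intro u hu
  obtain ⟨huS, hu⟩ := Finset.mem_filter.1 hu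
  refine Finset.mem_filter.2 ⟨huS, ?_⟩
  apply (RatFunc.C (K := F)).injective
  rw [← sub_eq_zero]
  simp only [map_add, map_mul, map_neg]
  have h1 : c * (RatFunc.C u.2.1 - RatFunc.C v.2.1) + e * (RatFunc.C u.1 - RatFunc.C v.1) = 0 := by
    linear_combination hu - hv
  rcases hce with h | h
  · refine (mul_eq_zero.1 (?_ : c * _ = 0)).resolve_left h
    linear_combination RatFunc.C ε * h1 - (RatFunc.C u.1 - RatFunc.C v.1) * h0
  · refine (mul_eq_zero.1 (?_ : e * _ = 0)).resolve_left h
    linear_combination (-RatFunc.C δ) * h1 + (RatFunc.C u.2.1 - RatFunc.C v.2.1) * h0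

/-- Rudnev-type point-plane incidence bound for two families of points. -/
theorem card_lightForm_eq_zero_le {p : ℕ} [CharP F p] {k D : ℕ} (R B : Finset (F × F × F))
    (hk1 : 1 ≤ k)
    (hB : ∀ q ∈ R, ∀ c e d : F, (c ≠ 0 ∨ e ≠ 0) →
      (B.filter fun w => lightForm q w = 0 ∧ c * w.2.1 + e * w.1 = d).card ≤ k)
    (hR : ∀ q ∈ B, ∀ c e d : F, (c ≠ 0 ∨ e ≠ 0) →
      (R.filter fun w => lightForm w q = 0 ∧ c * w.2.1 + e * w.1 = d).card ≤ k)
    (hD : 2000 ^ 2 * (R.card + B.card) ≤ D ^ 2) (hkD : 2 * k ≤ D)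
    (hp : R.card + B.card ≤ p ^ 2) :
    ((R ×ˢ B).filter fun q => lightForm q.1 q.2 = 0).card ≤ 2 * D * (R.card + B.card) := by
  have hX : (RatFunc.X : RatFunc F) ≠ 0 := RatFunc.X_ne_zero
  have : CharP (RatFunc F) p := charP_of_injective_ringHom (RatFunc.C (K := F)).injective p
  set Q := R.image redMap ∪ B.image blueMap with hQ
  have hQc : Q.card ≤ R.card + B.card :=
    (Finset.card_union_le _ _).trans (Nat.add_le_add Finset.card_image_le Finset.card_image_le)
  have hmem : ∀ v, v ∈ Q ↔ (∃ q ∈ R, redMap q = v) ∨ ∃ q ∈ B, blueMap q = v := by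
    intro v; simp only [hQ, Finset.mem_union, Finset.mem_image]
  have hkey : ∑ v ∈ Q, (lightNeighbours Q v).card ≤ 2 * D * Q.card := by
    refine sum_lightNeighbours_card_le (p := p) (k := k) Q ?_ ?_ ?_ (by omega) hkD (by omega)
    · intro v hv w hw hne h0
      rcases (hmem v).1 hv with ⟨q, hq, rfl⟩ | ⟨q, hq, rfl⟩ <;>
        rcases (hmem w).1 hw with ⟨r, hr, rfl⟩ | ⟨r, hr, rfl⟩
      · exact absurd (congrArg _ (eq_of_lightForm_redMap h0)) hne
      · exact redMap_fst_ne_blueMap_fst q r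
      · exact (redMap_fst_ne_blueMap_fst r q).symm
      · exact absurd (congrArg _ (eq_of_lightForm_blueMap h0)) hne
    · intro u hu v hv w hw huv huw hvw h1 h2 h3
      rcases (hmem u).1 hu with ⟨q, hq, rfl⟩ | ⟨q, hq, rfl⟩ <;>
        rcases (hmem v).1 hv with ⟨r, hr, rfl⟩ | ⟨r, hr, rfl⟩ <;>
        rcases (hmem w).1 hw with ⟨s, hs, rfl⟩ | ⟨s, hs, rfl⟩
      · exact huv (congrArg _ (eq_of_lightForm_redMap h1))
      · exact huv (congrArg _ (eq_of_lightForm_redMap h1))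
      · exact huw (congrArg _ (eq_of_lightForm_redMap h2))
      · exact hvw (congrArg _ (eq_of_lightForm_blueMap h3))
      · exact hvw (congrArg _ (eq_of_lightForm_redMap h3))
      · exact huw (congrArg _ (eq_of_lightForm_blueMap h2))
      · exact huv (congrArg _ (eq_of_lightForm_blueMap h1))
      · exact huv (congrArg _ (eq_of_lightForm_blueMap h1))
    · intro v hv c e d hce
      rcases (hmem v).1 hv with ⟨q, hq, rfl⟩ | ⟨q, hq, rfl⟩
      · have h := card_filter_linear_le (S := B.filter fun w => lightForm q w = 0) hk1 (by
            intro v hv w hw h1 h2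
            have e1 := (Finset.mem_filter.1 hv).2
            have e2 := (Finset.mem_filter.1 hw).2
            unfold lightForm at e1 e2
            refine Prod.ext h1 (Prod.ext h2 ?_)
            rw [h1, h2] at e1
            linear_combination e2 - e1)
          (by intro c e d h; rw [Finset.filter_filter]; exact hB q hq c e d h)
          (c / RatFunc.X ^ 3) e (d + e * RatFunc.X - c / RatFunc.X) (by
            rcases hce with h | h
            · exact Or.inl (div_ne_zero h (pow_ne_zero _ hX))
            · exact Or.inr h)
        refine le_trans ?_ h
        rw [← Finset.card_image_of_injective _ (blueMap_injective (F := F))]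
        refine Finset.card_le_card fun w hw => ?_
        obtain ⟨hw1, hw2⟩ := Finset.mem_filter.1 hw
        obtain ⟨hwQ, hwne, hw0⟩ := Finset.mem_filter.1 hw1
        rcases (hmem w).1 hwQ with ⟨r, hr, rfl⟩ | ⟨r, hr, rfl⟩
        · exact absurd (congrArg _ (eq_of_lightForm_redMap hw0).symm) hwne
        · refine Finset.mem_image_of_mem _ (Finset.mem_filter.2 ⟨Finset.mem_filter.2
            ⟨hr, lightForm_redMap_blueMap_eq_zero.1 hw0⟩, ?_⟩)
          rw [← hw2]
          simp only [blueMap]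
          field_simp
          ring
      · have h := card_filter_linear_le (S := R.filter fun w => lightForm w q = 0) hk1 (by
            intro v hv w hw h1 h2
            have e1 := (Finset.mem_filter.1 hv).2
            have e2 := (Finset.mem_filter.1 hw).2
            unfold lightForm at e1 e2
            refine Prod.ext h1 (Prod.ext h2 ?_)
            rw [h1, h2] at e1
            linear_combination e1 - e2)
          (by intro c e d h; rw [Finset.filter_filter]; exact hR q hq c e d h)
          c (e * RatFunc.X ^ 3) d (by
            rcases hce with h | h
            · exact Or.inl h
            · exact Or.inr (mul_ne_zero h (pow_ne_zero _ hX)))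
        refine le_trans ?_ h
        rw [← Finset.card_image_of_injective _ (redMap_injective (F := F))]
        refine Finset.card_le_card fun w hw => ?_
        obtain ⟨hw1, hw2⟩ := Finset.mem_filter.1 hw
        obtain ⟨hwQ, hwne, hw0⟩ := Finset.mem_filter.1 hw1
        rcases (hmem w).1 hwQ with ⟨r, hr, rfl⟩ | ⟨r, hr, rfl⟩
        · rw [lightForm_swap, neg_eq_zero] at hw0
          refine Finset.mem_image_of_mem _ (Finset.mem_filter.2 ⟨Finset.mem_filter.2
            ⟨hr, lightForm_redMap_blueMap_eq_zero.1 hw0⟩, ?_⟩)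
          rw [← hw2]
          simp only [redMap]
          ring
        · exact absurd (congrArg _ (eq_of_lightForm_blueMap hw0).symm) hwne
  refine le_trans ?_ (hkey.trans (Nat.mul_le_mul_left _ hQc))
  rw [← Finset.card_sigma]
  refine Finset.card_le_card_of_injOn (fun q => ⟨redMap q.1, blueMap q.2⟩) ?_ ?_
  · intro q hq
    obtain ⟨h1, h2⟩ := Finset.mem_filter.1 hq
    obtain ⟨h3, h4⟩ := Finset.mem_product.1 h1
    refine Finset.mem_coe.2 (Finset.mem_sigma.2 ⟨(hmem _).2 (Or.inl ⟨_, h3, rfl⟩),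
      Finset.mem_filter.2 ⟨(hmem _).2 (Or.inr ⟨_, h4, rfl⟩), fun h => ?_,
        lightForm_redMap_blueMap_eq_zero.2 h2⟩⟩)
    exact redMap_fst_ne_blueMap_fst q.1 q.2 (congrArg Prod.fst h.symm)
  · intro q _ r _ h
    obtain ⟨h1, h2⟩ := Sigma.mk.inj_iff.1 h
    exact Prod.ext (redMap_injective h1) (blueMap_injective (eq_of_heq h2))

end Genericity

section Counting

theorem sum_card_fiber_mul {ι ι' κ : Type*} [Fintype κ] (S : Finset ι) (T : Finset ι')
    (f : ι → κ) (g : ι' → κ) :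
    ∑ y, (S.filter fun s => f s = y).card * (T.filter fun t => g t = y).card =
      ((S ×ˢ T).filter fun q => f q.1 = g q.2).card := by
  rw [Finset.card_eq_sum_card_fiberwise (f := fun q : ι × ι' => f q.1) (t := Finset.univ)
    (fun _ _ => Finset.mem_coe.2 (Finset.mem_univ _))]
  refine Finset.sum_congr rfl fun y _ => ?_
  rw [← Finset.card_product]
  congr 1
  ext ⟨s, t⟩
  simp only [Finset.mem_product, Finset.mem_filter]
  constructor
  · rintro ⟨⟨h1, h2⟩, h3, h4⟩
    exact ⟨⟨⟨h1, h3⟩, h2.trans h4.symm⟩, h2⟩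
  · rintro ⟨⟨⟨h1, h3⟩, h2⟩, h4⟩
    exact ⟨⟨h1, h4⟩, h3, h2.symm.trans h4⟩

theorem sum_card_fiber {ι κ : Type*} [Fintype κ] (S : Finset ι) (f : ι → κ) :
    ∑ y, (S.filter fun s => f s = y).card = S.card :=
  (Finset.card_eq_sum_card_fiberwise (fun _ _ => Finset.mem_coe.2 (Finset.mem_univ _))).symm

theorem sq_card_coincidence_le {ι ι' κ : Type*} [Fintype κ] (S : Finset ι) (T : Finset ι')
    (f : ι → κ) (g : ι' → κ) :
    ((S ×ˢ T).filter fun q => f q.1 = g q.2).card ^ 2 ≤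
      ((S ×ˢ S).filter fun q => f q.1 = f q.2).card *
        ((T ×ˢ T).filter fun q => g q.1 = g q.2).card := by
  rw [← sum_card_fiber_mul, ← sum_card_fiber_mul, ← sum_card_fiber_mul]
  simp only [← sq]
  exact Finset.sum_mul_sq_le_sq_mul_sq _ _ _

theorem card_mul_sq_le_coincidence {ι κ : Type*} [Fintype κ] (S : Finset ι) (f : ι → κ)
    (I : Finset κ) {τ : ℝ} (hτ : 0 ≤ τ) (h : ∀ i ∈ I, τ ≤ (S.filter fun s => f s = i).card) :
    (I.card : ℝ) * τ ^ 2 ≤ ((S ×ˢ S).filter fun q => f q.1 = f q.2).card := by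
  rw [← sum_card_fiber_mul]
  push_cast
  calc (I.card : ℝ) * τ ^ 2 = ∑ _i ∈ I, τ ^ 2 := by rw [Finset.sum_const, nsmul_eq_mul]
    _ ≤ ∑ i ∈ I, ((S.filter fun s => f s = i).card : ℝ) * (S.filter fun s => f s = i).card := by
      refine Finset.sum_le_sum fun i hi => ?_
      rw [sq]
      exact mul_le_mul (h i hi) (h i hi) hτ (Nat.cast_nonneg _)
    _ ≤ _ := Finset.sum_le_sum_of_subset_of_nonneg (Finset.subset_univ _)
      fun i _ _ => mul_self_nonneg _

end Counting

section Incidence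

variable {F : Type*} [Field F]

theorem card_lightForm_eq_zero_le_real {p : ℕ} [CharP F p] {k : ℕ} {n : ℝ}
    (R B : Finset (F × F × F)) (hk1 : 1 ≤ k)
    (hB : ∀ q ∈ R, ∀ c e d : F, (c ≠ 0 ∨ e ≠ 0) →
      (B.filter fun w => lightForm q w = 0 ∧ c * w.2.1 + e * w.1 = d).card ≤ k)
    (hR : ∀ q ∈ B, ∀ c e d : F, (c ≠ 0 ∨ e ≠ 0) →
      (R.filter fun w => lightForm w q = 0 ∧ c * w.2.1 + e * w.1 = d).card ≤ k)
    (hRn : (R.card : ℝ) ≤ n) (hBn : (B.card : ℝ) ≤ n) (hp : 2 * n ≤ (p : ℝ) ^ 2) :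
    (((R ×ˢ B).filter fun q => lightForm q.1 q.2 = 0).card : ℝ) ≤
      (2 ^ 15 * √n + 8 * k) * R.card + (2 ^ 15 * √n + 8 * k) * B.card := by
  have hn0 : 0 ≤ n := (Nat.cast_nonneg _).trans hRn
  set M := R.card + B.card with hM
  have hMn : (M : ℝ) ≤ 2 * n := by rw [hM]; push_cast; linarith
  rcases Nat.eq_zero_or_pos M with h0 | hpos
  · have : R = ∅ := Finset.card_eq_zero.1 (by omega)
    subst this
    simp only [Finset.empty_product, Finset.filter_empty, Finset.card_empty, Nat.cast_zero]
    positivity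
  · have h := card_lightForm_eq_zero_le (p := p) (k := k)
      (D := 2 * k + 2000 * (Nat.sqrt M + 1)) R B hk1 hB hR (by
        have := Nat.lt_succ_sqrt' M
        rw [Nat.succ_eq_add_one] at this
        calc 2000 ^ 2 * (R.card + B.card) ≤ 2000 ^ 2 * (Nat.sqrt M + 1) ^ 2 := by
              rw [← hM]; gcongr
          _ = (2000 * (Nat.sqrt M + 1)) ^ 2 := by ring
          _ ≤ _ := Nat.pow_le_pow_left (Nat.le_add_left _ _) 2) (by omega) (by
        exact_mod_cast hMn.trans hp)
    have h' : (((R ×ˢ B).filter fun q => lightForm q.1 q.2 = 0).card : ℝ) ≤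
        2 * (2 * k + 2000 * (Nat.sqrt M + 1)) * (R.card + B.card) := by exact_mod_cast h
    have h1 : (Nat.sqrt M : ℝ) ≤ √(M : ℝ) := Real.nat_sqrt_le_real_sqrt
    have h2 : (1 : ℝ) ≤ √(M : ℝ) := by
      rw [Real.one_le_sqrt]; exact_mod_cast hpos
    have h3 : √(M : ℝ) ≤ 2 * √n := by
      rw [Real.sqrt_le_left (by positivity), mul_pow, Real.sq_sqrt hn0]
      linarith
    have h4 : 2 * (2 * (k : ℝ) + 2000 * (Nat.sqrt M + 1)) ≤ 2 ^ 15 * √n + 8 * k := by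
      have : (0 : ℝ) ≤ k := Nat.cast_nonneg k
      nlinarith [Real.sqrt_nonneg n]
    calc _ ≤ _ := h'
      _ ≤ (2 ^ 15 * √n + 8 * k) * (R.card + B.card) := by gcongr
      _ = _ := by ring

theorem card_lines_through [Fintype F] (q : F × F) :
    (Finset.univ.filter fun l : F × F => q.2 = l.1 * q.1 + l.2).card = Fintype.card F := by
  have : (Finset.univ.filter fun l : F × F => q.2 = l.1 * q.1 + l.2) =
      Finset.univ.image fun α : F => (α, q.2 - α * q.1) := by
    ext ⟨α, β⟩
    simp only [Finset.mem_filter, Finset.mem_univ, true_and, Finset.mem_image, Prod.mk.injEq]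
    constructor
    · intro h; exact ⟨α, rfl, by rw [h]; ring⟩
    · rintro ⟨_, rfl, rfl⟩; ring
  rw [this, Finset.card_image_of_injective _ (fun a b h => (Prod.mk.inj h).1), Finset.card_univ]

theorem sum_nPts [Fintype F] (A B : Finset F) :
    ∑ l, nPts A B l = Fintype.card F * (A.card * B.card) := by
  unfold nPts
  simp only [Finset.card_filter]
  rw [Finset.sum_comm]
  simp only [← Finset.card_filter, card_lines_through]
  rw [Finset.sum_const, Finset.card_product, smul_eq_mul, mul_comm]

theorem eq_of_two_points {l l' q r : F × F} (hq : q.2 = l.1 * q.1 + l.2)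
    (hq' : q.2 = l'.1 * q.1 + l'.2) (hr : r.2 = l.1 * r.1 + l.2)
    (hr' : r.2 = l'.1 * r.1 + l'.2) (hqr : q ≠ r) : l = l' := by
  have hne : q.1 ≠ r.1 := by
    intro h
    refine hqr (Prod.ext h ?_)
    rw [hq, hr, h]
  have h1 : (l.1 - l'.1) * (q.1 - r.1) = 0 := by linear_combination hq' - hq - hr' + hr
  have h2 : l.1 = l'.1 :=
    sub_eq_zero.1 ((mul_eq_zero.1 h1).resolve_right (sub_ne_zero.2 hne))
  refine Prod.ext h2 ?_
  rw [h2] at hq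
  linear_combination hq' - hq

theorem sum_nPts_sq_le [Fintype F] (A B : Finset F) :
    ∑ l, nPts A B l ^ 2 ≤
      Fintype.card F * (A.card * B.card) + (A.card * B.card) ^ 2 := by
  have h1 : ∀ l : F × F, nPts A B l ^ 2 = ∑ q ∈ A ×ˢ B, ∑ r ∈ A ×ˢ B,
      if q.2 = l.1 * q.1 + l.2 ∧ r.2 = l.1 * r.1 + l.2 then 1 else 0 := by
    intro l
    unfold nPts
    rw [sq, Finset.card_filter, Finset.sum_mul_sum]
    refine Finset.sum_congr rfl fun q _ => Finset.sum_congr rfl fun r _ => ?_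
    by_cases hq : q.2 = l.1 * q.1 + l.2 <;> by_cases hr : r.2 = l.1 * r.1 + l.2 <;> simp [hq, hr]
  simp only [h1]
  rw [Finset.sum_comm]
  calc _ ≤ ∑ q ∈ A ×ˢ B, (Fintype.card F + A.card * B.card) := by
        refine Finset.sum_le_sum fun q hq => ?_
        rw [Finset.sum_comm, ← Finset.add_sum_erase _ _ hq]
        refine Nat.add_le_add ?_ ?_
        · simp only [and_self, ← Finset.card_filter, card_lines_through]; exact le_rfl
        · calc _ ≤ ∑ r ∈ (A ×ˢ B).erase q, 1 := by
                refine Finset.sum_le_sum fun r hr => ?_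
                rw [← Finset.card_filter, Finset.card_le_one]
                intro l hl l' hl'
                have e := (Finset.mem_filter.1 hl).2
                have e' := (Finset.mem_filter.1 hl').2
                exact eq_of_two_points e.1 e'.1 e.2 e'.2 (Finset.ne_of_mem_erase hr).symm
            _ ≤ A.card * B.card := by
                rw [← Finset.card_eq_sum_ones, ← Finset.card_product]
                exact Finset.card_le_card (Finset.erase_subset _ _)
    _ = _ := by
      rw [Finset.sum_const, Finset.card_product, smul_eq_mul]; ring

/-- Balanced number of points of `A × A` on a line. -/
noncomputable def balancedPts [Fintype F] (A : Finset F) (l : F × F) : ℝ :=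
  nPts A A l - (A.card : ℝ) ^ 2 / Fintype.card F

theorem balancedPts_le [Fintype F] (A : Finset F) (l : F × F) :
    balancedPts A l ≤ nPts A A l := by
  unfold balancedPts
  have : 0 ≤ (A.card : ℝ) ^ 2 / Fintype.card F := by positivity
  linarith

theorem sum_balancedPts_sq_le [Fintype F] (A : Finset F) :
    ∑ l, balancedPts A l ^ 2 ≤ Fintype.card F * (A.card : ℝ) ^ 2 := by
  have hq : (0 : ℝ) < Fintype.card F := by exact_mod_cast Fintype.card_pos
  have h1 : (∑ l, (nPts A A l : ℝ)) = Fintype.card F * (A.card * A.card) := by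
    exact_mod_cast sum_nPts A A
  have h2 : (∑ l, (nPts A A l : ℝ) ^ 2) ≤
      Fintype.card F * (A.card * A.card) + (A.card * A.card) ^ 2 := by
    exact_mod_cast sum_nPts_sq_le A A
  have h3 : ∀ l, balancedPts A l ^ 2 = (nPts A A l : ℝ) ^ 2 -
      2 * ((A.card : ℝ) ^ 2 / Fintype.card F) * nPts A A l +
        ((A.card : ℝ) ^ 2 / Fintype.card F) ^ 2 := by
    intro l; unfold balancedPts; ring
  simp only [h3]
  rw [Finset.sum_add_distrib, Finset.sum_sub_distrib, ← Finset.mul_sum, h1, Finset.sum_const,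
    Finset.card_univ, Fintype.card_prod, nsmul_eq_mul]
  push_cast
  have h4 : 2 * ((A.card : ℝ) ^ 2 / Fintype.card F) *
      (Fintype.card F * (A.card * A.card)) = 2 * (A.card : ℝ) ^ 4 := by field_simp
  have h5 : (Fintype.card F : ℝ) * Fintype.card F * ((A.card : ℝ) ^ 2 / Fintype.card F) ^ 2 =
      (A.card : ℝ) ^ 4 := by field_simp
  rw [h4, h5]
  nlinarith

theorem nPts_le_left (A B : Finset F) (l : F × F) : nPts A B l ≤ A.card := by
  unfold nPts
  refine Finset.card_le_card_of_injOn Prod.fst ?_ ?_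
  · intro q hq
    exact (Finset.mem_product.1 (Finset.mem_filter.1 hq).1).1
  · intro q hq r hr h
    have e1 := (Finset.mem_filter.1 hq).2
    have e2 := (Finset.mem_filter.1 hr).2
    exact Prod.ext h (by rw [e1, e2, h])

/-- Rich lines through a common point. -/
theorem card_pencil_mul_le (A B : Finset F) (G : Finset (F × F)) {κ : ℝ} (hκ : 2 ≤ κ)
    (hG : ∀ g ∈ G, κ ≤ nPts A B g) (x y : F) :
    ((G.filter fun g => y = g.1 * x + g.2).card : ℝ) * κ ≤ 2 * (A.card * B.card) := by
  set P := G.filter fun g => y = g.1 * x + g.2 with hP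
  have h1 : ∀ g ∈ P, κ / 2 ≤
      (((A ×ˢ B).filter fun q => q.2 = g.1 * q.1 + g.2).erase (x, y)).card := by
    intro g hg
    have h2 := hG g (Finset.mem_filter.1 hg).1
    have h3 := Finset.pred_card_le_card_erase
      (s := (A ×ˢ B).filter fun q => q.2 = g.1 * q.1 + g.2) (a := (x, y))
    have h4 : nPts A B g ≤
      (((A ×ˢ B).filter fun q => q.2 = g.1 * q.1 + g.2).erase (x, y)).card + 1 := by
      unfold nPts; omega
    have h5 : (nPts A B g : ℝ) ≤
      (((A ×ˢ B).filter fun q => q.2 = g.1 * q.1 + g.2).erase (x, y)).card + 1 := by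
      exact_mod_cast h4
    linarith
  have h2 : ∑ g ∈ P, (((A ×ˢ B).filter fun q => q.2 = g.1 * q.1 + g.2).erase (x, y)).card ≤
      (A ×ˢ B).card := by
    rw [← Finset.card_biUnion]
    · refine Finset.card_le_card fun q hq => ?_
      obtain ⟨g, _, hq⟩ := Finset.mem_biUnion.1 hq
      exact (Finset.mem_filter.1 (Finset.mem_of_mem_erase hq)).1
    · intro g hg g' hg' hne
      rw [Function.onFun, Finset.disjoint_left]
      intro q hq hq'
      refine hne (eq_of_two_points (q := (x, y)) (r := q) (Finset.mem_filter.1 hg).2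
        (Finset.mem_filter.1 hg').2 (Finset.mem_filter.1 (Finset.mem_of_mem_erase hq)).2
        (Finset.mem_filter.1 (Finset.mem_of_mem_erase hq')).2 (Finset.ne_of_mem_erase hq).symm)
  have h3 : (P.card : ℝ) * (κ / 2) ≤ A.card * B.card := by
    calc (P.card : ℝ) * (κ / 2) = ∑ _g ∈ P, κ / 2 := by rw [Finset.sum_const, nsmul_eq_mul]
      _ ≤ ∑ g ∈ P,
          ((((A ×ˢ B).filter fun q => q.2 = g.1 * q.1 + g.2).erase (x, y)).card : ℝ) :=
        Finset.sum_le_sum h1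
      _ ≤ A.card * B.card := by
        rw [Finset.card_product] at h2; exact_mod_cast h2
  linarith

end Incidence

section Rich

variable {F : Type*} [Field F]

theorem card_filter_lightForm_lines_le {A : Finset F} {G : Finset (F × F)} {k : ℕ}
    (hA : A.card ≤ k)
    (hG : ∀ x y : F, (G.filter fun g => y = g.1 * x + g.2).card ≤ k)
    (v : F × F × F) (c e d : F) (hce : c ≠ 0 ∨ e ≠ 0) :
    ((A ×ˢ G).filter fun w => lightForm v w = 0 ∧ c * w.2.1 + e * w.1 = d).card ≤ k := by
  by_cases hc : c = 0
  · have he : e ≠ 0 := by tauto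
    refine le_trans ?_ (hG v.1 (v.2.2 + v.2.1 * (d / e)))
    refine Finset.card_le_card_of_injOn Prod.snd ?_ ?_
    · intro w hw
      obtain ⟨h1, h2, h3⟩ := Finset.mem_filter.1 hw
      refine Finset.mem_coe.2 (Finset.mem_filter.2 ⟨(Finset.mem_product.1 h1).2, ?_⟩)
      have h4 : w.1 = d / e := by
        rw [eq_div_iff he]; rw [hc] at h3; linear_combination h3
      rw [← h4]
      unfold lightForm at h2
      linear_combination h2
    · intro w hw w' hw' h
      obtain ⟨_, _, h3⟩ := Finset.mem_filter.1 hw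
      obtain ⟨_, _, h3'⟩ := Finset.mem_filter.1 hw'
      refine Prod.ext (mul_left_cancel₀ he ?_) h
      rw [hc] at h3 h3'
      linear_combination h3 - h3'
  · refine le_trans ?_ hA
    refine Finset.card_le_card_of_injOn Prod.fst ?_ ?_
    · intro w hw
      exact (Finset.mem_product.1 (Finset.mem_filter.1 hw).1).1
    · intro w hw w' hw' h
      obtain ⟨_, h2, h3⟩ := Finset.mem_filter.1 hw
      obtain ⟨_, h2', h3'⟩ := Finset.mem_filter.1 hw'
      have e1 : w.2.1 = w'.2.1 := mul_left_cancel₀ hc (by rw [h] at h3; linear_combination h3 - h3')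
      unfold lightForm at h2 h2'
      refine Prod.ext h (Prod.ext e1 ?_)
      rw [h, e1] at h2
      linear_combination h2' - h2

theorem sum_nPts_eq_sum_fiber (A B : Finset F) (G : Finset (F × F)) :
    ∑ g ∈ G, nPts A B g =
      ∑ y ∈ B, ((A ×ˢ G).filter fun w => w.2.1 * w.1 + w.2.2 = y).card := by
  unfold nPts
  have h1 : ∀ g : F × F, ((A ×ˢ B).filter fun q => q.2 = g.1 * q.1 + g.2).card =
      ∑ y ∈ B, (A.filter fun x => g.1 * x + g.2 = y).card := by
    intro g
    rw [Finset.card_filter, Finset.sum_product_right]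
    refine Finset.sum_congr rfl fun y _ => ?_
    rw [Finset.card_filter]
    exact Finset.sum_congr rfl fun x _ => by simp only [eq_comm]
  simp only [h1]
  rw [Finset.sum_comm]
  refine Finset.sum_congr rfl fun y _ => ?_
  rw [Finset.card_filter, Finset.sum_product_right]
  simp only [Finset.card_filter]

theorem rich_numerics {N a s k κ : ℝ} (hN : 0 < N) (ha : 0 < a) (hκ : 2 ≤ κ) (hκa : κ ≤ a)
    (hs : s ^ 2 = N * a) (h : N * κ ^ 2 ≤ 2 ^ 16 * a ^ 2 * s + 16 * a ^ 2 * k)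
    (hk : k * κ ≤ 2 * a ^ 2) : N * κ ^ 4 ≤ 2 ^ 34 * a ^ 5 := by
  rcases le_total (16 * a ^ 2 * k) (2 ^ 16 * a ^ 2 * s) with h1 | h1
  · have h2 : N * κ ^ 2 ≤ 2 ^ 17 * a ^ 2 * s := by linarith
    have h3 : (N * κ ^ 2) ^ 2 ≤ (2 ^ 17 * a ^ 2 * s) ^ 2 :=
      pow_le_pow_left₀ (by positivity) h2 2
    have h4 : N * (N * κ ^ 4) ≤ N * (2 ^ 34 * a ^ 5) := by
      calc N * (N * κ ^ 4) = (N * κ ^ 2) ^ 2 := by ring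
        _ ≤ _ := h3
        _ = 2 ^ 34 * a ^ 4 * s ^ 2 := by ring
        _ = _ := by rw [hs]; ring
    exact le_of_mul_le_mul_left h4 hN
  · have h2 : N * κ ^ 2 ≤ 32 * a ^ 2 * k := by linarith
    calc N * κ ^ 4 = N * κ ^ 2 * κ * κ := by ring
      _ ≤ 32 * a ^ 2 * k * κ * κ := by gcongr
      _ = 32 * a ^ 2 * (k * κ) * κ := by ring
      _ ≤ 32 * a ^ 2 * (2 * a ^ 2) * a := by gcongr
      _ ≤ _ := by nlinarith [pow_pos ha 5]

/-- The number of affine maps preserving many points of `A`. -/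
theorem card_rich_maps_le [Fintype F] {p : ℕ} [CharP F p] (hF : Fintype.card F = p)
    (A : Finset F) (G : Finset (F × F)) {κ : ℝ} (hκ : 2 ≤ κ)
    (hG : ∀ g ∈ G, κ ≤ balancedPts A g) :
    (G.card : ℝ) * κ ^ 4 ≤ 2 ^ 34 * (A.card : ℝ) ^ 5 := by
  rcases G.eq_empty_or_nonempty with rfl | hne
  · simp only [Finset.card_empty, Nat.cast_zero, zero_mul]; positivity
  have hn : ∀ g ∈ G, κ ≤ nPts A A g := fun g hg => (hG g hg).trans (balancedPts_le A g)
  have hκa : κ ≤ A.card := by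
    obtain ⟨g, hg⟩ := hne
    exact (hn g hg).trans (by exact_mod_cast nPts_le_left A A g)
  have ha : (0 : ℝ) < A.card := by linarith
  have hN : (0 : ℝ) < G.card := by exact_mod_cast hne.card_pos
  have hp0 : (0 : ℝ) < p := by rw [← hF]; exact_mod_cast Fintype.card_pos
  have hsecond : (G.card : ℝ) * κ ^ 2 ≤ p * (A.card : ℝ) ^ 2 := by
    rw [← hF]
    refine le_trans ?_ (sum_balancedPts_sq_le A)
    calc (G.card : ℝ) * κ ^ 2 = ∑ _g ∈ G, κ ^ 2 := by rw [Finset.sum_const, nsmul_eq_mul]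
      _ ≤ ∑ g ∈ G, balancedPts A g ^ 2 :=
        Finset.sum_le_sum fun g hg => pow_le_pow_left₀ (by linarith) (hG g hg) 2
      _ ≤ _ := Finset.sum_le_sum_of_subset_of_nonneg (Finset.subset_univ _)
        fun _ _ _ => sq_nonneg _
  by_cases hp : 2 * ((A.card : ℝ) * G.card) ≤ (p : ℝ) ^ 2
  · set k : ℕ := ⌊2 * (A.card : ℝ) ^ 2 / κ⌋₊ with hk
    have hκ0 : 0 < κ := by linarith
    have hkκ : (k : ℝ) * κ ≤ 2 * (A.card : ℝ) ^ 2 := by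
      rw [← le_div_iff₀ hκ0]; exact Nat.floor_le (by positivity)
    have hAk : A.card ≤ k := by
      rw [hk]
      apply Nat.le_floor
      rw [le_div_iff₀ hκ0]
      nlinarith
    have hk1 : 1 ≤ k := le_trans (by exact_mod_cast ha) hAk
    have hpen : ∀ x y : F, (G.filter fun g => y = g.1 * x + g.2).card ≤ k := by
      intro x y
      rw [hk]
      apply Nat.le_floor
      rw [le_div_iff₀ hκ0]
      have := card_pencil_mul_le A A G hκ hn x y
      rwa [← sq] at this
    have hI := card_lightForm_eq_zero_le_real (p := p) (k := k) (n := A.card * G.card)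
      (A ×ˢ G) (A ×ˢ G) hk1
      (fun q _ c e d h => card_filter_lightForm_lines_le hAk hpen q c e d h)
      (fun q _ c e d h => by
        have := card_filter_lightForm_lines_le hAk hpen q c e d h
        simpa only [lightForm_swap q, neg_eq_zero] using this)
      (by rw [Finset.card_product]; push_cast; exact le_rfl)
      (by rw [Finset.card_product]; push_cast; exact le_rfl) hp
    have hcoin : ((((A ×ˢ G) ×ˢ (A ×ˢ G)).filter
        fun q => lightForm q.1 q.2 = 0).card : ℝ) =
        ∑ y, (((A ×ˢ G).filter fun w => w.2.1 * w.1 + w.2.2 = y).card : ℝ) ^ 2 := by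
      have := sum_card_fiber_mul (A ×ˢ G) (A ×ˢ G) (fun w : F × F × F => w.2.1 * w.1 + w.2.2)
        (fun w : F × F × F => w.2.1 * w.1 + w.2.2)
      simp only [← sq] at this
      have h2 : ((((A ×ˢ G) ×ˢ (A ×ˢ G)).filter fun q : (F × F × F) × (F × F × F) =>
          q.1.2.1 * q.1.1 + q.1.2.2 = q.2.2.1 * q.2.1 + q.2.2.2).card) =
          (((A ×ˢ G) ×ˢ (A ×ˢ G)).filter fun q => lightForm q.1 q.2 = 0).card := by
        refine Finset.card_bij (fun q _ => ((q.2.1, q.1.2), (q.1.1, q.2.2))) ?_ ?_ ?_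
        · intro q hq
          obtain ⟨h1, h2⟩ := Finset.mem_filter.1 hq
          simp only [Finset.mem_product] at h1
          refine Finset.mem_filter.2 ⟨?_, ?_⟩
          · simp only [Finset.mem_product]; tauto
          · unfold lightForm; linear_combination h2
        · rintro ⟨⟨x, g⟩, x', g'⟩ _ ⟨⟨y, h⟩, y', h'⟩ _ heq
          simp only [Prod.mk.injEq] at heq ⊢
          tauto
        · intro q hq
          obtain ⟨h1, h2⟩ := Finset.mem_filter.1 hq
          simp only [Finset.mem_product] at h1
          refine ⟨((q.2.1, q.1.2), (q.1.1, q.2.2)), Finset.mem_filter.2 ⟨?_, ?_⟩, rfl⟩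
          · simp only [Finset.mem_product]; tauto
          · unfold lightForm at h2; linear_combination h2
      rw [← h2, ← this]
      push_cast
      rfl
    have hsum : (G.card : ℝ) * κ ≤
        ∑ y ∈ A, (((A ×ˢ G).filter fun w => w.2.1 * w.1 + w.2.2 = y).card : ℝ) := by
      have h1 : (∑ g ∈ G, (nPts A A g : ℝ)) =
          ∑ y ∈ A, (((A ×ˢ G).filter fun w => w.2.1 * w.1 + w.2.2 = y).card : ℝ) := by
        exact_mod_cast sum_nPts_eq_sum_fiber A A G
      rw [← h1]
      calc (G.card : ℝ) * κ = ∑ _g ∈ G, κ := by rw [Finset.sum_const, nsmul_eq_mul]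
        _ ≤ _ := Finset.sum_le_sum hn
    have hCS : ((G.card : ℝ) * κ) ^ 2 ≤ A.card * ∑ y,
        (((A ×ˢ G).filter fun w => w.2.1 * w.1 + w.2.2 = y).card : ℝ) ^ 2 := by
      refine (pow_le_pow_left₀ (by positivity) hsum 2).trans ?_
      refine (sq_sum_le_card_mul_sum_sq).trans ?_
      gcongr
      exact Finset.subset_univ _
    rw [← hcoin] at hCS
    rw [Finset.card_product] at hI
    push_cast at hI
    refine rich_numerics (s := √(A.card * G.card)) (k := k) hN ha hκ hκa
      (by rw [Real.sq_sqrt (by positivity)]; ring) ?_ hkκ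
    refine le_of_mul_le_mul_left ?_ hN
    calc (G.card : ℝ) * (G.card * κ ^ 2) = (G.card * κ) ^ 2 := by ring
      _ ≤ _ := hCS
      _ ≤ _ := mul_le_mul_of_nonneg_left hI ha.le
      _ = _ := by ring
  · push Not at hp
    refine le_of_mul_le_mul_left ?_ hN
    calc (G.card : ℝ) * (G.card * κ ^ 4) = (G.card * κ ^ 2) * (G.card * κ ^ 2) := by ring
      _ ≤ (p * (A.card : ℝ) ^ 2) * (p * (A.card : ℝ) ^ 2) :=
        mul_le_mul hsecond hsecond (by positivity) (by positivity)
      _ = (p : ℝ) ^ 2 * (A.card : ℝ) ^ 4 := by ring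
      _ ≤ (2 * (A.card * G.card)) * (A.card : ℝ) ^ 4 := by gcongr
      _ ≤ _ := by
        have : 0 < (G.card : ℝ) * (A.card : ℝ) ^ 5 := by positivity
        nlinarith

end Rich

section Dyadic

/-- Dyadic summation of a distribution-function estimate. -/
theorem dyadic_sum_le {ι : Type*} (S : Finset ι) (f : ι → ℝ) (e : ℕ) {T a X Y : ℝ} (hT : 2 ≤ T)
    (ha : 1 ≤ a) (hX : 0 ≤ X) (hY : 0 ≤ Y) (hfT : ∀ i ∈ S, T ≤ f i) (hfa : ∀ i ∈ S, f i ≤ a)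
    (h : ∀ τ, T ≤ τ → ((S.filter fun i => τ ≤ f i).card : ℝ) * τ ^ e ≤ X + Y / τ) :
    ∑ i ∈ S, f i ^ e ≤ 2 ^ e * (2 * Real.log a * X + 2 * Y / T) := by
  have hT0 : 0 < T := by linarith
  have hla : 0 ≤ Real.log a := Real.log_nonneg ha
  rcases S.eq_empty_or_nonempty with rfl | ⟨i₀, hi₀⟩
  · simp only [Finset.sum_empty]; positivity
  have haT : 1 ≤ a / T := by
    rw [one_le_div hT0]; exact (hfT i₀ hi₀).trans (hfa i₀ hi₀)
  set j : ι → ℕ := fun i => Nat.log 2 ⌊f i / T⌋₊ with hj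
  set J := Nat.log 2 ⌊a / T⌋₊ + 1 with hJ
  have hfl : ∀ x : ℝ, 1 ≤ x → (2 : ℝ) ^ (Nat.log 2 ⌊x⌋₊) ≤ x := by
    intro x hx
    have h1 : (2 : ℕ) ^ (Nat.log 2 ⌊x⌋₊) ≤ ⌊x⌋₊ :=
      Nat.pow_log_le_self 2 (Nat.floor_pos.2 hx).ne'
    calc (2 : ℝ) ^ (Nat.log 2 ⌊x⌋₊) = ((2 ^ (Nat.log 2 ⌊x⌋₊) : ℕ) : ℝ) := by push_cast; rfl
      _ ≤ (⌊x⌋₊ : ℝ) := by exact_mod_cast h1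
      _ ≤ x := Nat.floor_le (by linarith)
  have hfu : ∀ x : ℝ, x ≤ 2 * 2 ^ (Nat.log 2 ⌊x⌋₊) := by
    intro x
    have h1 : ⌊x⌋₊ < 2 ^ (Nat.log 2 ⌊x⌋₊ + 1) := Nat.lt_pow_succ_log_self (by norm_num) _
    have h2 : (⌊x⌋₊ : ℝ) + 1 ≤ 2 ^ (Nat.log 2 ⌊x⌋₊ + 1) := by exact_mod_cast h1
    have h3 := Nat.lt_floor_add_one x
    rw [pow_succ'] at h2
    linarith
  have hJle : (J : ℝ) ≤ 2 * Real.log a := by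
    have h1 : (2 : ℝ) ^ J ≤ a := by
      rw [hJ, pow_succ]
      have h2 := hfl _ haT
      have h3 : a / T * 2 ≤ a := by
        rw [div_mul_eq_mul_div, div_le_iff₀ hT0]; nlinarith
      linarith
    have h2 := Real.log_le_log (by positivity) h1
    rw [Real.log_pow] at h2
    have h3 := Real.log_two_gt_d9
    have h4 : (0 : ℝ) ≤ J := Nat.cast_nonneg J
    nlinarith
  have hmaps : ∀ i ∈ S, j i ∈ Finset.range J := by
    intro i hi
    rw [Finset.mem_range, hJ, Nat.lt_succ_iff]
    exact Nat.log_mono_right (Nat.floor_le_floor (by gcongr; exact hfa i hi))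
  rw [← Finset.sum_fiberwise_of_maps_to hmaps]
  have hblock : ∀ n ∈ Finset.range J, ∑ i ∈ S.filter (fun i => j i = n), f i ^ e ≤
      2 ^ e * (X + Y / T * (1 / 2) ^ n) := by
    intro n _
    have hpos : (0 : ℝ) < T * 2 ^ n := by positivity
    have h1 : ∀ i ∈ S.filter (fun i => j i = n), f i ^ e ≤ (2 * (T * 2 ^ n)) ^ e := by
      intro i hi
      obtain ⟨hiS, hin⟩ := Finset.mem_filter.1 hi
      refine pow_le_pow_left₀ (hT0.le.trans (hfT i hiS)) ?_ e
      have := hfu (f i / T)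
      rw [show Nat.log 2 ⌊f i / T⌋₊ = n from hin, div_le_iff₀ hT0] at this
      linarith
    have h2 : S.filter (fun i => j i = n) ⊆ S.filter fun i => T * 2 ^ n ≤ f i := by
      intro i hi
      obtain ⟨hiS, hin⟩ := Finset.mem_filter.1 hi
      refine Finset.mem_filter.2 ⟨hiS, ?_⟩
      have := hfl (f i / T) (by rw [one_le_div hT0]; exact hfT i hiS)
      rw [show Nat.log 2 ⌊f i / T⌋₊ = n from hin, le_div_iff₀ hT0] at this
      linarith
    have h3 : T ≤ T * 2 ^ n := le_mul_of_one_le_right hT0.le (one_le_pow₀ (by norm_num))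
    calc _ ≤ ((S.filter (fun i => j i = n)).card : ℝ) * (2 * (T * 2 ^ n)) ^ e := by
          rw [← nsmul_eq_mul]; exact Finset.sum_le_card_nsmul _ _ _ h1
      _ ≤ ((S.filter fun i => T * 2 ^ n ≤ f i).card : ℝ) * (2 * (T * 2 ^ n)) ^ e := by
          gcongr
      _ = 2 ^ e * (((S.filter fun i => T * 2 ^ n ≤ f i).card : ℝ) * (T * 2 ^ n) ^ e) := by
          rw [mul_pow]; ring
      _ ≤ 2 ^ e * (X + Y / (T * 2 ^ n)) := by
          have := h _ h3
          gcongr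
      _ = _ := by rw [one_div, inv_pow]; field_simp
  refine (Finset.sum_le_sum hblock).trans ?_
  rw [← Finset.mul_sum, Finset.sum_add_distrib, Finset.sum_const, Finset.card_range, nsmul_eq_mul,
    ← Finset.mul_sum]
  have hgeo : ∑ n ∈ Finset.range J, (1 / 2 : ℝ) ^ n ≤ 2 := sum_geometric_two_le J
  have h4 : Y / T * ∑ n ∈ Finset.range J, (1 / 2 : ℝ) ^ n ≤ Y / T * 2 := by gcongr
  have h5 : (J : ℝ) * X ≤ 2 * Real.log a * X := by gcongr
  have h6 : Y / T * 2 = 2 * Y / T := by ring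
  gcongr
  linarith

end Dyadic

section Energy

variable {F : Type*} [Field F]

theorem sum_balancedPts_pow_four_le [Fintype F] {p : ℕ} [CharP F p] (hF : Fintype.card F = p)
    (A : Finset F) (hA : A.Nonempty) :
    ∑ g with 2 ≤ balancedPts A g, balancedPts A g ^ 4 ≤
      2 ^ 39 * (A.card : ℝ) ^ 5 * Real.log A.card := by
  have h := dyadic_sum_le (Finset.univ.filter fun g : F × F => 2 ≤ balancedPts A g)
    (balancedPts A) 4 (T := 2) (a := A.card) (X := 2 ^ 34 * (A.card : ℝ) ^ 5) (Y := 0) le_rfl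
    (by exact_mod_cast hA.card_pos) (by positivity) le_rfl
    (fun g hg => (Finset.mem_filter.1 hg).2)
    (fun g _ => (balancedPts_le A g).trans (by exact_mod_cast nPts_le_left A A g))
    (fun τ hτ => by
      rw [zero_div, add_zero]
      exact card_rich_maps_le hF A _ hτ fun g hg => (Finset.mem_filter.1 hg).2)
  linarith

/-- The affine map `l'⁻¹ ∘ l`. -/
noncomputable def affQuo (l l' : F × F) : F × F := (l.1 / l'.1, (l.2 - l'.2) / l'.1)

theorem affQuo_apply {l l' : F × F} (h : l'.1 ≠ 0) (x y : F) :
    y = (affQuo l l').1 * x + (affQuo l l').2 ↔ l.1 * x + l.2 = l'.1 * y + l'.2 := by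
  unfold affQuo
  constructor
  · rintro rfl
    field_simp
    ring
  · intro h1
    field_simp
    linear_combination -h1

noncomputable def quoRed (q : (F × F) × (F × F)) : F × F × F :=
  (1 / q.2.1, q.2.2 / q.2.1, q.1.2)

noncomputable def quoBlue (q : (F × F) × (F × F)) : F × F × F :=
  (q.2.1, q.1.2 * q.2.1, q.2.2)

theorem lightForm_quoRed_quoBlue {l₁ l₁' l₂ l₂' : F × F} (h₁ : l₁'.1 ≠ 0) (h₂ : l₂'.1 ≠ 0)
    (h : affQuo l₁ l₁' = affQuo l₂ l₂') : lightForm (quoRed (l₁, l₂')) (quoBlue (l₂, l₁')) = 0 := by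
  have e := (Prod.mk.inj h).2
  simp only [lightForm, quoRed, quoBlue]
  field_simp at e ⊢
  linear_combination e

/-- Pairs of lines with prescribed product of slopes. -/
noncomputable def slopePairs (L : Finset (F × F)) (t : F) : Finset ((F × F) × (F × F)) :=
  (L ×ˢ L).filter fun q => q.1.1 * q.2.1 = t

theorem card_slopePairs_le {L : Finset (F × F)} (h0 : ∀ l ∈ L, l.1 ≠ 0) {m : ℕ}
    (hm : ∀ s, (L.filter fun l => l.1 = s).card ≤ m) (t : F) :
    (slopePairs L t).card ≤ L.card * m := by
  rw [Finset.card_eq_sum_card_fiberwise (s := slopePairs L t) (f := Prod.fst) (t := L) (fun q hq =>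
    (Finset.mem_product.1 (Finset.mem_filter.1 hq).1).1), ← smul_eq_mul]
  refine Finset.sum_le_card_nsmul _ _ _ fun l hl => le_trans ?_ (hm (t / l.1))
  refine Finset.card_le_card_of_injOn Prod.snd ?_ ?_
  · intro q hq
    obtain ⟨h1, rfl⟩ := Finset.mem_filter.1 hq
    obtain ⟨h2, h3⟩ := Finset.mem_filter.1 h1
    refine Finset.mem_coe.2 (Finset.mem_filter.2 ⟨(Finset.mem_product.1 h2).2, ?_⟩)
    rw [eq_div_iff (h0 _ hl), mul_comm, h3]
  · intro q hq r hr h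
    exact Prod.ext ((Finset.mem_filter.1 hq).2.trans (Finset.mem_filter.1 hr).2.symm) h

theorem card_filter_quoBlue_le {L : Finset (F × F)} (h0 : ∀ l ∈ L, l.1 ≠ 0) {k : ℕ}
    (hm : ∀ s, (L.filter fun l => l.1 = s).card ≤ k)
    (hM : ∀ x y, (L.filter fun l => y = l.1 * x + l.2).card ≤ k) (t : F) (v : F × F × F)
    (c e d : F) (hce : c ≠ 0 ∨ e ≠ 0) :
    (((slopePairs L t).image quoBlue).filter
      fun w => lightForm v w = 0 ∧ c * w.2.1 + e * w.1 = d).card ≤ k := by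
  rw [Finset.filter_image]
  refine Finset.card_image_le.trans ?_
  set P := (slopePairs L t).filter fun q => lightForm v (quoBlue q) = 0 ∧
    c * (quoBlue q).2.1 + e * (quoBlue q).1 = d with hP
  have hPmem : ∀ q ∈ P, q.1 ∈ L ∧ q.2 ∈ L ∧ q.1.1 * q.2.1 = t ∧ q.1.1 ≠ 0 ∧ q.2.1 ≠ 0 ∧
      lightForm v (quoBlue q) = 0 ∧ (c * q.1.2 + e) * t = d * q.1.1 := by
    intro q hq
    obtain ⟨h1, h2, h3⟩ := Finset.mem_filter.1 hq
    obtain ⟨h4, h5⟩ := Finset.mem_filter.1 h1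
    obtain ⟨h6, h7⟩ := Finset.mem_product.1 h4
    refine ⟨h6, h7, h5, h0 _ h6, h0 _ h7, h2, ?_⟩
    rw [← h5, ← h3]
    simp only [quoBlue]
    ring
  have hinj : Set.InjOn Prod.fst (P : Set ((F × F) × (F × F))) := by
    intro q hq r hr h
    obtain ⟨-, -, h1, h2, -, h3, -⟩ := hPmem q hq
    obtain ⟨-, -, h1', -, -, h3', -⟩ := hPmem r hr
    rw [← h] at h1'
    have h4 : q.2.1 = r.2.1 := mul_left_cancel₀ h2 (h1.trans h1'.symm)
    simp only [lightForm, quoBlue, ← h, ← h4] at h3 h3'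
    exact Prod.ext h (Prod.ext h4 (by linear_combination h3' - h3))
  by_cases hc : c = 0
  · have he : e ≠ 0 := by tauto
    refine le_trans (Finset.card_le_card_of_injOn Prod.fst ?_ hinj) (hm (e * t / d))
    intro q hq
    obtain ⟨h1, -, h2, h3, h4, -, h5⟩ := hPmem q hq
    refine Finset.mem_coe.2 (Finset.mem_filter.2 ⟨h1, ?_⟩)
    rw [hc, zero_mul, zero_add] at h5
    have hd : d ≠ 0 := by
      rintro rfl
      rw [zero_mul, ← h2] at h5
      exact mul_ne_zero he (mul_ne_zero h3 h4) h5
    rw [eq_div_iff hd, h5, mul_comm]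
  · refine le_trans (Finset.card_le_card_of_injOn Prod.fst ?_ hinj) (hM (-(d / (c * t))) (-(e / c)))
    intro q hq
    obtain ⟨h1, -, h2, h3, h4, -, h5⟩ := hPmem q hq
    refine Finset.mem_coe.2 (Finset.mem_filter.2 ⟨h1, ?_⟩)
    have ht : t ≠ 0 := by rw [← h2]; exact mul_ne_zero h3 h4
    field_simp
    linear_combination -h5

theorem card_filter_quoRed_le {L : Finset (F × F)} (h0 : ∀ l ∈ L, l.1 ≠ 0) {k : ℕ}
    (hm : ∀ s, (L.filter fun l => l.1 = s).card ≤ k)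
    (hM : ∀ x y, (L.filter fun l => y = l.1 * x + l.2).card ≤ k) (t : F) (v : F × F × F)
    (c e d : F) (hce : c ≠ 0 ∨ e ≠ 0) :
    (((slopePairs L t).image quoRed).filter
      fun w => lightForm w v = 0 ∧ c * w.2.1 + e * w.1 = d).card ≤ k := by
  rw [Finset.filter_image]
  refine Finset.card_image_le.trans ?_
  set P := (slopePairs L t).filter fun q => lightForm (quoRed q) v = 0 ∧
    c * (quoRed q).2.1 + e * (quoRed q).1 = d with hP
  have hPmem : ∀ q ∈ P, q.2 ∈ L ∧ q.1.1 * q.2.1 = t ∧ q.2.1 ≠ 0 ∧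
      lightForm (quoRed q) v = 0 ∧ c * q.2.2 + e = d * q.2.1 := by
    intro q hq
    obtain ⟨h1, h2, h3⟩ := Finset.mem_filter.1 hq
    obtain ⟨h4, h5⟩ := Finset.mem_filter.1 h1
    obtain ⟨h6, h7⟩ := Finset.mem_product.1 h4
    have h8 := h0 _ h7
    refine ⟨h7, h5, h8, h2, ?_⟩
    rw [← h3]
    simp only [quoRed]
    field_simp
  have hinj : Set.InjOn Prod.snd (P : Set ((F × F) × (F × F))) := by
    intro q hq r hr h
    obtain ⟨-, h1, h2, h3, -⟩ := hPmem q hq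
    obtain ⟨-, h1', -, h3', -⟩ := hPmem r hr
    rw [← h] at h1'
    have h4 : q.1.1 = r.1.1 := mul_right_cancel₀ h2 (h1.trans h1'.symm)
    simp only [lightForm, quoRed, ← h] at h3 h3'
    exact Prod.ext (Prod.ext h4 (by linear_combination h3 - h3')) h
  by_cases hc : c = 0
  · have he : e ≠ 0 := by tauto
    refine le_trans (Finset.card_le_card_of_injOn Prod.snd ?_ hinj) (hm (e / d))
    intro q hq
    obtain ⟨h1, -, -, -, h5⟩ := hPmem q hq
    refine Finset.mem_coe.2 (Finset.mem_filter.2 ⟨h1, ?_⟩)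
    rw [hc, zero_mul, zero_add] at h5
    have hd : d ≠ 0 := by
      rintro rfl
      rw [zero_mul] at h5
      exact he h5
    rw [eq_div_iff hd, h5, mul_comm]
  · refine le_trans (Finset.card_le_card_of_injOn Prod.snd ?_ hinj) (hM (-(d / c)) (-(e / c)))
    intro q hq
    obtain ⟨h1, -, -, -, h5⟩ := hPmem q hq
    refine Finset.mem_coe.2 (Finset.mem_filter.2 ⟨h1, ?_⟩)
    field_simp
    linear_combination -h5

/-- The number of quadruples of lines in `L` with a common affine quotient. -/
noncomputable def quoEnergy (L : Finset (F × F)) : ℕ :=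
  (((L ×ˢ L) ×ˢ (L ×ˢ L)).filter
    fun q => affQuo q.1.1 q.1.2 = affQuo q.2.1 q.2.2).card

theorem quoEnergy_le [Fintype F] {p : ℕ} [CharP F p] {L : Finset (F × F)}
    (h0 : ∀ l ∈ L, l.1 ≠ 0) {m M : ℕ}
    (hm : ∀ s, (L.filter fun l => l.1 = s).card ≤ m) (hmL : m ≤ L.card)
    (hM : ∀ x y, (L.filter fun l => y = l.1 * x + l.2).card ≤ M)
    (hp : 2 * ((L.card : ℝ) * m) ≤ (p : ℝ) ^ 2) :
    (quoEnergy L : ℝ) ≤ (2 ^ 17 * √(L.card * m) + 16 * M) * (L.card : ℝ) ^ 2 := by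
  rcases L.eq_empty_or_nonempty with rfl | ⟨l₀, hl₀⟩
  · simp [quoEnergy]
  have hm1 : 1 ≤ m := by
    refine le_trans (Finset.card_pos.2 ⟨l₀, ?_⟩) (hm l₀.1)
    exact Finset.mem_filter.2 ⟨hl₀, rfl⟩
  have hfib : ∀ t : F, (((((L ×ˢ L) ×ˢ (L ×ˢ L)).filter
      fun q => affQuo q.1.1 q.1.2 = affQuo q.2.1 q.2.2).filter
      fun q => q.1.1.1 * q.2.2.1 = t).card : ℝ) ≤
      (2 ^ 16 * √(L.card * m) + 16 * (m + M)) * (slopePairs L t).card := by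
    intro t
    have hc : ((slopePairs L t).card : ℝ) ≤ L.card * m := by
      exact_mod_cast card_slopePairs_le h0 hm t
    have hI := card_lightForm_eq_zero_le_real (p := p) (k := m + M) (n := L.card * m)
      ((slopePairs L t).image quoRed) ((slopePairs L t).image quoBlue) (by omega)
      (fun q _ c e d h => card_filter_quoBlue_le h0 (fun s => (hm s).trans (by omega))
        (fun x y => (hM x y).trans (by omega)) t q c e d h)
      (fun q _ c e d h => card_filter_quoRed_le h0 (fun s => (hm s).trans (by omega))
        (fun x y => (hM x y).trans (by omega)) t q c e d h)
      (le_trans (by exact_mod_cast Finset.card_image_le) hc)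
      (le_trans (by exact_mod_cast Finset.card_image_le) hc) hp
    have h1 : (((slopePairs L t).image quoRed).card : ℝ) ≤ (slopePairs L t).card := by
      exact_mod_cast Finset.card_image_le
    have h2 : (((slopePairs L t).image quoBlue).card : ℝ) ≤ (slopePairs L t).card := by
      exact_mod_cast Finset.card_image_le
    have h3 : (((((L ×ˢ L) ×ˢ (L ×ˢ L)).filter
      fun q => affQuo q.1.1 q.1.2 = affQuo q.2.1 q.2.2).filter
      fun q => q.1.1.1 * q.2.2.1 = t).card) ≤ ((((slopePairs L t).image quoRed) ×ˢ
        ((slopePairs L t).image quoBlue)).filter fun q => lightForm q.1 q.2 = 0).card := by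
      refine Finset.card_le_card_of_injOn
        (fun q => (quoRed (q.1.1, q.2.2), quoBlue (q.2.1, q.1.2))) ?_ ?_
      · intro q hq
        obtain ⟨h1, h2⟩ := Finset.mem_filter.1 hq
        obtain ⟨h3, h4⟩ := Finset.mem_filter.1 h1
        simp only [Finset.mem_product] at h3
        have e1 := h0 _ h3.1.2
        have e2 := h0 _ h3.2.2
        refine Finset.mem_coe.2 (Finset.mem_filter.2 ⟨Finset.mem_product.2
          ⟨Finset.mem_image_of_mem _ (Finset.mem_filter.2 ⟨?_, h2⟩),
          Finset.mem_image_of_mem _ (Finset.mem_filter.2 ⟨?_, ?_⟩)⟩,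
          lightForm_quoRed_quoBlue e1 e2 h4⟩)
        · exact Finset.mem_product.2 ⟨h3.1.1, h3.2.2⟩
        · exact Finset.mem_product.2 ⟨h3.2.1, h3.1.2⟩
        · rw [← h2]
          have := (Prod.mk.inj h4).1
          field_simp at this
          simp only
          linear_combination -this
      · rintro ⟨⟨l₁, l₁'⟩, l₂, l₂'⟩ hq ⟨⟨r₁, r₁'⟩, r₂, r₂'⟩ hr heq
        obtain ⟨hq1, hqt⟩ := Finset.mem_filter.1 hq
        obtain ⟨hq3, hq4⟩ := Finset.mem_filter.1 hq1
        obtain ⟨hr1, hrt⟩ := Finset.mem_filter.1 hr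
        obtain ⟨hr3, hr4⟩ := Finset.mem_filter.1 hr1
        simp only [Finset.mem_product] at hq3 hr3
        have a1 := h0 _ hq3.1.2
        have a2 := h0 _ hq3.2.2
        have b1 := h0 _ hr3.1.2
        have b2 := h0 _ hr3.2.2
        simp only [quoRed, quoBlue, Prod.mk.injEq] at heq
        obtain ⟨⟨c1, c2, c3⟩, c4, c5, c6⟩ := heq
        simp only at hqt hrt a1 a2 b1 b2
        have d1 : l₂'.1 = r₂'.1 := by
          rw [one_div, one_div] at c1; exact inv_injective c1
        rw [← d1] at hrt c2
        have d2 : l₁.1 = r₁.1 := mul_right_cancel₀ a2 (hqt.trans hrt.symm)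
        have d3 : l₂'.2 = r₂'.2 := (div_left_inj' a2).1 c2
        rw [← c4] at c5
        have d4 : l₂.2 = r₂.2 := mul_right_cancel₀ a1 c5
        have e1 := (Prod.mk.inj hq4).1
        have e2 := (Prod.mk.inj hr4).1
        simp only at e1 e2
        rw [← d1, ← c4, ← d2] at e2
        have d5 : l₂.1 = r₂.1 := (div_left_inj' a2).1 (e1.symm.trans e2)
        rw [Prod.ext d2 c3, Prod.ext c4 c6, Prod.ext d5 d4, Prod.ext d1 d3]
    have hs := Real.sqrt_nonneg ((L.card : ℝ) * m)
    calc _ ≤ _ := (Nat.cast_le (α := ℝ)).2 h3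
      _ ≤ _ := hI
      _ ≤ (2 ^ 15 * √(L.card * m) + 8 * (m + M : ℕ)) * (slopePairs L t).card +
        (2 ^ 15 * √(L.card * m) + 8 * (m + M : ℕ)) * (slopePairs L t).card := by gcongr
      _ = _ := by push_cast; ring
  have hsum : (quoEnergy L : ℝ) = ∑ t : F, (((((L ×ˢ L) ×ˢ (L ×ˢ L)).filter
      fun q => affQuo q.1.1 q.1.2 = affQuo q.2.1 q.2.2).filter
      fun q => q.1.1.1 * q.2.2.1 = t).card : ℝ) := by
    rw [quoEnergy, ← sum_card_fiber _ fun q : ((F × F) × F × F) × (F × F) × F × F =>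
      q.1.1.1 * q.2.2.1]
    push_cast
    rfl
  have hpairs : ∑ t : F, ((slopePairs L t).card : ℝ) = (L.card : ℝ) ^ 2 := by
    have := sum_card_fiber (L ×ˢ L) fun q : (F × F) × (F × F) => q.1.1 * q.2.1
    rw [Finset.card_product] at this
    rw [sq]
    exact_mod_cast this
  have hms : (m : ℝ) ≤ √(L.card * m) := by
    apply Real.le_sqrt_of_sq_le
    have : (m : ℝ) ≤ L.card := by exact_mod_cast hmL
    rw [sq]
    gcongr
  calc (quoEnergy L : ℝ) ≤ ∑ t : F, (2 ^ 16 * √(L.card * m) + 16 * (m + M)) *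
        ((slopePairs L t).card : ℝ) := by
        rw [hsum]; exact Finset.sum_le_sum fun t _ => hfib t
    _ = (2 ^ 16 * √(L.card * m) + 16 * (m + M)) * (L.card : ℝ) ^ 2 := by
        rw [← Finset.mul_sum, hpairs]
    _ ≤ _ := mul_le_mul_of_nonneg_right (by linarith) (sq_nonneg _)

end Energy

section Parallel

variable {F : Type*} [Field F] [Fintype F]

theorem card_parallel_mul_sq_le (A B : Finset F) {L : Finset (F × F)} {τ : ℝ} (hτ : 0 ≤ τ)
    (h0 : ∀ l ∈ L, l.1 ≠ 0) (hL : ∀ l ∈ L, τ ≤ nPts A B l) (s : F) :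
    ((L.filter fun l => l.1 = s).card : ℝ) * τ ^ 2 ≤ √(addE F A A * addE F B B) := by
  rcases (L.filter fun l => l.1 = s).eq_empty_or_nonempty with he | ⟨l₀, hl₀⟩
  · rw [he, Finset.card_empty, Nat.cast_zero, zero_mul]; exact Real.sqrt_nonneg _
  have hs : s ≠ 0 := by
    obtain ⟨h1, rfl⟩ := Finset.mem_filter.1 hl₀
    exact h0 _ h1
  have hc : (L.filter fun l => l.1 = s).card =
      ((L.filter fun l => l.1 = s).image Prod.snd).card := by
    rw [Finset.card_image_of_injOn]
    intro l hl l' hl' h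
    exact Prod.ext ((Finset.mem_filter.1 hl).2.trans (Finset.mem_filter.1 hl').2.symm) h
  have h1 := card_mul_sq_le_coincidence (A ×ˢ B) (fun q => q.2 - s * q.1)
    ((L.filter fun l => l.1 = s).image Prod.snd) hτ (by
      intro β hβ
      obtain ⟨l, hl, rfl⟩ := Finset.mem_image.1 hβ
      obtain ⟨hl', hls⟩ := Finset.mem_filter.1 hl
      refine (hL l hl').trans (le_of_eq ?_)
      unfold nPts
      congr 2
      refine Finset.filter_congr fun q _ => ?_
      rw [hls, sub_eq_iff_eq_add, add_comm])
  have h2 : (((A ×ˢ B) ×ˢ (A ×ˢ B)).filter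
      fun q => q.1.2 - s * q.1.1 = q.2.2 - s * q.2.1).card ≤
      (((A ×ˢ A) ×ˢ (B ×ˢ B)).filter fun q => s * (q.1.1 - q.1.2) = q.2.1 - q.2.2).card := by
    refine Finset.card_le_card_of_injOn (fun q => ((q.1.1, q.2.1), (q.1.2, q.2.2))) ?_ ?_
    · intro q hq
      obtain ⟨h1, h2⟩ := Finset.mem_filter.1 hq
      simp only [Finset.mem_product] at h1
      refine Finset.mem_coe.2 (Finset.mem_filter.2 ⟨?_, ?_⟩)
      · simp only [Finset.mem_product]; tauto
      · simp only; linear_combination -h2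
    · rintro ⟨⟨x, y⟩, x', y'⟩ _ ⟨⟨z, w⟩, z', w'⟩ _ h
      simp only [Prod.mk.injEq] at h ⊢
      tauto
  have h3 := sq_card_coincidence_le (A ×ˢ A) (B ×ˢ B) (fun q : F × F => s * (q.1 - q.2))
    (fun q : F × F => q.1 - q.2)
  have h4 : (((A ×ˢ A) ×ˢ (A ×ˢ A)).filter
      fun q : (F × F) × F × F => s * (q.1.1 - q.1.2) = s * (q.2.1 - q.2.2)).card =
        addE F A A := by
    unfold addE
    congr 1
    refine Finset.filter_congr fun q _ => ?_
    rw [mul_right_inj' hs]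
    constructor <;> intro h <;> linear_combination h
  have h5 : (((B ×ˢ B) ×ˢ (B ×ˢ B)).filter
      fun q : (F × F) × F × F => q.1.1 - q.1.2 = q.2.1 - q.2.2).card = addE F B B := by
    unfold addE
    congr 1
    refine Finset.filter_congr fun q _ => ?_
    constructor <;> intro h <;> linear_combination h
  rw [h4, h5] at h3
  rw [hc]
  refine h1.trans ((Nat.cast_le.2 h2).trans ?_)
  exact Real.le_sqrt_of_sq_le (by exact_mod_cast h3)

theorem coincidence_le_mulEbar (A : Finset F) (x₀ : F) :
    ((((A ×ˢ A).filter fun q : F × F => q.1 ≠ x₀ ∧ q.2 ≠ x₀) ×ˢ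
      ((A ×ˢ A).filter fun q : F × F => q.1 ≠ x₀ ∧ q.2 ≠ x₀)).filter
        fun q : (F × F) × F × F => (q.1.1 - x₀) / (q.1.2 - x₀) =
          (q.2.1 - x₀) / (q.2.2 - x₀)).card ≤ mulEbar F A := by
  refine le_trans ?_ (le_ciSup (f := fun s : F => mulE F (A.image fun a => a - s)
    (A.image fun a => a - s)) (Set.finite_range _).bddAbove x₀)
  unfold mulE
  refine Finset.card_le_card_of_injOn
    (fun q => ((q.1.1 - x₀, q.1.2 - x₀), (q.2.1 - x₀, q.2.2 - x₀))) ?_ ?_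
  · intro q hq
    obtain ⟨h1, h2⟩ := Finset.mem_filter.1 hq
    obtain ⟨h3, h4⟩ := Finset.mem_product.1 h1
    obtain ⟨h5, -, h6⟩ := Finset.mem_filter.1 h3
    obtain ⟨h7, -, h8⟩ := Finset.mem_filter.1 h4
    obtain ⟨a1, a2⟩ := Finset.mem_product.1 h5
    obtain ⟨a3, a4⟩ := Finset.mem_product.1 h7
    refine Finset.mem_coe.2 (Finset.mem_filter.2 ⟨Finset.mem_product.2
      ⟨Finset.mem_product.2 ⟨Finset.mem_image_of_mem _ a1, Finset.mem_image_of_mem _ a2⟩,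
        Finset.mem_product.2 ⟨Finset.mem_image_of_mem _ a3, Finset.mem_image_of_mem _ a4⟩⟩, ?_⟩)
    rw [div_eq_div_iff (sub_ne_zero.2 h6) (sub_ne_zero.2 h8)] at h2
    simp only
    linear_combination h2
  · rintro ⟨⟨x, y⟩, x', y'⟩ _ ⟨⟨z, w⟩, z', w'⟩ _ h
    simpa only [Prod.mk.injEq, sub_left_inj] using h

theorem card_pencil_mul_sq_le (A B : Finset F) {L : Finset (F × F)} {τ : ℝ} (hτ : 2 ≤ τ)
    (h0 : ∀ l ∈ L, l.1 ≠ 0) (hL : ∀ l ∈ L, τ ≤ nPts A B l) (x₀ y₀ : F) :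
    ((L.filter fun l => y₀ = l.1 * x₀ + l.2).card : ℝ) * τ ^ 2 ≤
      4 * √(mulEbar F A * mulEbar F B) := by
  set P := (A ×ˢ B).filter fun q => q.1 ≠ x₀ ∧ q.2 ≠ y₀ with hP
  set I := (L.filter fun l => y₀ = l.1 * x₀ + l.2).image Prod.fst with hI
  have hc : (L.filter fun l => y₀ = l.1 * x₀ + l.2).card = I.card := by
    rw [hI, Finset.card_image_of_injOn]
    intro l hl l' hl' h
    have e1 := (Finset.mem_filter.1 hl).2
    have e2 := (Finset.mem_filter.1 hl').2
    refine Prod.ext h ?_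
    rw [h] at e1
    linear_combination e2 - e1
  have h1 := card_mul_sq_le_coincidence P (fun q => (q.2 - y₀) / (q.1 - x₀)) I
    (τ := τ / 2) (by linarith) (by
      intro α hα
      obtain ⟨l, hl, rfl⟩ := Finset.mem_image.1 hα
      obtain ⟨hl, hl0⟩ := Finset.mem_filter.1 hl
      have hl1 := hL l hl
      have hsub : ((A ×ˢ B).filter fun q => q.2 = l.1 * q.1 + l.2).erase (x₀, y₀) ⊆
          P.filter fun q => (q.2 - y₀) / (q.1 - x₀) = l.1 := by
        intro q hq
        obtain ⟨hq1, hq2⟩ := Finset.mem_erase.1 hq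
        obtain ⟨hq3, hq4⟩ := Finset.mem_filter.1 hq2
        have e : q.2 - y₀ = l.1 * (q.1 - x₀) := by linear_combination hq4 - hl0
        have hx : q.1 ≠ x₀ := by
          intro h
          rw [h, sub_self, mul_zero, sub_eq_zero] at e
          exact hq1 (Prod.ext h e)
        have hx' := sub_ne_zero.2 hx
        have hy : q.2 ≠ y₀ := by
          rw [← sub_ne_zero, e]
          exact mul_ne_zero (h0 l hl) hx'
        exact Finset.mem_filter.2 ⟨Finset.mem_filter.2 ⟨hq3, hx, hy⟩, by
          rw [e, mul_div_cancel_right₀ _ hx']⟩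
      have h2 := Finset.card_le_card hsub
      have h3 := Finset.pred_card_le_card_erase
        (s := (A ×ˢ B).filter fun q => q.2 = l.1 * q.1 + l.2) (a := (x₀, y₀))
      have h4 : nPts A B l ≤
          (P.filter fun q => (q.2 - y₀) / (q.1 - x₀) = l.1).card + 1 := by
        unfold nPts; omega
      have h5 : (nPts A B l : ℝ) ≤
          (P.filter fun q => (q.2 - y₀) / (q.1 - x₀) = l.1).card + 1 := by exact_mod_cast h4
      linarith)
  have h2 : ((P ×ˢ P).filter
      fun q => (q.1.2 - y₀) / (q.1.1 - x₀) = (q.2.2 - y₀) / (q.2.1 - x₀)).card ≤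
      ((((A ×ˢ A).filter fun q : F × F => q.1 ≠ x₀ ∧ q.2 ≠ x₀) ×ˢ
        ((B ×ˢ B).filter fun q : F × F => q.1 ≠ y₀ ∧ q.2 ≠ y₀)).filter
        fun q => (q.1.1 - x₀) / (q.1.2 - x₀) = (q.2.1 - y₀) / (q.2.2 - y₀)).card := by
    refine Finset.card_le_card_of_injOn (fun q => ((q.1.1, q.2.1), (q.1.2, q.2.2))) ?_ ?_
    · intro q hq
      obtain ⟨h1, h2⟩ := Finset.mem_filter.1 hq
      obtain ⟨h3, h4⟩ := Finset.mem_product.1 h1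
      obtain ⟨h5, h6, h7⟩ := Finset.mem_filter.1 h3
      obtain ⟨h8, h9, h10⟩ := Finset.mem_filter.1 h4
      obtain ⟨a1, a2⟩ := Finset.mem_product.1 h5
      obtain ⟨a3, a4⟩ := Finset.mem_product.1 h8
      refine Finset.mem_coe.2 (Finset.mem_filter.2 ⟨Finset.mem_product.2
        ⟨Finset.mem_filter.2 ⟨Finset.mem_product.2 ⟨a1, a3⟩, h6, h9⟩,
          Finset.mem_filter.2 ⟨Finset.mem_product.2 ⟨a2, a4⟩, h7, h10⟩⟩, ?_⟩)
      rw [div_eq_div_iff (sub_ne_zero.2 h6) (sub_ne_zero.2 h9)] at h2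
      simp only
      rw [div_eq_div_iff (sub_ne_zero.2 h9) (sub_ne_zero.2 h10)]
      linear_combination -h2
    · rintro ⟨⟨x, y⟩, x', y'⟩ _ ⟨⟨z, w⟩, z', w'⟩ _ h
      simp only [Prod.mk.injEq] at h ⊢
      tauto
  have h3 := sq_card_coincidence_le ((A ×ˢ A).filter fun q : F × F => q.1 ≠ x₀ ∧ q.2 ≠ x₀)
    ((B ×ˢ B).filter fun q : F × F => q.1 ≠ y₀ ∧ q.2 ≠ y₀)
    (fun q => (q.1 - x₀) / (q.2 - x₀)) (fun q => (q.1 - y₀) / (q.2 - y₀))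
  have h4 := h3.trans (Nat.mul_le_mul (coincidence_le_mulEbar A x₀) (coincidence_le_mulEbar B y₀))
  have h5 : (I.card : ℝ) * (τ / 2) ^ 2 ≤ √(mulEbar F A * mulEbar F B) :=
    h1.trans ((Nat.cast_le.2 h2).trans (Real.le_sqrt_of_sq_le (by exact_mod_cast h4)))
  rw [hc]
  linarith

end Parallel

section Dichotomy

variable {F : Type*} [Field F] [Fintype F]

theorem sum_fiber_sq_le_sum_nPts (A : Finset F) {L : Finset (F × F)} (h0 : ∀ l ∈ L, l.1 ≠ 0) :
    ∑ y, ((A ×ˢ L).filter fun w => w.2.1 * w.1 + w.2.2 = y).card ^ 2 ≤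
      ∑ q ∈ L ×ˢ L, nPts A A (affQuo q.1 q.2) := by
  simp only [sq]
  rw [sum_card_fiber_mul, Finset.card_eq_sum_card_fiberwise
    (f := fun q : (F × F × F) × F × F × F => (q.1.2, q.2.2)) (t := L ×ˢ L) (fun q hq => by
      have h1 := (Finset.mem_filter.1 hq).1
      simp only [Finset.mem_product] at h1
      exact Finset.mem_product.2 ⟨h1.1.2, h1.2.2⟩)]
  refine Finset.sum_le_sum fun ⟨l, l'⟩ hl => ?_
  unfold nPts
  refine Finset.card_le_card_of_injOn (fun q => (q.1.1, q.2.1)) ?_ ?_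
  · intro q hq
    obtain ⟨h1, h2⟩ := Finset.mem_filter.1 hq
    obtain ⟨h3, h4⟩ := Finset.mem_filter.1 h1
    simp only [Finset.mem_product] at h3
    obtain ⟨e1, e2⟩ := Prod.mk.inj h2
    refine Finset.mem_coe.2 (Finset.mem_filter.2 ⟨Finset.mem_product.2 ⟨h3.1.1, h3.2.1⟩, ?_⟩)
    rw [affQuo_apply (h0 l' (Finset.mem_product.1 hl).2), ← e1, ← e2, h4]
  · rintro ⟨⟨x, g⟩, x', g'⟩ hq ⟨⟨y, k⟩, y', k'⟩ hr h
    have h2 := (Finset.mem_filter.1 hq).2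
    have h3 := (Finset.mem_filter.1 hr).2
    simp only [Prod.mk.injEq] at h h2 h3 ⊢
    refine ⟨⟨h.1, h2.1.trans h3.1.symm⟩, h.2, h2.2.trans h3.2.symm⟩

theorem sq_card_mul_le_sum_balancedPts (A B : Finset F) {L : Finset (F × F)} {τ : ℝ}
    (h0 : ∀ l ∈ L, l.1 ≠ 0) (hL : ∀ l ∈ L, τ ≤ nPts A B l) (hτ0 : 0 ≤ τ)
    (hτ : 2 * (A.card * B.card : ℝ) ≤ τ * Fintype.card F) :
    (L.card : ℝ) ^ 2 * τ ^ 2 ≤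
      4 * B.card * ∑ q ∈ L ×ˢ L, balancedPts A (affQuo q.1 q.2) := by
  set q : ℝ := (Fintype.card F : ℝ) with hq
  have hq0 : 0 < q := by rw [hq]; exact_mod_cast Fintype.card_pos
  set s : F → ℝ := fun y => (((A ×ˢ L).filter fun w => w.2.1 * w.1 + w.2.2 = y).card : ℝ) with hs
  have h1 : (∑ l ∈ L, (nPts A B l : ℝ)) = ∑ y ∈ B, s y := by
    simp only [hs]
    exact_mod_cast sum_nPts_eq_sum_fiber A B L
  have h2 : ∑ y, s y = A.card * L.card := by
    have := sum_card_fiber (A ×ˢ L) fun w : F × F × F => w.2.1 * w.1 + w.2.2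
    rw [Finset.card_product] at this
    simp only [hs]
    exact_mod_cast this
  have h3 : ∑ y, s y ^ 2 ≤ ∑ q ∈ L ×ˢ L, (nPts A A (affQuo q.1 q.2) : ℝ) := by
    simp only [hs]
    exact_mod_cast sum_fiber_sq_le_sum_nPts A h0
  have h4 : (L.card : ℝ) * τ / 2 ≤ ∑ y ∈ B, (s y - A.card * L.card / q) := by
    rw [Finset.sum_sub_distrib, ← h1, Finset.sum_const, nsmul_eq_mul]
    have h5 : (L.card : ℝ) * τ ≤ ∑ l ∈ L, (nPts A B l : ℝ) := by
      calc (L.card : ℝ) * τ = ∑ _l ∈ L, τ := by rw [Finset.sum_const, nsmul_eq_mul]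
        _ ≤ _ := Finset.sum_le_sum hL
    have h6 : (B.card : ℝ) * (A.card * L.card / q) ≤ L.card * τ / 2 := by
      rw [mul_div_assoc', div_le_iff₀ hq0]
      have : (0 : ℝ) ≤ L.card := Nat.cast_nonneg _
      nlinarith
    linarith
  have h5 : ((L.card : ℝ) * τ / 2) ^ 2 ≤ B.card * ∑ y, (s y - A.card * L.card / q) ^ 2 := by
    refine (pow_le_pow_left₀ (by positivity) h4 2).trans (sq_sum_le_card_mul_sum_sq.trans ?_)
    gcongr
    exact Finset.subset_univ _
  have h6 : ∑ y, (s y - A.card * L.card / q) ^ 2 ≤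
      ∑ q ∈ L ×ˢ L, balancedPts A (affQuo q.1 q.2) := by
    have e1 : ∀ y, (s y - A.card * L.card / q) ^ 2 =
        s y ^ 2 - 2 * (A.card * L.card / q) * s y + (A.card * L.card / q) ^ 2 := by
      intro y; ring
    simp only [e1]
    unfold balancedPts
    rw [Finset.sum_add_distrib, Finset.sum_sub_distrib, ← Finset.mul_sum, h2, Finset.sum_const,
      Finset.card_univ, nsmul_eq_mul, ← hq, Finset.sum_sub_distrib, Finset.sum_const,
      Finset.card_product, nsmul_eq_mul]
    push_cast
    have e2 : q * (A.card * L.card / q) ^ 2 = L.card * L.card * ((A.card : ℝ) ^ 2 / q) := by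
      field_simp
    have e3 : 2 * (A.card * L.card / q) * (A.card * L.card) =
        2 * (L.card * L.card * ((A.card : ℝ) ^ 2 / q)) := by
      field_simp
    rw [e2, e3]
    linarith
  have h7 : ((L.card : ℝ) * τ / 2) ^ 2 ≤
      B.card * ∑ q ∈ L ×ˢ L, balancedPts A (affQuo q.1 q.2) :=
    h5.trans (mul_le_mul_of_nonneg_left h6 (Nat.cast_nonneg _))
  linarith

theorem sum_large_balancedPts_pow_four_le (A : Finset F) (L : Finset (F × F)) :
    (∑ q ∈ (L ×ˢ L).filter (fun q => 2 ≤ balancedPts A (affQuo q.1 q.2)),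
      balancedPts A (affQuo q.1 q.2)) ^ 4 ≤
      (L.card : ℝ) ^ 4 * (quoEnergy L * ∑ g with 2 ≤ balancedPts A g, balancedPts A g ^ 4) := by
  set S := (L ×ˢ L).filter (fun q => 2 ≤ balancedPts A (affQuo q.1 q.2)) with hS
  set H := Finset.univ.filter fun g => 2 ≤ balancedPts A g with hH
  have hSc : (S.card : ℝ) ≤ (L.card : ℝ) ^ 2 := by
    rw [sq, ← Nat.cast_mul, ← Finset.card_product]
    exact_mod_cast Finset.card_le_card (Finset.filter_subset _ _)
  have h1 : (∑ q ∈ S, balancedPts A (affQuo q.1 q.2)) ^ 2 ≤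
      (L.card : ℝ) ^ 2 * ∑ q ∈ S, balancedPts A (affQuo q.1 q.2) ^ 2 := by
    refine sq_sum_le_card_mul_sum_sq.trans ?_
    exact mul_le_mul_of_nonneg_right hSc (Finset.sum_nonneg fun _ _ => sq_nonneg _)
  have h2 : ∑ q ∈ S, balancedPts A (affQuo q.1 q.2) ^ 2 =
      ∑ g ∈ H, ((S.filter fun q => affQuo q.1 q.2 = g).card : ℝ) * balancedPts A g ^ 2 := by
    rw [← Finset.sum_fiberwise_of_maps_to (s := S) (t := H) (g := fun q => affQuo q.1 q.2)
      (fun q hq => Finset.mem_filter.2 ⟨Finset.mem_univ _, (Finset.mem_filter.1 hq).2⟩)]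
    refine Finset.sum_congr rfl fun g _ => ?_
    rw [← nsmul_eq_mul]
    refine Finset.sum_eq_card_nsmul fun q hq => ?_
    rw [(Finset.mem_filter.1 hq).2]
  have h3 : ∑ g ∈ H, ((S.filter fun q => affQuo q.1 q.2 = g).card : ℝ) ^ 2 ≤ quoEnergy L := by
    have e1 := sum_card_fiber_mul S S (fun q : (F × F) × F × F => affQuo q.1 q.2)
      (fun q : (F × F) × F × F => affQuo q.1 q.2)
    have e2 : ((S ×ˢ S).filter fun q => affQuo q.1.1 q.1.2 = affQuo q.2.1 q.2.2).card ≤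
        quoEnergy L := by
      unfold quoEnergy
      exact Finset.card_le_card (Finset.filter_subset_filter _
        (Finset.product_subset_product (Finset.filter_subset _ _) (Finset.filter_subset _ _)))
    replace e2 := (le_of_eq e1).trans ((le_of_eq (by congr!)).trans e2)
    simp only [← sq] at e2
    refine (Finset.sum_le_sum_of_subset_of_nonneg (Finset.subset_univ _)
      fun _ _ _ => sq_nonneg _).trans ?_
    replace e2 := (Nat.cast_le (α := ℝ)).2 e2
    rw [Nat.cast_sum] at e2
    simp only [Nat.cast_pow] at e2
    convert e2
    rfl
  have h4 : (∑ q ∈ S, balancedPts A (affQuo q.1 q.2) ^ 2) ^ 2 ≤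
      quoEnergy L * ∑ g ∈ H, balancedPts A g ^ 4 := by
    rw [h2]
    refine (Finset.sum_mul_sq_le_sq_mul_sq _ _ _).trans ?_
    have : ∀ g, (balancedPts A g ^ 2) ^ 2 = balancedPts A g ^ 4 := fun g => by ring
    simp only [this]
    exact mul_le_mul_of_nonneg_right h3 (Finset.sum_nonneg fun g _ => by positivity)
  calc (∑ q ∈ S, balancedPts A (affQuo q.1 q.2)) ^ 4 =
        ((∑ q ∈ S, balancedPts A (affQuo q.1 q.2)) ^ 2) ^ 2 := by ring
    _ ≤ ((L.card : ℝ) ^ 2 * ∑ q ∈ S, balancedPts A (affQuo q.1 q.2) ^ 2) ^ 2 :=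
      pow_le_pow_left₀ (sq_nonneg _) h1 2
    _ = (L.card : ℝ) ^ 4 * (∑ q ∈ S, balancedPts A (affQuo q.1 q.2) ^ 2) ^ 2 := by ring
    _ ≤ _ := by gcongr

theorem dichotomy_numerics {N τ a b Λ m M W V X E : ℝ} (hN : 0 < N) (hτ : 0 < τ) (ha : 0 ≤ a)
    (hΛ : 0 ≤ Λ) (hm : 0 ≤ m)
    (h1 : N ^ 2 * τ ^ 2 ≤ 8 * b * X) (h2 : X ^ 4 ≤ N ^ 4 * (E * (2 ^ 39 * a ^ 5 * Λ)))
    (h3 : E ≤ (2 ^ 17 * √(N * m) + 16 * M) * N ^ 2) (h4 : m * τ ^ 2 ≤ W) (h5 : M * τ ^ 2 ≤ 4 * V) :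
    N ^ 3 * τ ^ 18 ≤ 2 ^ 138 * b ^ 8 * a ^ 10 * Λ ^ 2 * W ∨
      N ^ 2 * τ ^ 10 ≤ 2 ^ 58 * b ^ 4 * a ^ 5 * Λ * V := by
  have c0 : ∀ n : ℕ, 0 ≤ (2 : ℝ) ^ n * b ^ 4 * a ^ 5 * Λ := fun n => by positivity
  have c1 : ∀ n : ℕ, 0 ≤ (2 : ℝ) ^ n * b ^ 8 * a ^ 10 * Λ ^ 2 * N := fun n => by positivity
  have h6 : N ^ 2 * τ ^ 8 ≤ 2 ^ 51 * b ^ 4 * a ^ 5 * Λ * (2 ^ 17 * √(N * m) + 16 * M) := by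
    refine le_of_mul_le_mul_left ?_ (pow_pos hN 6)
    calc N ^ 6 * (N ^ 2 * τ ^ 8) = (N ^ 2 * τ ^ 2) ^ 4 := by ring
      _ ≤ (8 * b * X) ^ 4 := pow_le_pow_left₀ (by positivity) h1 4
      _ = 2 ^ 12 * b ^ 4 * X ^ 4 := by ring
      _ ≤ 2 ^ 12 * b ^ 4 * (N ^ 4 * (((2 ^ 17 * √(N * m) + 16 * M) * N ^ 2) *
          (2 ^ 39 * a ^ 5 * Λ))) := by
        refine mul_le_mul_of_nonneg_left (h2.trans ?_) (by positivity)
        gcongr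
      _ = _ := by ring
  rcases le_total (16 * M) (2 ^ 17 * √(N * m)) with h | h
  · left
    have h7 : N ^ 2 * τ ^ 8 ≤ 2 ^ 69 * b ^ 4 * a ^ 5 * Λ * √(N * m) := by
      calc _ ≤ _ := h6
        _ ≤ 2 ^ 51 * b ^ 4 * a ^ 5 * Λ * (2 ^ 17 * √(N * m) + 2 ^ 17 * √(N * m)) :=
          mul_le_mul_of_nonneg_left (by linarith) (c0 51)
        _ = _ := by ring
    refine le_of_mul_le_mul_left ?_ hN
    calc N * (N ^ 3 * τ ^ 18) = (N ^ 2 * τ ^ 8) ^ 2 * τ ^ 2 := by ring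
      _ ≤ (2 ^ 69 * b ^ 4 * a ^ 5 * Λ * √(N * m)) ^ 2 * τ ^ 2 := by gcongr
      _ = 2 ^ 138 * b ^ 8 * a ^ 10 * Λ ^ 2 * (√(N * m)) ^ 2 * τ ^ 2 := by ring
      _ = 2 ^ 138 * b ^ 8 * a ^ 10 * Λ ^ 2 * N * (m * τ ^ 2) := by
        rw [Real.sq_sqrt (by positivity)]; ring
      _ ≤ 2 ^ 138 * b ^ 8 * a ^ 10 * Λ ^ 2 * N * W :=
        mul_le_mul_of_nonneg_left h4 (c1 138)
      _ = _ := by ring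
  · right
    calc N ^ 2 * τ ^ 10 = N ^ 2 * τ ^ 8 * τ ^ 2 := by ring
      _ ≤ 2 ^ 51 * b ^ 4 * a ^ 5 * Λ * (16 * M + 16 * M) * τ ^ 2 := by
        refine mul_le_mul_of_nonneg_right (h6.trans ?_) (sq_nonneg _)
        exact mul_le_mul_of_nonneg_left (by linarith) (c0 51)
      _ = 2 ^ 56 * b ^ 4 * a ^ 5 * Λ * (M * τ ^ 2) := by ring
      _ ≤ 2 ^ 56 * b ^ 4 * a ^ 5 * Λ * (4 * V) :=
        mul_le_mul_of_nonneg_left h5 (c0 56)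
      _ = _ := by ring

/-- The number of rich lines is controlled either by additive or by multiplicative energies. -/
theorem card_rich_lines_dichotomy {p : ℕ} [CharP F p] (hF : Fintype.card F = p) (A B : Finset F)
    {L : Finset (F × F)} {τ : ℝ} (hne : L.Nonempty) (h0 : ∀ l ∈ L, l.1 ≠ 0)
    (hL : ∀ l ∈ L, τ ≤ nPts A B l) (hτ2 : 2 ≤ τ)
    (hτ : 2 * (A.card * B.card : ℝ) ≤ τ * p) (hτb : 16 * (B.card : ℝ) ≤ τ ^ 2)
    (hp : 2 * (L.card * √(addE F A A * addE F B B)) ≤ (p : ℝ) ^ 2 * τ ^ 2) :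
    (L.card : ℝ) ^ 3 * τ ^ 18 ≤ 2 ^ 138 * (B.card : ℝ) ^ 8 * (A.card : ℝ) ^ 10 *
        Real.log A.card ^ 2 * √(addE F A A * addE F B B) ∨
      (L.card : ℝ) ^ 2 * τ ^ 10 ≤ 2 ^ 58 * (B.card : ℝ) ^ 4 * (A.card : ℝ) ^ 5 *
        Real.log A.card * √(mulEbar F A * mulEbar F B) := by
  have hτ0 : 0 < τ := by linarith
  have hN : (0 : ℝ) < L.card := by exact_mod_cast hne.card_pos
  obtain ⟨l₀, hl₀⟩ := hne
  have hA : A.Nonempty := by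
    rw [← Finset.card_pos]
    have h1 := hL l₀ hl₀
    have h2 : (nPts A B l₀ : ℝ) ≤ A.card := by exact_mod_cast nPts_le_left A B l₀
    have : (0 : ℝ) < A.card := by linarith
    exact_mod_cast this
  obtain ⟨s₀, hs₀⟩ := Finite.exists_max fun s : F => (L.filter fun l => l.1 = s).card
  obtain ⟨⟨x₀, y₀⟩, hxy₀⟩ := Finite.exists_max
    fun q : F × F => (L.filter fun l => q.2 = l.1 * q.1 + l.2).card
  set m := (L.filter fun l => l.1 = s₀).card with hm
  set M := (L.filter fun l => y₀ = l.1 * x₀ + l.2).card with hM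
  have hmW : (m : ℝ) * τ ^ 2 ≤ √(addE F A A * addE F B B) :=
    card_parallel_mul_sq_le A B hτ0.le h0 hL s₀
  have hMV : (M : ℝ) * τ ^ 2 ≤ 4 * √(mulEbar F A * mulEbar F B) :=
    card_pencil_mul_sq_le A B hτ2 h0 hL x₀ y₀
  have hE := quoEnergy_le (p := p) h0 hs₀ (Finset.card_le_card (Finset.filter_subset _ _))
    (fun x y => hxy₀ (x, y)) (by
      have h1 : 2 * ((L.card : ℝ) * m) * τ ^ 2 ≤ (p : ℝ) ^ 2 * τ ^ 2 := by
        calc 2 * ((L.card : ℝ) * m) * τ ^ 2 = 2 * (L.card * (m * τ ^ 2)) := by ring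
          _ ≤ 2 * (L.card * √(addE F A A * addE F B B)) := by gcongr
          _ ≤ _ := hp
      exact le_of_mul_le_mul_right h1 (by positivity))
  have h1 := sq_card_mul_le_sum_balancedPts A B h0 hL hτ0.le (by rw [hF]; exact hτ)
  have h2 : 4 * (B.card : ℝ) * ∑ q ∈ L ×ˢ L, balancedPts A (affQuo q.1 q.2) ≤
      (L.card : ℝ) ^ 2 * τ ^ 2 / 2 + 4 * B.card *
        ∑ q ∈ (L ×ˢ L).filter (fun q => 2 ≤ balancedPts A (affQuo q.1 q.2)),
          balancedPts A (affQuo q.1 q.2) := by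
    rcases Nat.eq_zero_or_pos B.card with hb | hb
    · rw [hb, Nat.cast_zero, mul_zero, zero_mul, zero_mul, add_zero]; positivity
    have hb' : (0 : ℝ) < B.card := by exact_mod_cast hb
    have h3 : ∑ q ∈ L ×ˢ L, balancedPts A (affQuo q.1 q.2) ≤
        ∑ q ∈ L ×ˢ L, (τ ^ 2 / (8 * B.card) +
          if 2 ≤ balancedPts A (affQuo q.1 q.2) then balancedPts A (affQuo q.1 q.2) else 0) := by
      refine Finset.sum_le_sum fun q _ => ?_
      split_ifs with h
      · have : 0 ≤ τ ^ 2 / (8 * B.card) := by positivity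
        linarith
      · have : 2 ≤ τ ^ 2 / (8 * B.card) := by
          rw [le_div_iff₀ (by positivity)]; linarith
        linarith
    rw [Finset.sum_add_distrib, Finset.sum_const, Finset.card_product, nsmul_eq_mul,
      ← Finset.sum_filter] at h3
    have h4 := mul_le_mul_of_nonneg_left h3 (by positivity : 0 ≤ 4 * (B.card : ℝ))
    refine h4.trans (le_of_eq ?_)
    push_cast
    field_simp
    ring
  refine dichotomy_numerics hN hτ0 (Nat.cast_nonneg _) (Real.log_natCast_nonneg _)
    (Nat.cast_nonneg m) (by linarith)
    ((sum_large_balancedPts_pow_four_le A L).trans ?_) hE hmW hMV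
  have := sum_balancedPts_pow_four_le hF A hA
  gcongr

end Dichotomy

section Tuples

variable {F : Type*} [Field F]

theorem collinear_prod_iff {s : Set (F × F)} :
    Collinear F s ↔ (∃ x, ∀ q ∈ s, q.1 = x) ∨ (∃ y, ∀ q ∈ s, q.2 = y) ∨
      ∃ l : F × F, l.1 ≠ 0 ∧ ∀ q ∈ s, q.2 = l.1 * q.1 + l.2 := by
  rw [collinear_iff_exists_forall_eq_smul_vadd]
  constructor
  · rintro ⟨⟨x, y⟩, ⟨v, w⟩, h⟩
    simp only [Prod.smul_mk, vadd_eq_add, Prod.mk_add_mk, smul_eq_mul] at h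
    by_cases hv : v = 0
    · refine Or.inl ⟨x, fun q hq => ?_⟩
      obtain ⟨r, hr⟩ := h q hq
      rw [hr, hv]; simp
    by_cases hw : w = 0
    · refine Or.inr (Or.inl ⟨y, fun q hq => ?_⟩)
      obtain ⟨r, hr⟩ := h q hq
      rw [hr, hw]; simp
    refine Or.inr (Or.inr ⟨(w / v, y - w / v * x), div_ne_zero hw hv, fun q hq => ?_⟩)
    obtain ⟨r, hr⟩ := h q hq
    rw [hr]
    field_simp
    ring
  · rintro (⟨x, h⟩ | ⟨y, h⟩ | ⟨l, -, h⟩)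
    · exact ⟨(x, 0), (0, 1), fun q hq => ⟨q.2, by ext <;> simp [h q hq]⟩⟩
    · exact ⟨(0, y), (1, 0), fun q hq => ⟨q.1, by ext <;> simp [h q hq]⟩⟩
    · exact ⟨(0, l.2), (1, l.1), fun q hq => ⟨q.1, by ext <;> simp [h q hq, mul_comm]⟩⟩

/-- The lines that are neither vertical nor horizontal and meet `A × B` at least twice. -/
noncomputable def slantLines [Fintype F] (A B : Finset F) : Finset (F × F) :=
  Finset.univ.filter fun l => l.1 ≠ 0 ∧ 2 ≤ nPts A B l

theorem card_biUnion_piFinset_le {ι α : Type*} [DecidableEq α] (k : ℕ) (S : Finset ι)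
    (P : ι → Finset α) :
    (S.biUnion fun i => Fintype.piFinset fun _ : Fin k => P i).card ≤ ∑ i ∈ S, (P i).card ^ k := by
  refine Finset.card_biUnion_le.trans (le_of_eq (Finset.sum_congr rfl fun i _ => ?_))
  rw [Fintype.card_piFinset, Finset.prod_const, Finset.card_univ, Fintype.card_fin]

theorem Ctuples_le [Fintype F] (k : ℕ) (A B : Finset F) :
    Ctuples F (k + 1) A B ≤ A.card * B.card ^ (k + 1) + B.card * A.card ^ (k + 1) +
      ∑ l ∈ slantLines A B, nPts A B l ^ (k + 1) := by
  have h : ((Fintype.piFinset fun _ : Fin (k + 1) => A ×ˢ B).filter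
      fun f => Collinear F (Set.range f)) ⊆
      ((A.biUnion fun x => Fintype.piFinset fun _ : Fin (k + 1) => {x} ×ˢ B) ∪
        B.biUnion fun y => Fintype.piFinset fun _ : Fin (k + 1) => A ×ˢ {y}) ∪
      (slantLines A B).biUnion fun l => Fintype.piFinset fun _ : Fin (k + 1) =>
        (A ×ˢ B).filter fun q => q.2 = l.1 * q.1 + l.2 := by
    intro f hf
    obtain ⟨hf, hc⟩ := Finset.mem_filter.1 hf
    rw [Fintype.mem_piFinset] at hf
    have hf' := fun i => Finset.mem_product.1 (hf i)
    simp only [Finset.mem_union, Finset.mem_biUnion, Fintype.mem_piFinset, Finset.mem_product,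
      Finset.mem_singleton, Finset.mem_filter]
    rw [collinear_prod_iff] at hc
    simp only [Set.forall_mem_range] at hc
    rcases hc with ⟨x, h⟩ | ⟨y, h⟩ | ⟨l, hl, h⟩
    · exact Or.inl (Or.inl ⟨x, h 0 ▸ (hf' 0).1, fun i => ⟨h i, (hf' i).2⟩⟩)
    · exact Or.inl (Or.inr ⟨y, h 0 ▸ (hf' 0).2, fun i => ⟨(hf' i).1, h i⟩⟩)
    · by_cases h2 : 2 ≤ nPts A B l
      · exact Or.inr ⟨l, Finset.mem_filter.2 ⟨Finset.mem_univ _, hl, h2⟩,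
          fun i => ⟨hf' i, h i⟩⟩
      · have h1 : nPts A B l ≤ 1 := by omega
        unfold nPts at h1
        rw [Finset.card_le_one] at h1
        have h3 : ∀ i, f i = f 0 := fun i =>
          h1 _ (Finset.mem_filter.2 ⟨hf i, h i⟩) _ (Finset.mem_filter.2 ⟨hf 0, h 0⟩)
        exact Or.inl (Or.inl ⟨(f 0).1, (hf' 0).1, fun i => ⟨by rw [h3 i], (hf' i).2⟩⟩)
  have h1 := card_biUnion_piFinset_le (k + 1) A fun x => ({x} : Finset F) ×ˢ B
  have h2 := card_biUnion_piFinset_le (k + 1) B fun y => A ×ˢ ({y} : Finset F)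
  have h3 := card_biUnion_piFinset_le (k + 1) (slantLines A B)
    fun l => (A ×ˢ B).filter fun q => q.2 = l.1 * q.1 + l.2
  simp only [Finset.card_product, Finset.card_singleton, one_mul, mul_one, Finset.sum_const,
    smul_eq_mul] at h1 h2
  unfold Ctuples
  exact (Finset.card_le_card h).trans ((Finset.card_union_le _ _).trans (add_le_add
    ((Finset.card_union_le _ _).trans (add_le_add h1 h2)) h3))

theorem sum_pow_sub_le_Ctuples [Fintype F] (k : ℕ) (A B : Finset F) :
    ∑ l ∈ slantLines A B, (nPts A B l ^ (k + 1) - nPts A B l) ≤ Ctuples F (k + 1) A B := by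
  set P : F × F → Finset (F × F) := fun l => (A ×ˢ B).filter fun q => q.2 = l.1 * q.1 + l.2
    with hP
  set Q : F × F → Finset (Fin (k + 1) → F × F) := fun l =>
    (Fintype.piFinset fun _ : Fin (k + 1) => P l) \ (P l).image fun q _ => q with hQ
  have h1 : ∀ l, nPts A B l ^ (k + 1) - nPts A B l ≤ (Q l).card := by
    intro l
    refine le_trans ?_ (Finset.le_card_sdiff _ _)
    rw [Fintype.card_piFinset, Finset.prod_const, Finset.card_univ, Fintype.card_fin]
    exact Nat.sub_le_sub_left Finset.card_image_le _
  have hmem : ∀ l, ∀ f ∈ Q l, (∀ i, f i ∈ A ×ˢ B ∧ (f i).2 = l.1 * (f i).1 + l.2) ∧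
      ∃ i, f i ≠ f 0 := by
    intro l f hf
    obtain ⟨hf1, hf2⟩ := Finset.mem_sdiff.1 hf
    rw [Fintype.mem_piFinset] at hf1
    refine ⟨fun i => Finset.mem_filter.1 (hf1 i), ?_⟩
    by_contra! hcon
    exact hf2 (Finset.mem_image.2 ⟨f 0, hf1 0, funext fun i => (hcon i).symm⟩)
  have hdisj : (slantLines A B : Set (F × F)).PairwiseDisjoint Q := by
    intro l _ l' _ hll
    refine Finset.disjoint_left.2 fun f hf hf' => hll ?_
    obtain ⟨h2, i, hi⟩ := hmem l f hf
    have h3 := (hmem l' f hf').1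
    exact eq_of_two_points (h2 i).2 (h3 i).2 (h2 0).2 (h3 0).2 hi
  calc ∑ l ∈ slantLines A B, (nPts A B l ^ (k + 1) - nPts A B l)
      ≤ ∑ l ∈ slantLines A B, (Q l).card := Finset.sum_le_sum fun l _ => h1 l
    _ = ((slantLines A B).biUnion Q).card := (Finset.card_biUnion hdisj).symm
    _ ≤ _ := by
      refine Finset.card_le_card fun f hf => ?_
      obtain ⟨l, hl, hf⟩ := Finset.mem_biUnion.1 hf
      have h2 := (hmem l f hf).1
      refine Finset.mem_filter.2 ⟨Fintype.mem_piFinset.2 fun i => (h2 i).1, ?_⟩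
      rw [collinear_prod_iff]
      refine Or.inr (Or.inr ⟨l, (Finset.mem_filter.1 hl).2.1, ?_⟩)
      rw [Set.forall_mem_range]
      exact fun i => (h2 i).2

theorem card_mul_pow_le_Ctuples (k : ℕ) (A B : Finset F) :
    A.card * B.card ^ (k + 1) ≤ Ctuples F (k + 1) A B := by
  have hdisj : (A : Set F).PairwiseDisjoint
      fun x => Fintype.piFinset fun _ : Fin (k + 1) => ({x} : Finset F) ×ˢ B := by
    intro x _ x' _ hx
    refine Finset.disjoint_left.2 fun f hf hf' => hx ?_
    have h1 := Finset.mem_product.1 (Fintype.mem_piFinset.1 hf 0)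
    have h2 := Finset.mem_product.1 (Fintype.mem_piFinset.1 hf' 0)
    rw [← Finset.mem_singleton.1 h1.1, ← Finset.mem_singleton.1 h2.1]
  have h1 := Finset.card_biUnion hdisj
  simp only [Fintype.card_piFinset, Finset.prod_const, Finset.card_univ, Fintype.card_fin,
    Finset.card_product, Finset.card_singleton, one_mul, Finset.sum_const, smul_eq_mul] at h1
  rw [← h1]
  refine Finset.card_le_card fun f hf => ?_
  obtain ⟨x, hx, hf⟩ := Finset.mem_biUnion.1 hf
  have h2 := fun i => Finset.mem_product.1 (Fintype.mem_piFinset.1 hf i)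
  refine Finset.mem_filter.2 ⟨Fintype.mem_piFinset.2 fun i => Finset.mem_product.2
    ⟨(Finset.mem_singleton.1 (h2 i).1) ▸ hx, (h2 i).2⟩, ?_⟩
  rw [collinear_prod_iff]
  refine Or.inl ⟨x, ?_⟩
  rw [Set.forall_mem_range]
  exact fun i => Finset.mem_singleton.1 (h2 i).1

theorem Ctuples_le_pow (k : ℕ) (A B : Finset F) : Ctuples F k A B ≤ (A.card * B.card) ^ k := by
  refine (Finset.card_filter_le _ _).trans (le_of_eq ?_)
  rw [Fintype.card_piFinset, Finset.prod_const, Finset.card_univ, Fintype.card_fin,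
    Finset.card_product]

theorem sq_card_le_addE (A : Finset F) : A.card ^ 2 ≤ addE F A A := by
  rw [sq, ← Finset.card_product]
  refine Finset.card_le_card_of_injOn (fun q => ((q.1, q.2), (q.1, q.2))) ?_ ?_
  · intro q hq
    have hq' := Finset.mem_product.1 hq
    refine Finset.mem_coe.2 (Finset.mem_filter.2 ⟨?_, ?_⟩)
    · simp only [Finset.mem_product]; tauto
    · simp
  · rintro ⟨x, y⟩ _ ⟨x', y'⟩ _ h
    simp only [Prod.mk.injEq] at h ⊢
    tauto

theorem sum_nPts_pow_four_le [Fintype F] (A B : Finset F) :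
    ∑ l ∈ slantLines A B, (nPts A B l : ℝ) ^ 4 ≤ 2 * Ctuples F 4 A B := by
  have h : ∑ l ∈ slantLines A B, nPts A B l ^ 4 ≤ 2 * Ctuples F 4 A B := by
    refine le_trans ?_ (Nat.mul_le_mul_left 2 (sum_pow_sub_le_Ctuples 3 A B))
    rw [Finset.mul_sum]
    refine Finset.sum_le_sum fun l hl => ?_
    have h2 := (Finset.mem_filter.1 hl).2.2
    have h3 : 2 * nPts A B l ≤ nPts A B l ^ 4 := by
      calc 2 * nPts A B l ≤ 2 ^ 3 * nPts A B l := by omega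
        _ ≤ nPts A B l ^ 3 * nPts A B l := by gcongr
        _ = _ := by ring
    simp only [Nat.reduceAdd]
    omega
  exact_mod_cast h

theorem sum_slantLines_nPts_sq_le [Fintype F] (A B : Finset F) :
    ∑ l ∈ slantLines A B, (nPts A B l : ℝ) ^ 2 ≤ 2 * (A.card * B.card : ℝ) ^ 2 := by
  have h : ∑ l ∈ slantLines A B, nPts A B l ^ 2 ≤ 2 * (A.card * B.card) ^ 2 := by
    refine le_trans ?_ (Nat.mul_le_mul_left 2
      ((sum_pow_sub_le_Ctuples 1 A B).trans (Ctuples_le_pow 2 A B)))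
    rw [Finset.mul_sum]
    refine Finset.sum_le_sum fun l hl => ?_
    have h2 := (Finset.mem_filter.1 hl).2.2
    have h3 : 2 * nPts A B l ≤ nPts A B l ^ 2 := by
      rw [sq]; gcongr
    simp only [Nat.reduceAdd]
    omega
  exact_mod_cast h

end Tuples

section Numerics

theorem two_mul_mul_le_of_energy {a b D Λ W K P : ℝ} (ha : 0 < a) (hb : 0 < b) (hD : 0 ≤ D)
    (hΛ : 1 / 2 ≤ Λ) (hK : 0 ≤ K) (hP : 0 ≤ P) (hK6 : K ^ 6 = W * a ^ 10 * b ^ 8 * Λ ^ 2)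
    (hW : a * b ≤ W) (h1 : D ^ 4 * Λ ≤ P * a ^ 5 * b ^ 4) (h2 : a ^ 5 * b ^ 6 ≤ P ^ 9) :
    a * b * D ≤ 2 * K * P := by
  have hΛ0 : 0 < Λ := by linarith
  refine (pow_le_pow_iff_left₀ (by positivity) (by positivity) (by norm_num : (12 : ℕ) ≠ 0)).1 ?_
  refine le_of_mul_le_mul_right ?_ (pow_pos hΛ0 3)
  have h3 : 1 ≤ 2 ^ 12 * Λ ^ 7 := by
    calc (1 : ℝ) ≤ 2 ^ 12 * (1 / 2) ^ 7 := by norm_num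
      _ ≤ _ := by gcongr
  have h4 : a * b * a ^ 10 * b ^ 8 * Λ ^ 2 ≤ K ^ 6 := by rw [hK6]; gcongr
  calc (a * b * D) ^ 12 * Λ ^ 3 = a ^ 12 * b ^ 12 * (D ^ 4 * Λ) ^ 3 := by ring
    _ ≤ a ^ 12 * b ^ 12 * (P * a ^ 5 * b ^ 4) ^ 3 := by gcongr
    _ = a ^ 22 * b ^ 18 * P ^ 3 * (a ^ 5 * b ^ 6) * 1 := by ring
    _ ≤ a ^ 22 * b ^ 18 * P ^ 3 * P ^ 9 * (2 ^ 12 * Λ ^ 7) := by gcongr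
    _ = 2 ^ 12 * (a * b * a ^ 10 * b ^ 8 * Λ ^ 2) ^ 2 * P ^ 12 * Λ ^ 3 := by ring
    _ ≤ 2 ^ 12 * (K ^ 6) ^ 2 * P ^ 12 * Λ ^ 3 := by gcongr
    _ = _ := by ring

theorem mul_energy_le_of_threshold {a b D Λ W K P N τ : ℝ} (ha : 0 < a) (hb : 0 < b) (hD : 0 < D)
    (hΛ : 1 / 2 ≤ Λ) (hK : 0 ≤ K) (hK6 : K ^ 6 = W * a ^ 10 * b ^ 8 * Λ ^ 2)
    (hW : 0 ≤ W) (h1 : D ^ 4 * Λ ≤ P * a ^ 5 * b ^ 4) (hτ : 0 < τ) (hKτ : 4 * K ≤ τ * D)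
    (hN : N * τ ^ 4 ≤ 2 * D ^ 2) : 2 * (N * W) ≤ P ^ 2 * τ ^ 2 := by
  have hΛ0 : 0 < Λ := by linarith
  have h2 : D ^ 8 * Λ ^ 2 ≤ P ^ 2 * a ^ 10 * b ^ 8 := by
    calc D ^ 8 * Λ ^ 2 = (D ^ 4 * Λ) ^ 2 := by ring
      _ ≤ (P * a ^ 5 * b ^ 4) ^ 2 := by gcongr
      _ = _ := by ring
  have h3 : (4 : ℝ) ^ 6 * (W * a ^ 10 * b ^ 8 * Λ ^ 2) ≤ τ ^ 6 * D ^ 6 := by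
    rw [← hK6, ← mul_pow, ← mul_pow]; gcongr
  have h4 : 1 ≤ 4 ^ 5 * Λ ^ 4 := by
    calc (1 : ℝ) ≤ 4 ^ 5 * (1 / 2) ^ 4 := by norm_num
      _ ≤ _ := by gcongr
  have h5 : 0 < D ^ 6 * (a ^ 10 * b ^ 8 * τ ^ 4) := by positivity
  refine le_of_mul_le_mul_right ?_ h5
  calc 2 * (N * W) * (D ^ 6 * (a ^ 10 * b ^ 8 * τ ^ 4))
      = 2 * W * D ^ 6 * a ^ 10 * b ^ 8 * (N * τ ^ 4) := by ring
    _ ≤ 2 * W * D ^ 6 * a ^ 10 * b ^ 8 * (2 * D ^ 2) := by gcongr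
    _ = 4 * W * a ^ 10 * b ^ 8 * D ^ 8 * 1 := by ring
    _ ≤ 4 * W * a ^ 10 * b ^ 8 * D ^ 8 * (4 ^ 5 * Λ ^ 4) := by gcongr
    _ = D ^ 8 * Λ ^ 2 * (4 ^ 6 * (W * a ^ 10 * b ^ 8 * Λ ^ 2)) := by ring
    _ ≤ P ^ 2 * a ^ 10 * b ^ 8 * (τ ^ 6 * D ^ 6) := by gcongr
    _ = _ := by ring

theorem sq_mul_pow_le_of_energy {a r D Λ W K : ℝ} (ha : 2 ≤ a) (hr : 0 < r) (hD : 0 ≤ D)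
    (hΛ : 1 / 2 ≤ Λ) (hK : 0 ≤ K) (hK6 : K ^ 6 = W * a ^ 10 * (r ^ 2) ^ 8 * Λ ^ 2)
    (hW : a * r ^ 2 ≤ W) (h : a * (r ^ 2) ^ 4 ≤ D ^ 2) : a ^ 2 * r ^ 7 ≤ K * D := by
  have ha0 : 0 < a := by linarith
  have hΛ0 : 0 < Λ := by linarith
  refine (pow_le_pow_iff_left₀ (by positivity) (by positivity) (by norm_num : (6 : ℕ) ≠ 0)).1 ?_
  have hW0 : 0 ≤ W := le_trans (by positivity) hW
  have h1 : 1 ≤ a * Λ := by nlinarith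
  calc (a ^ 2 * r ^ 7) ^ 6 = a ^ 12 * r ^ 42 * 1 ^ 2 := by ring
    _ ≤ a ^ 12 * r ^ 42 * (a * Λ) ^ 2 := by gcongr
    _ = (a * r ^ 2) * a ^ 10 * (r ^ 2) ^ 8 * Λ ^ 2 * (a * (r ^ 2) ^ 4) ^ 3 := by ring
    _ ≤ W * a ^ 10 * (r ^ 2) ^ 8 * Λ ^ 2 * (D ^ 2) ^ 3 := by gcongr
    _ = _ := by rw [← hK6]; ring

theorem dyadic_terms_of_dichotomy {N τ K X a b Λ W V : ℝ} (hN : 0 ≤ N) (hτ : 0 < τ) (hX : 0 ≤ X)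
    (hK6 : K ^ 6 = W * a ^ 10 * b ^ 8 * Λ ^ 2) (hX2 : X ^ 2 = V * a ^ 5 * b ^ 4 * Λ)
    (h : N ^ 3 * τ ^ 18 ≤ 2 ^ 138 * b ^ 8 * a ^ 10 * Λ ^ 2 * W ∨
      N ^ 2 * τ ^ 10 ≤ 2 ^ 58 * b ^ 4 * a ^ 5 * Λ * V) :
    N * τ ^ 5 ≤ 2 ^ 29 * X + 2 ^ 46 * K ^ 2 / τ := by
  have hX' : 0 ≤ 2 ^ 29 * X := by positivity
  have hK' : 0 ≤ 2 ^ 46 * K ^ 2 := by positivity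
  have hN' : 0 ≤ N * τ ^ 6 := by positivity
  have hN'' : 0 ≤ N * τ ^ 5 := by positivity
  have hKτ : 0 ≤ 2 ^ 46 * K ^ 2 / τ := by positivity
  rcases h with h | h
  · have h1 : N * τ ^ 6 ≤ 2 ^ 46 * K ^ 2 := by
      refine (pow_le_pow_iff_left₀ hN' hK' (by norm_num : (3 : ℕ) ≠ 0)).1 ?_
      have e1 : (N * τ ^ 6) ^ 3 = N ^ 3 * τ ^ 18 := by ring
      have e2 : (2 ^ 46 * K ^ 2) ^ 3 = 2 ^ 138 * K ^ 6 := by ring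
      rw [e1, e2, hK6]
      exact h.trans (le_of_eq (by ring))
    have h2 : N * τ ^ 5 ≤ 2 ^ 46 * K ^ 2 / τ := by
      rw [le_div_iff₀ hτ]
      exact (le_of_eq (by ring)).trans h1
    linarith
  · have h1 : N * τ ^ 5 ≤ 2 ^ 29 * X := by
      refine (pow_le_pow_iff_left₀ hN'' hX' (by norm_num : (2 : ℕ) ≠ 0)).1 ?_
      have e1 : (N * τ ^ 5) ^ 2 = N ^ 2 * τ ^ 10 := by ring
      have e2 : (2 ^ 29 * X) ^ 2 = 2 ^ 58 * X ^ 2 := by ring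
      rw [e1, e2, hX2]
      exact h.trans (le_of_eq (by ring))
    linarith

end Numerics

section FifthMoment

variable {F : Type*} [Field F]

theorem card_mul_card_le_sqrt_addE (A B : Finset F) :
    (A.card * B.card : ℝ) ≤ √(addE F A A * addE F B B) := by
  refine Real.le_sqrt_of_sq_le ?_
  rw [mul_pow]
  have h1 : (A.card : ℝ) ^ 2 ≤ addE F A A := by exact_mod_cast sq_card_le_addE A
  have h2 : (B.card : ℝ) ^ 2 ≤ addE F B B := by exact_mod_cast sq_card_le_addE B
  gcongr

theorem nPts_le_right {l : F × F} (hl : l.1 ≠ 0) (A B : Finset F) : nPts A B l ≤ B.card := by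
  unfold nPts
  refine Finset.card_le_card_of_injOn Prod.snd ?_ ?_
  · intro q hq
    exact (Finset.mem_product.1 (Finset.mem_filter.1 hq).1).2
  · intro q hq r hr h
    have h1 := (Finset.mem_filter.1 hq).2
    have h2 := (Finset.mem_filter.1 hr).2
    refine Prod.ext (mul_left_cancel₀ hl ?_) h
    linear_combination h1.symm - h2.symm + h

/-- The fifth moment of the incidence numbers of lines that are neither vertical nor horizontal. -/
theorem sum_nPts_pow_five_le [Fintype F] {p : ℕ} [CharP F p] (hF : Fintype.card F = p)
    (A B : Finset F)
    {K X : ℝ} (hK : 0 ≤ K) (hX : 0 ≤ X)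
    (hK6 : K ^ 6 = √(addE F A A * addE F B B) * (A.card : ℝ) ^ 10 * (B.card : ℝ) ^ 8 *
      Real.log A.card ^ 2)
    (hX2 : X ^ 2 = √(mulEbar F A * mulEbar F B) * (A.card : ℝ) ^ 5 * (B.card : ℝ) ^ 4 *
      Real.log A.card)
    (h1 : (Ctuples F 4 A B : ℝ) ^ 2 * Real.log A.card ≤
      (p : ℝ) * (A.card : ℝ) ^ 5 * (B.card : ℝ) ^ 4)
    (h2 : (A.card : ℝ) ^ 5 * (B.card : ℝ) ^ 6 ≤ (p : ℝ) ^ 9) :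
    ∑ l ∈ slantLines A B, (nPts A B l : ℝ) ^ 5 ≤
      2 ^ 51 * (K * √(Ctuples F 4 A B) + X * Real.log A.card) := by
  set a : ℝ := (A.card : ℝ) with ha
  set b : ℝ := (B.card : ℝ) with hb
  set Λ : ℝ := Real.log a with hΛ
  set W : ℝ := √(addE F A A * addE F B B) with hW
  set V : ℝ := √(mulEbar F A * mulEbar F B) with hV
  set D : ℝ := √(Ctuples F 4 A B) with hD
  have hΛ0 : 0 ≤ Λ := Real.log_natCast_nonneg _
  have hD0 : 0 ≤ D := Real.sqrt_nonneg _
  rcases (slantLines A B).eq_empty_or_nonempty with he | ⟨l₀, hl₀⟩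
  · rw [he, Finset.sum_empty]; positivity
  obtain ⟨-, hl₀, hl₂⟩ := Finset.mem_filter.1 hl₀
  have ha2 : 2 ≤ a := by rw [ha]; exact_mod_cast hl₂.trans (nPts_le_left A B l₀)
  have hb2 : 2 ≤ b := by rw [hb]; exact_mod_cast hl₂.trans (nPts_le_right hl₀ A B)
  have ha0 : 0 < a := by linarith
  have hb0 : 0 < b := by linarith
  have hΛ2 : 1 / 2 ≤ Λ := by
    have := Real.log_two_gt_d9
    have h3 : Real.log 2 ≤ Λ := Real.log_le_log (by norm_num) ha2
    linarith
  have hWab : a * b ≤ W := card_mul_card_le_sqrt_addE A B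
  have hW0 : 0 < W := lt_of_lt_of_le (by positivity) hWab
  have hD2 : D ^ 2 = Ctuples F 4 A B := Real.sq_sqrt (Nat.cast_nonneg _)
  have hab4 : a * b ^ 4 ≤ D ^ 2 := by
    rw [hD2, ha, hb]; exact_mod_cast card_mul_pow_le_Ctuples 3 A B
  have hDpos : 0 < D := by
    have : 0 < D ^ 2 := lt_of_lt_of_le (by positivity) hab4
    exact lt_of_le_of_ne hD0 fun h => by rw [← h] at this; norm_num at this
  have hKpos : 0 < K := by
    refine lt_of_le_of_ne hK fun h => ?_
    rw [← h] at hK6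
    have : 0 < W * a ^ 10 * b ^ 8 * Λ ^ 2 := by positivity
    rw [← hK6] at this
    norm_num at this
  have hD4 : D ^ 4 * Λ ≤ p * a ^ 5 * b ^ 4 := by
    have : D ^ 4 = (Ctuples F 4 A B : ℝ) ^ 2 := by rw [← hD2]; ring
    rw [this]; exact h1
  have hr2 : √b ^ 2 = b := Real.sq_sqrt hb0.le
  have hr0 : 0 < √b := Real.sqrt_pos.2 hb0
  have hlow : a ^ 2 * √b ^ 7 ≤ K * D :=
    sq_mul_pow_le_of_energy ha2 hr0 hD0 hΛ2 hK (by rw [hr2]; exact hK6) (by rw [hr2]; exact hWab)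
      (by rw [hr2]; exact hab4)
  have hΔp := two_mul_mul_le_of_energy ha0 hb0 hD0 hΛ2 hK (Nat.cast_nonneg p) hK6 hWab hD4 h2
  set Δ : ℝ := 4 * K / D with hΔ
  have hΔ0 : 0 < Δ := by positivity
  have hΔD : Δ * D = 4 * K := by rw [hΔ]; field_simp
  set T : ℝ := max Δ (4 * √b) with hT
  have hTΔ : Δ ≤ T := le_max_left _ _
  have hTb : 4 * √b ≤ T := le_max_right _ _
  have hT2 : 2 ≤ T := by
    have : 1 ≤ √b := Real.one_le_sqrt.2 (by linarith)
    linarith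
  have hsum4 := sum_nPts_pow_four_le A B
  rw [← hD2] at hsum4
  have hsum2 := sum_slantLines_nPts_sq_le A B
  rw [← ha, ← hb] at hsum2
  have hsmall : ∑ l ∈ (slantLines A B).filter (fun l => ¬ T ≤ nPts A B l),
      (nPts A B l : ℝ) ^ 5 ≤ 2 ^ 8 * (K * D) := by
    calc ∑ l ∈ (slantLines A B).filter (fun l => ¬ T ≤ nPts A B l), (nPts A B l : ℝ) ^ 5
        ≤ ∑ l ∈ (slantLines A B).filter (fun l => ¬ T ≤ nPts A B l),
          (Δ * (nPts A B l : ℝ) ^ 4 + (4 * √b) ^ 3 * (nPts A B l : ℝ) ^ 2) := by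
          refine Finset.sum_le_sum fun l hl => ?_
          have h3 := (Finset.mem_filter.1 hl).2
          have h4 : (0 : ℝ) ≤ nPts A B l := Nat.cast_nonneg _
          rw [not_le, hT, lt_max_iff] at h3
          rcases h3 with h3 | h3
          · have : (nPts A B l : ℝ) ^ 5 ≤ Δ * (nPts A B l : ℝ) ^ 4 := by
              rw [pow_succ' _ 4]; gcongr
            have : 0 ≤ (4 * √b) ^ 3 * (nPts A B l : ℝ) ^ 2 := by positivity
            linarith
          · have : (nPts A B l : ℝ) ^ 5 ≤ (4 * √b) ^ 3 * (nPts A B l : ℝ) ^ 2 := by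
              rw [pow_add _ 3 2]; gcongr
            have : 0 ≤ Δ * (nPts A B l : ℝ) ^ 4 := by positivity
            linarith
      _ ≤ ∑ l ∈ slantLines A B,
          (Δ * (nPts A B l : ℝ) ^ 4 + (4 * √b) ^ 3 * (nPts A B l : ℝ) ^ 2) :=
        Finset.sum_le_sum_of_subset_of_nonneg (Finset.filter_subset _ _)
          fun _ _ _ => by positivity
      _ = Δ * ∑ l ∈ slantLines A B, (nPts A B l : ℝ) ^ 4 +
          (4 * √b) ^ 3 * ∑ l ∈ slantLines A B, (nPts A B l : ℝ) ^ 2 := by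
        rw [Finset.sum_add_distrib, Finset.mul_sum, Finset.mul_sum]
      _ ≤ Δ * (2 * D ^ 2) + (4 * √b) ^ 3 * (2 * (a * b) ^ 2) := by gcongr
      _ = 2 * (Δ * D) * D + 128 * (a ^ 2 * (√b ^ 3 * b ^ 2)) := by ring
      _ = 8 * (K * D) + 128 * (a ^ 2 * √b ^ 7) := by
        rw [hΔD]; nth_rewrite 2 [← hr2]; ring
      _ ≤ 2 ^ 8 * (K * D) := by
        have : 0 ≤ K * D := by positivity
        linarith
  have hlarge := dyadic_sum_le ((slantLines A B).filter fun l => T ≤ nPts A B l)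
    (fun l => (nPts A B l : ℝ)) 5 (X := 2 ^ 29 * X) (Y := 2 ^ 46 * K ^ 2) (a := a) hT2
    (by linarith) (by positivity) (by positivity) (fun l hl => (Finset.mem_filter.1 hl).2)
    (fun l _ => by rw [ha]; exact_mod_cast nPts_le_left A B l) (by
      intro τ hτ
      have hτ0 : 0 < τ := by linarith
      set L := ((slantLines A B).filter fun l => T ≤ nPts A B l).filter
        (fun l => τ ≤ (nPts A B l : ℝ)) with hL
      rcases L.eq_empty_or_nonempty with he | hne
      · rw [he, Finset.card_empty, Nat.cast_zero, zero_mul]; positivity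
      have hLτ : ∀ l ∈ L, τ ≤ nPts A B l := fun l hl => (Finset.mem_filter.1 hl).2
      have hLs : L ⊆ slantLines A B :=
        (Finset.filter_subset _ _).trans (Finset.filter_subset _ _)
      have hN4 : (L.card : ℝ) * τ ^ 4 ≤ 2 * D ^ 2 := by
        refine le_trans ?_ hsum4
        rw [← nsmul_eq_mul, ← Finset.sum_const]
        refine (Finset.sum_le_sum fun l hl => pow_le_pow_left₀ hτ0.le (hLτ l hl) 4).trans ?_
        exact Finset.sum_le_sum_of_subset_of_nonneg hLs fun _ _ _ => by positivity
      have hKτ : 4 * K ≤ τ * D := by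
        rw [← hΔD]; exact mul_le_mul_of_nonneg_right (hTΔ.trans hτ) hD0
      refine dyadic_terms_of_dichotomy (Nat.cast_nonneg _) hτ0 hX hK6 hX2 ?_
      refine card_rich_lines_dichotomy hF A B hne
        (fun l hl => (Finset.mem_filter.1 (hLs hl)).2.1) hLτ (hT2.trans hτ) ?_ ?_ ?_
      · refine le_of_mul_le_mul_right ?_ hDpos
        calc 2 * (a * b) * D = 2 * (a * b * D) := by ring
          _ ≤ 2 * (2 * K * p) := by gcongr
          _ = 4 * K * p := by ring
          _ ≤ τ * D * p := by gcongr
          _ = _ := by ring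
      · calc 16 * b = (4 * √b) ^ 2 := by rw [mul_pow, hr2]; norm_num
          _ ≤ τ ^ 2 := by gcongr; exact hTb.trans hτ
      · exact mul_energy_le_of_threshold ha0 hb0 hDpos hΛ2 hK hK6 hW0.le hD4 hτ0 hKτ hN4)
  have hYT : 2 ^ 46 * K ^ 2 / T ≤ 2 ^ 44 * (K * D) := by
    rw [div_le_iff₀ (by linarith)]
    calc 2 ^ 46 * K ^ 2 = 2 ^ 44 * K * (4 * K) := by ring
      _ = 2 ^ 44 * K * (Δ * D) := by rw [hΔD]
      _ ≤ 2 ^ 44 * K * (T * D) := by gcongr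
      _ = _ := by ring
  rw [← Finset.sum_filter_add_sum_filter_not _ fun l => T ≤ (nPts A B l : ℝ)]
  have hKD : 0 ≤ K * D := by positivity
  have hXΛ : 0 ≤ X * Λ := by positivity
  rw [← hΛ, mul_div_assoc] at hlarge
  linarith

end FifthMoment

theorem stmt1 :
    ∃ C : ℝ, 0 < C ∧ ∀ (p : ℕ) [Fact p.Prime] (A B : Finset (ZMod p)),
      (Ctuples (ZMod p) 4 A B : ℝ) ^ 2 * Real.log A.card ≤
          (p : ℝ) * (A.card : ℝ) ^ 5 * (B.card : ℝ) ^ 4 →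
      (A.card : ℝ) ^ 5 * (B.card : ℝ) ^ 6 ≤ (p : ℝ) ^ 9 →
      (Ctuples (ZMod p) 5 A B : ℝ) - B.card * (A.card : ℝ) ^ 5 - A.card * (B.card : ℝ) ^ 5 ≤
        C * ((B.card : ℝ) * (A.card : ℝ) ^ 4 + (A.card : ℝ) * (B.card : ℝ) ^ 4
          + ((addE (ZMod p) A A : ℝ) * (addE (ZMod p) B B : ℝ)) ^ (1 / 12 : ℝ) *
              (Ctuples (ZMod p) 4 A B : ℝ) ^ (1 / 2 : ℝ) * (A.card : ℝ) ^ (5 / 3 : ℝ) *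
              (B.card : ℝ) ^ (4 / 3 : ℝ) * Real.log A.card ^ (1 / 3 : ℝ)
          + ((mulEbar (ZMod p) A : ℝ) * (mulEbar (ZMod p) B : ℝ)) ^ (1 / 4 : ℝ) *
              (A.card : ℝ) ^ (5 / 2 : ℝ) * (B.card : ℝ) ^ 2 * Real.log A.card ^ (3 / 2 : ℝ)) := by
  refine ⟨2 ^ 51, by positivity, fun p _ A B h1 h2 => ?_⟩
  set a : ℝ := (A.card : ℝ) with ha
  set b : ℝ := (B.card : ℝ) with hb
  set Λ : ℝ := Real.log a with hΛ
  set E : ℝ := (addE (ZMod p) A A : ℝ) * (addE (ZMod p) B B : ℝ) with hE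
  set M : ℝ := (mulEbar (ZMod p) A : ℝ) * (mulEbar (ZMod p) B : ℝ) with hM
  have ha0 : 0 ≤ a := Nat.cast_nonneg _
  have hb0 : 0 ≤ b := Nat.cast_nonneg _
  have hΛ0 : 0 ≤ Λ := Real.log_natCast_nonneg _
  have hE0 : 0 ≤ E := by positivity
  have hM0 : 0 ≤ M := by positivity
  have key := sum_nPts_pow_five_le (p := p) (ZMod.card p) A B
    (K := E ^ (1 / 12 : ℝ) * a ^ (5 / 3 : ℝ) * b ^ (4 / 3 : ℝ) * Λ ^ (1 / 3 : ℝ))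
    (X := M ^ (1 / 4 : ℝ) * a ^ (5 / 2 : ℝ) * b ^ 2 * Λ ^ (1 / 2 : ℝ)) (by positivity)
    (by positivity) (by
      simp only [mul_pow, Real.sqrt_eq_rpow, ← Real.rpow_mul_natCast hE0,
        ← Real.rpow_mul_natCast ha0, ← Real.rpow_mul_natCast hb0, ← Real.rpow_mul_natCast hΛ0]
      norm_num
      rfl) (by
      simp only [mul_pow, Real.sqrt_eq_rpow, ← Real.rpow_mul_natCast hM0,
        ← Real.rpow_mul_natCast ha0, ← Real.rpow_mul_natCast hΛ0]
      norm_num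
      ring) h1 h2
  have h3 : (Ctuples (ZMod p) 5 A B : ℝ) ≤ a * b ^ 5 + b * a ^ 5 +
      ∑ l ∈ slantLines A B, (nPts A B l : ℝ) ^ 5 := by
    rw [ha, hb]
    exact_mod_cast Ctuples_le 4 A B
  have h4 : Λ ^ (3 / 2 : ℝ) = Λ ^ (1 / 2 : ℝ) * Λ := by
    rw [← Real.rpow_add_one' hΛ0 (by norm_num)]; norm_num
  have h5 : 0 ≤ b * a ^ 4 + a * b ^ 4 := by positivity
  rw [h4, ← Real.sqrt_eq_rpow (Ctuples (ZMod p) 4 A B : ℝ)]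
  linarith
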